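/- Max-Cut of random regular graphs: for every ε > 0 there exists an integer γ₀ such that for every integer γ ≥ γ₀, if R_n(γ) is a uniformly random simple γ-regular graph on n vertices, then P( |MaxCut(R_n(γ))/n − (γ/4 + P_*·√(γ/4))| ≤ ε·√γ ) → 1 as n → ∞ along even n > γ. (That is, w.h.p. MaxCut(R_n(γ))/n = γ/4 + P_*√(γ/4) + o_γ(√γ).) -/

import Mathlib

open MeasureTheory Filter Finset

/-- The real value (±1) of a Boolean spin. -/
noncomputable def spin (b : Bool) : ℝ := if b then 1 else -1

/-- The Sherrington–Kirkpatrick Hamiltonian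
`H^SK_n(σ) = -(2n)^{-1/2} Σ_{i,j} J_{ij} σ_i σ_j`. -/
noncomputable def HSK (n : ℕ) (J : Fin n × Fin n → ℝ) (σ : Fin n → Bool) : ℝ :=
  -(Real.sqrt (2 * n))⁻¹ * ∑ p : Fin n × Fin n, J p * spin (σ p.1) * spin (σ p.2)

/-- The law of the i.i.d. standard Gaussian couplings `(J_{ij})`. -/
noncomputable def skMeasure (n : ℕ) : Measure ((Fin n × Fin n) → ℝ) :=
  Measure.pi fun _ => ProbabilityTheory.gaussianReal 0 1

open Classical in
/-- The cut size of the partition `(S, Sᶜ)` in the graph `G`. -/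
noncomputable def cutSize {n : ℕ} (G : SimpleGraph (Fin n)) (S : Finset (Fin n)) : ℕ :=
  ∑ i ∈ S, ∑ j ∈ Sᶜ, if G.Adj i j then 1 else 0

/-- `S` induces a bisection: the sizes of the two parts differ by at most one. -/
def IsBisection {n : ℕ} (S : Finset (Fin n)) : Prop :=
  (n : ℤ) - 1 ≤ 2 * S.card ∧ (2 * S.card : ℤ) ≤ n + 1

/-- Max-Cut: the maximum cut size over all (unconstrained) two-part
partitions of the vertex set. -/
noncomputable def MaxCut {n : ℕ} (G : SimpleGraph (Fin n)) : ℕ :=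
  sSup {k : ℕ | ∃ S : Finset (Fin n), cutSize G S = k}

/-- Probability that a uniformly random element of the (finite) set `A`
lies in the set `B`. -/
noncomputable def probUniform {α : Type*} (A B : Set α) : ℝ :=
  ((A ∩ B).ncard : ℝ) / (A.ncard : ℝ)


open MeasureTheory Filter Finset

/-! ### Part 1: scalar and Gibbs-measure lemmas -/

lemma mc_scalar (b x : ℝ) (hb0 : 0 ≤ b) (hb : b ≤ 1/4) (hx : |x| ≤ 1) :
    |Real.log (Real.cosh b - x * Real.sinh b) - (-b * x + b^2/2 * (1 - x^2))| ≤ 6 * b^3 := by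
  have h1 := Real.exp_bound (x := b) (by rw [abs_of_nonneg hb0]; linarith) (n := 3) (by norm_num)
  have h2 := Real.exp_bound (x := -b) (by rw [abs_neg, abs_of_nonneg hb0]; linarith) (n := 3) (by norm_num)
  simp only [Finset.sum_range_succ, Finset.sum_range_zero, abs_neg, abs_of_nonneg hb0] at h1 h2
  norm_num [Nat.factorial] at h1 h2
  rw [abs_le] at h1 h2
  obtain ⟨r, hr⟩ : ∃ r, r = Real.cosh b - x * Real.sinh b - 1 + x * b - b^2/2 := ⟨_, rfl⟩
  have hb3 : 0 ≤ b^3 := by positivity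
  have hc : |Real.cosh b - 1 - b^2/2| ≤ 2/9 * b^3 := by
    rw [Real.cosh_eq, abs_le]; constructor <;> linarith [h1.1, h1.2, h2.1, h2.2]
  have hs : |Real.sinh b - b| ≤ 2/9 * b^3 := by
    rw [Real.sinh_eq, abs_le]; constructor <;> linarith [h1.1, h1.2, h2.1, h2.2]
  have hr' : |r| ≤ 4/9 * b^3 := by
    have : r = (Real.cosh b - 1 - b^2/2) - x * (Real.sinh b - b) := by rw [hr]; ring
    rw [this]
    calc _ ≤ |Real.cosh b - 1 - b^2/2| + |x * (Real.sinh b - b)| := abs_sub _ _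
      _ ≤ 2/9 * b^3 + 1 * (2/9 * b^3) := by
        rw [abs_mul]
        gcongr
      _ = _ := by ring
  set q := b^2/2 + r with hq
  have hb2 : 0 ≤ b^2 := by positivity
  have hb3' : b^3 ≤ 1/4 * b^2 := by nlinarith
  have hq' : |q| ≤ 5/8 * b^2 := by
    calc |q| ≤ |b^2/2| + |r| := abs_add_le _ _
      _ ≤ b^2/2 + 4/9 * b^3 := by rw [abs_of_nonneg (by positivity)]; gcongr
      _ ≤ _ := by linarith
  have hb2' : b^2 ≤ 1/4 * b := by nlinarith
  set y := -x * b + q with hy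
  have hxb : |x * b| ≤ b := by rw [abs_mul, abs_of_nonneg hb0]; nlinarith
  have hyb : |y| ≤ 6/5 * b := by
    calc |y| ≤ |-x*b| + |q| := abs_add_le _ _
      _ ≤ b + 5/8 * b^2 := by
        gcongr; rw [neg_mul, abs_neg]; exact hxb
      _ ≤ _ := by linarith
  have hyb' : |y| ≤ 3/10 := by linarith
  have harg : Real.cosh b - x * Real.sinh b = 1 - (-y) := by rw [hy, hq, hr]; ring
  have hl := Real.abs_log_sub_add_sum_range_le (x := -y) (by rw [abs_neg]; linarith) 2
  simp only [Finset.sum_range_succ, Finset.sum_range_zero, abs_neg] at hl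
  norm_num at hl
  have hl2 : |y|^3 / (1 - |y|) ≤ 3 * b^3 := by
    rw [div_le_iff₀ (by linarith)]
    have : |y|^3 ≤ (6/5*b)^3 := by gcongr
    nlinarith
  have e : Real.log (Real.cosh b - x * Real.sinh b) - (-b * x + b^2/2 * (1 - x^2))
      = (-y + y^2/2 + Real.log (1 + y)) + r + (x * b * q - q^2/2) := by
    rw [harg, sub_neg_eq_add, hy, hq]; ring
  have h4 : |x * b * q - q^2/2| ≤ b * (5/8*b^2) + (5/8*b^2)^2/2 := by
    calc _ ≤ |x*b*q| + |q^2/2| := abs_sub _ _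
      _ ≤ _ := by
        rw [abs_mul, abs_div, abs_pow, abs_of_pos (show (0:ℝ) < 2 by norm_num)]
        gcongr
  rw [e]
  calc _ ≤ |(-y + y^2/2 + Real.log (1 + y)) + r| + |x * b * q - q^2/2| := abs_add_le _ _
    _ ≤ |-y + y^2/2 + Real.log (1 + y)| + |r| + |x * b * q - q^2/2| := by gcongr; exact abs_add_le _ _
    _ ≤ 3 * b^3 + 4/9 * b^3 + (b * (5/8*b^2) + (5/8*b^2)^2/2) := by
      gcongr
      exact hl.trans hl2
    _ ≤ _ := by nlinarith

section gibbs
variable {α : Type*}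

/-- partition function -/
noncomputable def gZ (B : Finset α) (a : α → ℝ) : ℝ := ∑ σ ∈ B, Real.exp (a σ)
/-- Gibbs average -/
noncomputable def gA (B : Finset α) (a : α → ℝ) (f : α → ℝ) : ℝ :=
  (∑ σ ∈ B, f σ * Real.exp (a σ)) / gZ B a
/-- log partition function -/
noncomputable def gL (B : Finset α) (a : α → ℝ) : ℝ := Real.log (gZ B a)

variable {B : Finset α}

lemma gZ_pos (hB : B.Nonempty) (a : α → ℝ) : 0 < gZ B a :=
  Finset.sum_pos (fun _ _ => Real.exp_pos _) hB

lemma gA_const (hB : B.Nonempty) (a : α → ℝ) (c : ℝ) : gA B a (fun _ => c) = c := by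
  unfold gA
  rw [← Finset.mul_sum]
  exact mul_div_cancel_right₀ _ (gZ_pos hB a).ne'

lemma gA_add (a f g : α → ℝ) : gA B a (fun σ => f σ + g σ) = gA B a f + gA B a g := by
  unfold gA; rw [← add_div, ← Finset.sum_add_distrib]; simp only [add_mul]

lemma gA_sub (a f g : α → ℝ) : gA B a (fun σ => f σ - g σ) = gA B a f - gA B a g := by
  unfold gA; rw [← sub_div, ← Finset.sum_sub_distrib]; simp only [sub_mul]

lemma gA_smul (a f : α → ℝ) (c : ℝ) : gA B a (fun σ => c * f σ) = c * gA B a f := by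
  unfold gA; rw [mul_div, Finset.mul_sum]; simp only [mul_assoc]

lemma gA_sum {ι : Type*} (s : Finset ι) (a : α → ℝ) (f : ι → α → ℝ) :
    gA B a (fun σ => ∑ i ∈ s, f i σ) = ∑ i ∈ s, gA B a (f i) := by
  unfold gA; rw [← Finset.sum_div, Finset.sum_comm]; simp only [Finset.sum_mul]

lemma gA_mono (a f g : α → ℝ) (h : ∀ σ ∈ B, f σ ≤ g σ) : gA B a f ≤ gA B a g := by
  unfold gA gZ
  apply div_le_div_of_nonneg_right _ (Finset.sum_nonneg fun _ _ => (Real.exp_pos _).le)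
  exact Finset.sum_le_sum fun σ hσ => mul_le_mul_of_nonneg_right (h σ hσ) (Real.exp_pos _).le

lemma gA_abs_le (hB : B.Nonempty) (a f : α → ℝ) (c : ℝ) (h : ∀ σ ∈ B, |f σ| ≤ c) :
    |gA B a f| ≤ c := by
  rw [abs_le]
  constructor
  · rw [← gA_const hB a (-c)]
    exact gA_mono _ _ _ fun σ hσ => (abs_le.mp (h σ hσ)).1
  · rw [← gA_const hB a c]
    exact gA_mono _ _ _ fun σ hσ => (abs_le.mp (h σ hσ)).2

lemma gZ_add (hB : B.Nonempty) (a g : α → ℝ) :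
    gZ B (fun σ => a σ + g σ) = gZ B a * gA B a (fun σ => Real.exp (g σ)) := by
  unfold gA
  rw [mul_div_cancel₀ _ (gZ_pos hB a).ne']
  unfold gZ
  refine Finset.sum_congr rfl fun σ _ => ?_
  rw [Real.exp_add, mul_comm]

lemma gL_add (hB : B.Nonempty) (a g : α → ℝ) :
    gL B (fun σ => a σ + g σ) - gL B a = Real.log (gA B a (fun σ => Real.exp (g σ))) := by
  unfold gL
  have h := gZ_add hB a g
  have h1 := gZ_pos hB a
  have h2 := gZ_pos hB (fun σ => a σ + g σ)
  have h3 : 0 < gA B a (fun σ => Real.exp (g σ)) := by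
    rw [h] at h2; exact pos_of_mul_pos_right h2 h1.le
  rw [h, Real.log_mul h1.ne' h3.ne']; ring

lemma exp_sign (b s : ℝ) (hs : s = 1 ∨ s = -1) :
    Real.exp (-b * s) = Real.cosh b - Real.sinh b * s := by
  rcases hs with rfl | rfl
  · rw [Real.cosh_eq, Real.sinh_eq]; simp; ring
  · rw [Real.cosh_eq, Real.sinh_eq]; simp; ring

lemma sign_abs {s : ℝ} (hs : s = 1 ∨ s = -1) : |s| ≤ 1 := by
  rcases hs with rfl | rfl <;> simp

/-- second-order expansion for adding a single edge -/
lemma gL_edge (hB : B.Nonempty) (a s : α → ℝ) (hs : ∀ σ, s σ = 1 ∨ s σ = -1)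
    (b : ℝ) (hb0 : 0 ≤ b) (hb : b ≤ 1/4) :
    |gL B (fun σ => a σ + -b * s σ) - gL B a
      - (-b * gA B a s + b^2/2 * (1 - (gA B a s)^2))| ≤ 6 * b^3 := by
  rw [gL_add hB]
  have : gA B a (fun σ => Real.exp (-b * s σ)) = Real.cosh b - gA B a s * Real.sinh b := by
    have : (fun σ => Real.exp (-b * s σ)) = fun σ => Real.cosh b - Real.sinh b * s σ := by
      funext σ; exact exp_sign _ _ (hs σ)
    rw [this, gA_sub, gA_const hB, gA_smul, mul_comm]
  rw [this]
  exact mc_scalar _ _ hb0 hb (gA_abs_le hB _ _ _ fun σ _ => sign_abs (hs σ))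

/-- stability of Gibbs averages under adding an edge -/
lemma gA_stab (hB : B.Nonempty) (a s f : α → ℝ) (hs : ∀ σ, s σ = 1 ∨ s σ = -1)
    (hf : ∀ σ, |f σ| ≤ 1)
    (b : ℝ) (hb0 : 0 ≤ b) (hb : b ≤ 1/4) :
    |gA B (fun σ => a σ + -b * s σ) f - gA B a f| ≤ 6 * b := by
  set g : α → ℝ := fun σ => Real.exp (-b * s σ) with hg
  have hg1 : ∀ σ, |g σ - 1| ≤ 5/4 * b := by
    intro σ
    have h1 : |-b * s σ| ≤ b := by
      rw [abs_mul, abs_neg, abs_of_nonneg hb0]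
      have := sign_abs (hs σ); nlinarith
    have h2 := Real.abs_exp_sub_one_sub_id_le (x := -b * s σ) (by linarith)
    have h3 : (-b * s σ)^2 ≤ b^2 := by
      rw [← sq_abs]; gcongr
    calc |g σ - 1| = |(g σ - 1 - (-b * s σ)) + (-b * s σ)| := by ring_nf
      _ ≤ _ + _ := abs_add_le _ _
      _ ≤ b^2 + b := by gcongr; exact h2.trans h3
      _ ≤ _ := by nlinarith
  have hden : |gA B a g - 1| ≤ 5/4 * b := by
    have : gA B a g - 1 = gA B a (fun σ => g σ - 1) := by rw [gA_sub, gA_const hB]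
    rw [this]; exact gA_abs_le hB _ _ _ fun σ _ => hg1 σ
  have hnum : |gA B a (fun σ => f σ * g σ) - gA B a f| ≤ 5/4 * b := by
    rw [← gA_sub]
    refine gA_abs_le hB _ _ _ fun σ _ => ?_
    rw [show f σ * g σ - f σ = f σ * (g σ - 1) by ring, abs_mul]
    have := hf σ; have := hg1 σ; nlinarith [abs_nonneg (f σ), abs_nonneg (g σ - 1)]
  have hdpos : 1/2 ≤ gA B a g := by rw [abs_le] at hden; linarith [hden.1]
  have hx : |gA B a f| ≤ 1 := gA_abs_le hB _ _ _ fun σ _ => hf σ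
  have key : gA B (fun σ => a σ + -b * s σ) f = gA B a (fun σ => f σ * g σ) / gA B a g := by
    rw [gA, gZ_add hB]
    have hz := (gZ_pos hB a).ne'
    have : ∑ σ ∈ B, f σ * Real.exp (a σ + -b * s σ) = gZ B a * gA B a (fun σ => f σ * g σ) := by
      rw [gA, mul_div_cancel₀ _ hz]
      refine Finset.sum_congr rfl fun σ _ => ?_
      rw [Real.exp_add]; ring
    rw [this, mul_div_mul_left _ _ hz]
  rw [key]
  have : gA B a (fun σ => f σ * g σ) / gA B a g - gA B a f
      = ((gA B a (fun σ => f σ * g σ) - gA B a f) - gA B a f * (gA B a g - 1)) / gA B a g := by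
    field_simp; ring
  rw [this, abs_div, abs_of_pos (by linarith : 0 < gA B a g), div_le_iff₀ (by linarith)]
  calc _ ≤ |gA B a (fun σ => f σ * g σ) - gA B a f| + |gA B a f * (gA B a g - 1)| := abs_sub _ _
    _ ≤ 5/4 * b + 1 * (5/4*b) := by rw [abs_mul]; gcongr
    _ ≤ _ := by nlinarith

lemma gL_ge (a : α → ℝ) {σ : α} (hσ : σ ∈ B) : a σ ≤ gL B a := by
  unfold gL gZ
  rw [Real.le_log_iff_exp_le (Finset.sum_pos (fun _ _ => Real.exp_pos _) ⟨σ, hσ⟩)]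
  exact Finset.single_le_sum (f := fun σ => Real.exp (a σ)) (fun _ _ => (Real.exp_pos _).le) hσ

lemma gL_le (hB : B.Nonempty) (a : α → ℝ) (m : ℝ) (h : ∀ σ ∈ B, a σ ≤ m) :
    gL B a ≤ m + Real.log B.card := by
  unfold gL
  have hc : (0:ℝ) < B.card := by exact_mod_cast hB.card_pos
  rw [Real.log_le_iff_le_exp (gZ_pos hB a), Real.exp_add, Real.exp_log hc]
  unfold gZ
  calc _ ≤ ∑ σ ∈ B, Real.exp m := Finset.sum_le_sum fun σ hσ => Real.exp_le_exp.mpr (h σ hσ)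
    _ = _ := by rw [Finset.sum_const, nsmul_eq_mul, mul_comm]

lemma gL_abs_le (hB : B.Nonempty) (a : α → ℝ) (m : ℝ) (h : ∀ σ ∈ B, |a σ| ≤ m) :
    |gL B a| ≤ m + Real.log B.card := by
  have hc : (1:ℝ) ≤ B.card := by exact_mod_cast hB.card_pos
  rw [abs_le]
  constructor
  · obtain ⟨σ, hσ⟩ := hB
    have := gL_ge a hσ
    have := (abs_le.mp (h σ hσ)).1
    have := Real.log_nonneg hc
    linarith
  · exact gL_le hB a m fun σ hσ => (abs_le.mp (h σ hσ)).2

end gibbs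

open MeasureTheory Filter Finset
set_option linter.unusedSectionVars false
set_option linter.unusedDecidableInType false

/-! ### Part 2: Gaussian calculus -/

lemma gauss_integrable_id : Integrable (fun x : ℝ => x) (ProbabilityTheory.gaussianReal 0 1) :=
  (ProbabilityTheory.memLp_id_gaussianReal (μ := 0) (v := 1) 1).integrable (by norm_num)

lemma gauss_pdf_deriv (x : ℝ) :
    HasDerivAt (fun x => -ProbabilityTheory.gaussianPDFReal 0 1 x)
      (x * ProbabilityTheory.gaussianPDFReal 0 1 x) x := by
  unfold ProbabilityTheory.gaussianPDFReal
  have h : HasDerivAt (fun x : ℝ => -(x - 0)^2 / (2 * ((1 : NNReal) : ℝ))) (-x) x := by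
    have := (((hasDerivAt_id x).sub_const (0:ℝ)).pow 2).neg.div_const (2 * ((1 : NNReal) : ℝ))
    refine this.congr_deriv ?_
    simp; ring
  have := ((h.exp).const_mul ((Real.sqrt (2 * Real.pi * ((1:NNReal):ℝ)))⁻¹)).neg
  refine this.congr_deriv ?_
  ring

lemma gauss_integrable_iff (f : ℝ → ℝ) (hf : Integrable f (ProbabilityTheory.gaussianReal 0 1)) :
    Integrable (fun x => ProbabilityTheory.gaussianPDFReal 0 1 x * f x) := by
  rw [ProbabilityTheory.gaussianReal_of_var_ne_zero _ one_ne_zero] at hf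
  rw [integrable_withDensity_iff_integrable_smul'
    (ProbabilityTheory.measurable_gaussianPDF 0 1)
    (Filter.Eventually.of_forall fun x => ProbabilityTheory.gaussianPDF_lt_top)] at hf
  simpa [ProbabilityTheory.toReal_gaussianPDF] using hf

lemma gauss_stein (g g' : ℝ → ℝ) (hg : ∀ x, HasDerivAt g (g' x) x)
    (i1 : Integrable (fun x => x * g x) (ProbabilityTheory.gaussianReal 0 1))
    (i2 : Integrable g' (ProbabilityTheory.gaussianReal 0 1))
    (i3 : Integrable g (ProbabilityTheory.gaussianReal 0 1)) :
    ∫ x, x * g x ∂(ProbabilityTheory.gaussianReal 0 1)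
      = ∫ x, g' x ∂(ProbabilityTheory.gaussianReal 0 1) := by
  rw [ProbabilityTheory.integral_gaussianReal_eq_integral_smul one_ne_zero,
    ProbabilityTheory.integral_gaussianReal_eq_integral_smul one_ne_zero]
  have j1 := gauss_integrable_iff _ i1
  have j2 := gauss_integrable_iff _ i2
  have j3 := gauss_integrable_iff _ i3
  have := integral_mul_deriv_eq_deriv_mul_of_integrable (u := g) (u' := g')
    (v := fun x => -ProbabilityTheory.gaussianPDFReal 0 1 x)
    (v' := fun x => x * ProbabilityTheory.gaussianPDFReal 0 1 x)
    (fun x _ => hg x) (fun x _ => gauss_pdf_deriv x)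
    (by convert j1 using 1; funext x; simp; ring)
    (by convert j2.neg using 1; funext x; simp; ring)
    (by convert j3.neg using 1; funext x; simp; ring)
  simp only [smul_eq_mul]
  calc _ = ∫ x, g x * (x * ProbabilityTheory.gaussianPDFReal 0 1 x) := by
        congr 1; funext x; ring
    _ = _ := this
    _ = _ := by
      rw [← integral_neg]; congr 1; funext x; ring

/-- product Gaussian measure -/
noncomputable abbrev gm (ι : Type*) [Fintype ι] : Measure (ι → ℝ) :=
  Measure.pi fun _ => ProbabilityTheory.gaussianReal 0 1

section pi
variable {ι : Type*} [Fintype ι] [DecidableEq ι]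

lemma gm_update_mp (p : ι) :
    MeasurePreserving (fun z : (ι → ℝ) × ℝ => Function.update z.1 p z.2)
      ((gm ι).prod (ProbabilityTheory.gaussianReal 0 1)) (gm ι) := by
  have hm : Measurable (fun z : (ι → ℝ) × ℝ => Function.update z.1 p z.2) := by
    rw [measurable_pi_iff]
    intro i
    by_cases h : i = p
    · subst h; simp only [Function.update_self]; fun_prop
    · simp only [Function.update_of_ne h]; fun_prop
  refine ⟨hm, ?_⟩
  symm
  apply Measure.pi_eq
  intro s hs
  rw [Measure.map_apply hm (MeasurableSet.univ_pi hs)]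
  have : (fun z : (ι → ℝ) × ℝ => Function.update z.1 p z.2) ⁻¹' Set.pi Set.univ s
      = (Set.pi Set.univ (Function.update s p Set.univ)) ×ˢ s p := by
    ext ⟨x, y⟩
    simp only [Set.mem_preimage, Set.mem_pi, Set.mem_univ, true_implies, Set.mem_prod]
    constructor
    · intro h
      refine ⟨fun i => ?_, by simpa using h p⟩
      by_cases hi : i = p
      · subst hi; simp
      · simpa [hi] using h i
    · rintro ⟨h1, h2⟩ i
      by_cases hi : i = p
      · subst hi; simpa using h2
      · simpa [hi] using h1 i
  rw [this, Measure.prod_prod, Measure.pi_pi]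
  rw [← Finset.mul_prod_erase _ _ (Finset.mem_univ p),
    ← Finset.mul_prod_erase _ (fun i => (ProbabilityTheory.gaussianReal 0 1) (s i)) (Finset.mem_univ p)]
  rw [Function.update_self, measure_univ, one_mul, mul_comm]
  congr 1
  refine Finset.prod_congr rfl fun i hi => ?_
  rw [Function.update_of_ne (Finset.ne_of_mem_erase hi)]

lemma gm_integral_update (p : ι) (f : (ι → ℝ) → ℝ) (hf : Integrable f (gm ι)) :
    ∫ J, f J ∂(gm ι)
      = ∫ x, ∫ y, f (Function.update x p y) ∂(ProbabilityTheory.gaussianReal 0 1) ∂(gm ι) := by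
  have mp := gm_update_mp (ι := ι) p
  have hf' : Integrable (fun z : (ι → ℝ) × ℝ => f (Function.update z.1 p z.2))
      ((gm ι).prod (ProbabilityTheory.gaussianReal 0 1)) := mp.integrable_comp_of_integrable hf
  rw [← integral_prod _ hf']
  have := integral_map (f := f) mp.measurable.aemeasurable (by rw [mp.map_eq]; exact hf.aestronglyMeasurable)
  rw [mp.map_eq] at this
  exact this

lemma gm_integrable_eval (p : ι) : Integrable (fun J : ι → ℝ => J p) (gm ι) :=
  integrable_comp_eval (μ := fun _ : ι => ProbabilityTheory.gaussianReal 0 1)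
    (f := fun x => x) gauss_integrable_id

variable {α : Type*} {B : Finset α}

lemma gZ_hasDerivAt (A h f : α → ℝ) (y : ℝ) :
    HasDerivAt (fun y => ∑ σ ∈ B, f σ * Real.exp (A σ + y * h σ))
      (∑ σ ∈ B, (f σ * h σ) * Real.exp (A σ + y * h σ)) y := by
  apply HasDerivAt.fun_sum
  intro σ _
  have := ((((hasDerivAt_id y).mul_const (h σ)).const_add (A σ)).exp).const_mul (f σ)
  refine this.congr_deriv ?_
  simp; ring

lemma gL_hasDerivAt (hB : B.Nonempty) (A h : α → ℝ) (y : ℝ) :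
    HasDerivAt (fun y => gL B (fun σ => A σ + y * h σ)) (gA B (fun σ => A σ + y * h σ) h) y := by
  unfold gL gA gZ
  have h1 := gZ_hasDerivAt (B := B) A h (fun _ => 1) y
  simp only [one_mul] at h1
  exact h1.log (gZ_pos hB _).ne'

lemma gA_hasDerivAt (hB : B.Nonempty) (A h f : α → ℝ) (y : ℝ) :
    HasDerivAt (fun y => gA B (fun σ => A σ + y * h σ) f)
      (gA B (fun σ => A σ + y * h σ) (fun σ => f σ * h σ)
        - gA B (fun σ => A σ + y * h σ) f * gA B (fun σ => A σ + y * h σ) h) y := by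
  have h1 := gZ_hasDerivAt (B := B) A h (fun _ => 1) y
  simp only [one_mul] at h1
  have h2 := gZ_hasDerivAt (B := B) A h f y
  have hz := (gZ_pos hB (fun σ => A σ + y * h σ)).ne'
  have := h2.div h1 hz
  unfold gA
  refine this.congr_deriv ?_
  unfold gZ at hz ⊢
  generalize (∑ x ∈ B, Real.exp (A x + y * h x)) = z at *
  generalize (∑ σ ∈ B, f σ * h σ * Real.exp (A σ + y * h σ)) = z1 at *
  generalize (∑ σ ∈ B, f σ * Real.exp (A σ + y * h σ)) = z2 at *
  generalize (∑ x ∈ B, h x * Real.exp (A x + y * h x)) = z3 at *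
  field_simp

variable (s : α → ι → ℝ)

/-- linear field -/
noncomputable def lf (s : α → ι → ℝ) (J : ι → ℝ) (σ : α) : ℝ := ∑ p, J p * s σ p

lemma lf_cont (σ : α) : Continuous (fun J : ι → ℝ => lf s J σ) := by
  unfold lf; fun_prop

lemma gZf_cont (A f : α → ℝ) (r : ℝ) :
    Continuous (fun J : ι → ℝ => ∑ σ ∈ B, f σ * Real.exp (A σ + r * lf s J σ)) := by
  have := lf_cont s
  fun_prop

lemma gL_cont (hB : B.Nonempty) (A : α → ℝ) (r : ℝ) :
    Continuous (fun J : ι → ℝ => gL B (fun σ => A σ + r * lf s J σ)) := by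
  have := gZf_cont (B := B) s A (fun _ => 1) r
  simp only [one_mul] at this
  unfold gL gZ
  exact this.log fun J => (gZ_pos hB _).ne'

lemma gA_cont (hB : B.Nonempty) (A f : α → ℝ) (r : ℝ) :
    Continuous (fun J : ι → ℝ => gA B (fun σ => A σ + r * lf s J σ) f) := by
  have := gZf_cont (B := B) s A (fun _ => 1) r
  simp only [one_mul] at this
  unfold gA gZ
  exact (gZf_cont s A f r).div this fun J => (gZ_pos hB _).ne'

lemma lf_abs (hs : ∀ σ p, s σ p = 1 ∨ s σ p = -1) (J : ι → ℝ) (σ : α) :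
    |lf s J σ| ≤ ∑ p, |J p| := by
  unfold lf
  refine (Finset.abs_sum_le_sum_abs _ _).trans (Finset.sum_le_sum fun p _ => ?_)
  rw [abs_mul]
  have := sign_abs (hs σ p); nlinarith [abs_nonneg (J p)]

lemma gm_integrable_abs_sum : Integrable (fun J : ι → ℝ => ∑ p, |J p|) (gm ι) :=
  integrable_finsetSum _ fun p _ => (gm_integrable_eval p).abs

lemma gL_integrable (hB : B.Nonempty) (hs : ∀ σ p, s σ p = 1 ∨ s σ p = -1) (A : α → ℝ) (r : ℝ) :
    Integrable (fun J : ι → ℝ => gL B (fun σ => A σ + r * lf s J σ)) (gm ι) := by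
  obtain ⟨m, hm⟩ : ∃ m : ℝ, ∀ σ ∈ B, |A σ| ≤ m :=
    ⟨∑ σ ∈ B, |A σ|, fun σ hσ => Finset.single_le_sum (f := fun σ => |A σ|) (fun _ _ => abs_nonneg _) hσ⟩
  have hi : Integrable (fun J : ι → ℝ => (m + |r| * ∑ p, |J p|) + Real.log B.card) (gm ι) :=
    ((integrable_const m).add ((gm_integrable_abs_sum).const_mul _)).add (integrable_const _)
  refine hi.mono' (gL_cont s hB A r).aestronglyMeasurable (ae_of_all _ fun J => ?_)
  rw [Real.norm_eq_abs]
  apply gL_abs_le hB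
  intro σ hσ
  refine (abs_add_le _ _).trans (add_le_add (hm σ hσ) ?_)
  rw [abs_mul]
  exact mul_le_mul_of_nonneg_left (lf_abs s hs J σ) (abs_nonneg _)

lemma gA_integrable (hB : B.Nonempty) (A f : α → ℝ) (r : ℝ) (hf : ∀ σ, |f σ| ≤ 1) :
    Integrable (fun J : ι → ℝ => gA B (fun σ => A σ + r * lf s J σ) f) (gm ι) := by
  refine (integrable_const (1:ℝ)).mono' (gA_cont s hB A f r).aestronglyMeasurable
    (ae_of_all _ fun J => ?_)
  exact gA_abs_le hB _ _ _ fun σ _ => hf σ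

lemma gA_sq_integrable (hB : B.Nonempty) (A f : α → ℝ) (r : ℝ) (hf : ∀ σ, |f σ| ≤ 1) :
    Integrable (fun J : ι → ℝ => 1 - (gA B (fun σ => A σ + r * lf s J σ) f)^2) (gm ι) := by
  have hc := gA_cont s hB A f r
  refine (integrable_const (1:ℝ)).mono' (by fun_prop : Continuous _).aestronglyMeasurable
    (ae_of_all _ fun J => ?_)
  have h := gA_abs_le hB (fun σ => A σ + r * lf s J σ) _ _ fun σ _ => hf σ
  have h2 : (gA B (fun σ => A σ + r * lf s J σ) f)^2 ≤ 1 := by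
    rw [← sq_abs]; exact pow_le_one₀ (abs_nonneg _) h
  rw [Real.norm_eq_abs, abs_le]; constructor <;> nlinarith [sq_nonneg (gA B (fun σ => A σ + r * lf s J σ) f)]

lemma lf_update (J : ι → ℝ) (p : ι) (y : ℝ) (σ : α) :
    lf s (Function.update J p y) σ = lf s J σ - J p * s σ p + y * s σ p := by
  unfold lf
  rw [← Finset.add_sum_erase _ _ (Finset.mem_univ p),
    ← Finset.add_sum_erase _ (fun p => J p * s σ p) (Finset.mem_univ p)]
  rw [Function.update_self]
  have : ∑ q ∈ univ.erase p, Function.update J p y q * s σ q = ∑ q ∈ univ.erase p, J q * s σ q :=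
    Finset.sum_congr rfl fun q hq => by rw [Function.update_of_ne (Finset.ne_of_mem_erase hq)]
  rw [this]; ring

lemma gm_ibp (hB : B.Nonempty) (hs : ∀ σ p, s σ p = 1 ∨ s σ p = -1) (A : α → ℝ) (r : ℝ) (p : ι) :
    ∫ J, J p * gA B (fun σ => A σ + r * lf s J σ) (fun σ => s σ p) ∂(gm ι)
      = r * ∫ J, (1 - (gA B (fun σ => A σ + r * lf s J σ) (fun σ => s σ p))^2) ∂(gm ι) := by
  have hf : ∀ σ, |s σ p| ≤ 1 := fun σ => sign_abs (hs σ p)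
  have hinteg : Integrable (fun J => J p * gA B (fun σ => A σ + r * lf s J σ) (fun σ => s σ p)) (gm ι) := by
    refine (gm_integrable_eval p).abs.mono'
      ((continuous_apply p).mul (gA_cont s hB A _ r)).aestronglyMeasurable (ae_of_all _ fun J => ?_)
    rw [Real.norm_eq_abs, abs_mul]
    have := gA_abs_le hB (fun σ => A σ + r * lf s J σ) _ _ fun σ _ => hf σ
    nlinarith [abs_nonneg (J p)]
  rw [← integral_const_mul, gm_integral_update p _ hinteg,
    gm_integral_update p _ ((gA_sq_integrable s hB A _ r hf).const_mul r)]
  congr 1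
  funext x
  simp only [Function.update_self]
  have e : ∀ y, (fun σ => A σ + r * lf s (Function.update x p y) σ)
      = fun σ => (A σ + r * (lf s x σ - x p * s σ p)) + y * (r * s σ p) := by
    intro y; funext σ; rw [lf_update]; ring
  have hd : ∀ y, HasDerivAt (fun y => gA B (fun σ => A σ + r * lf s (Function.update x p y) σ) (fun σ => s σ p))
      (r * (1 - (gA B (fun σ => A σ + r * lf s (Function.update x p y) σ) (fun σ => s σ p))^2)) y := by
    intro y
    simp only [e]
    refine (gA_hasDerivAt hB (fun σ => (A σ + r * (lf s x σ - x p * s σ p))) (fun σ => r * s σ p)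
      (fun σ => s σ p) y).congr_deriv ?_
    rw [gA_smul]
    have : (fun σ => s σ p * (r * s σ p)) = fun _ => r := by
      funext σ; rcases hs σ p with h | h <;> rw [h] <;> ring
    rw [this, gA_const hB]; ring
  have hc : Continuous fun y => gA B (fun σ => A σ + r * lf s (Function.update x p y) σ) (fun σ => s σ p) :=
    continuous_iff_continuousAt.mpr fun y => (hd y).continuousAt
  have hb : ∀ y, |gA B (fun σ => A σ + r * lf s (Function.update x p y) σ) (fun σ => s σ p)| ≤ 1 :=
    fun y => gA_abs_le hB _ _ _ fun σ _ => hf σ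
  apply gauss_stein _ _ hd
  · refine gauss_integrable_id.abs.mono' (continuous_id.mul hc).aestronglyMeasurable (ae_of_all _ fun y => ?_)
    rw [Real.norm_eq_abs, abs_mul]
    nlinarith [abs_nonneg y, hb y]
  · refine (integrable_const (|r|)).mono' (by fun_prop : Continuous _).aestronglyMeasurable (ae_of_all _ fun y => ?_)
    rw [Real.norm_eq_abs, abs_mul]
    have h1 := hb y
    have h2 : |1 - (gA B (fun σ => A σ + r * lf s (Function.update x p y) σ) (fun σ => s σ p))^2| ≤ 1 := by
      rw [← sq_abs]
      rw [abs_le]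
      constructor <;> nlinarith [abs_nonneg (gA B (fun σ => A σ + r * lf s (Function.update x p y) σ) (fun σ => s σ p))]
    nlinarith [abs_nonneg r]
  · exact (integrable_const (1:ℝ)).mono' hc.aestronglyMeasurable (ae_of_all _ fun y => hb y)

/-- derivative of Gaussian free energy in the scale -/
lemma gG_hasDerivAt (hB : B.Nonempty) (hs : ∀ σ p, s σ p = 1 ∨ s σ p = -1) (A : α → ℝ) (r : ℝ) :
    HasDerivAt (fun r => ∫ J, gL B (fun σ => A σ + r * lf s J σ) ∂(gm ι))
      (r * ∑ p, ∫ J, (1 - (gA B (fun σ => A σ + r * lf s J σ) (fun σ => s σ p))^2) ∂(gm ι)) r := by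
  have key := hasDerivAt_integral_of_dominated_loc_of_deriv_le (μ := gm ι)
    (F := fun r J => gL B (fun σ => A σ + r * lf s J σ))
    (F' := fun r J => gA B (fun σ => A σ + r * lf s J σ) (fun σ => lf s J σ))
    (x₀ := r) (s := Set.univ) (bound := fun J => ∑ p, |J p|) Filter.univ_mem
    (Filter.Eventually.of_forall fun x => (gL_cont s hB A x).aestronglyMeasurable)
    (gL_integrable s hB hs A r)
    (by
      have h1 := gZf_cont (B := B) s A (fun _ => 1) r
      simp only [one_mul] at h1
      have h2 : Continuous (fun J : ι → ℝ => ∑ σ ∈ B, lf s J σ * Real.exp (A σ + r * lf s J σ)) := by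
        have := lf_cont s
        fun_prop
      unfold gA gZ
      exact (h2.div h1 fun J => (gZ_pos hB _).ne').aestronglyMeasurable)
    (ae_of_all _ fun J x _ => gA_abs_le hB _ _ _ fun σ _ => lf_abs s hs J σ)
    gm_integrable_abs_sum
    (ae_of_all _ fun J x _ => gL_hasDerivAt hB A (fun σ => lf s J σ) x)
  refine key.2.congr_deriv ?_
  have e : ∀ J, gA B (fun σ => A σ + r * lf s J σ) (fun σ => lf s J σ)
      = ∑ p, J p * gA B (fun σ => A σ + r * lf s J σ) (fun σ => s σ p) := by
    intro J
    have : (fun σ => lf s J σ) = fun σ => ∑ p, J p * s σ p := rfl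
    conv_lhs => rw [show gA B (fun σ => A σ + r * lf s J σ) (fun σ => lf s J σ) = gA B (fun σ => A σ + r * lf s J σ) (fun σ => ∑ p, J p * s σ p) from rfl]
    rw [gA_sum]
    refine Finset.sum_congr rfl fun p _ => ?_
    rw [gA_smul]
  simp only [e]
  rw [integral_finsetSum]
  · rw [Finset.mul_sum]
    exact Finset.sum_congr rfl fun p _ => gm_ibp s hB hs A r p
  · intro p _
    refine (gm_integrable_eval p).abs.mono'
      ((continuous_apply p).mul (gA_cont s hB A _ r)).aestronglyMeasurable (ae_of_all _ fun J => ?_)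
    rw [Real.norm_eq_abs, abs_mul]
    have := gA_abs_le hB (fun σ => A σ + r * lf s J σ) _ _ fun σ _ => sign_abs (hs σ p)
    nlinarith [abs_nonneg (J p)]

end pi

open MeasureTheory Filter Finset
set_option linter.unusedSectionVars false

/-! ### Part 3: permutation averages and the configuration model -/

section pE
variable {α : Type*} [Fintype α]

/-- uniform average -/
noncomputable def pE (f : α → ℝ) : ℝ := (∑ a, f a) / Fintype.card α

lemma pE_add (f g : α → ℝ) : pE (fun a => f a + g a) = pE f + pE g := by
  unfold pE; rw [Finset.sum_add_distrib, add_div]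

lemma pE_sub (f g : α → ℝ) : pE (fun a => f a - g a) = pE f - pE g := by
  unfold pE; rw [Finset.sum_sub_distrib, sub_div]

lemma pE_smul (c : ℝ) (f : α → ℝ) : pE (fun a => c * f a) = c * pE f := by
  unfold pE; rw [← Finset.mul_sum, mul_div_assoc]

lemma pE_div (f : α → ℝ) (c : ℝ) : pE (fun a => f a / c) = pE f / c := by
  unfold pE; rw [← Finset.sum_div, div_right_comm]

lemma pE_sum {ι : Type*} (s : Finset ι) (f : ι → α → ℝ) :
    pE (fun a => ∑ i ∈ s, f i a) = ∑ i ∈ s, pE (f i) := by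
  unfold pE; rw [Finset.sum_comm, ← Finset.sum_div]

lemma pE_const [Nonempty α] (c : ℝ) : pE (fun _ : α => c) = c := by
  unfold pE
  rw [Finset.sum_const, nsmul_eq_mul, Finset.card_univ]
  have : (Fintype.card α : ℝ) ≠ 0 := by exact_mod_cast Fintype.card_ne_zero
  field_simp

lemma pE_mono {f g : α → ℝ} (h : ∀ a, f a ≤ g a) : pE f ≤ pE g := by
  unfold pE
  exact div_le_div_of_nonneg_right (Finset.sum_le_sum fun a _ => h a) (Nat.cast_nonneg _)

lemma pE_abs_le [Nonempty α] {f : α → ℝ} {c : ℝ} (h : ∀ a, |f a| ≤ c) : |pE f| ≤ c := by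
  rw [abs_le]
  constructor
  · rw [← pE_const (α := α) (-c)]; exact pE_mono fun a => (abs_le.mp (h a)).1
  · rw [← pE_const (α := α) c]; exact pE_mono fun a => (abs_le.mp (h a)).2

lemma pE_equiv (e : α ≃ α) (f : α → ℝ) : pE (fun a => f (e a)) = pE f := by
  unfold pE; rw [Equiv.sum_comp e f]

end pE

section sym
variable {P : Type*} [Fintype P] [DecidableEq P]

lemma pE_mul_right (θ : Equiv.Perm P) (f : Equiv.Perm P → ℝ) :
    pE (fun π => f (π * θ)) = pE f := pE_equiv (Equiv.mulRight θ) f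

lemma exists_two_perm (R : Finset P) {x y a b : P} (hx : x ∈ R) (hy : y ∈ R) (hxy : x ≠ y)
    (ha : a ∈ R) (hb : b ∈ R) (hab : a ≠ b) :
    ∃ θ : Equiv.Perm P, θ x = a ∧ θ y = b ∧ ∀ z ∉ R, θ z = z := by
  refine ⟨Equiv.swap x a * Equiv.swap y (Equiv.swap x a b), ?_, ?_, ?_⟩
  · have h1 : x ≠ Equiv.swap x a b := by
      intro h
      have := congrArg (Equiv.swap x a) h
      rw [Equiv.swap_apply_left, Equiv.swap_apply_self] at this
      exact hab this
    rw [Equiv.Perm.mul_apply, Equiv.swap_apply_of_ne_of_ne hxy h1, Equiv.swap_apply_left]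
  · rw [Equiv.Perm.mul_apply, Equiv.swap_apply_left, Equiv.swap_apply_self]
  · intro z hz
    have hzx : z ≠ x := fun h => hz (h ▸ hx)
    have hzy : z ≠ y := fun h => hz (h ▸ hy)
    have hza : z ≠ a := fun h => hz (h ▸ ha)
    have hzb : z ≠ b := fun h => hz (h ▸ hb)
    have h2 : z ≠ Equiv.swap x a b := by
      intro h
      have : Equiv.swap x a z = b := by rw [h]; simp
      rw [Equiv.swap_apply_of_ne_of_ne hzx hza] at this
      exact hzb this
    rw [Equiv.Perm.mul_apply, Equiv.swap_apply_of_ne_of_ne hzy h2, Equiv.swap_apply_of_ne_of_ne hzx hza]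

lemma pE_sym2 (R : Finset P) {x y : P} (hx : x ∈ R) (hy : y ∈ R) (hxy : x ≠ y)
    (Φ : Equiv.Perm P → ℝ) (Ψ : Equiv.Perm P → P → P → ℝ)
    (h : ∀ π θ : Equiv.Perm P, (∀ z ∉ R, θ z = z) → Φ (π * θ) = Ψ π (θ x) (θ y)) :
    (R.card : ℝ) * (R.card - 1) * pE Φ
      = pE (fun π => ∑ a ∈ R, ∑ b ∈ R.erase a, Ψ π a b) := by
  rw [pE_sum]
  have : ∀ a ∈ R, pE (fun π => ∑ b ∈ R.erase a, Ψ π a b) = (R.card - 1 : ℝ) * pE Φ := by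
    intro a ha
    rw [pE_sum]
    have : ∀ b ∈ R.erase a, pE (fun π => Ψ π a b) = pE Φ := by
      intro b hb
      obtain ⟨θ, h1, h2, h3⟩ := exists_two_perm R hx hy hxy ha (Finset.mem_of_mem_erase hb)
        (Finset.ne_of_mem_erase hb).symm
      rw [← pE_mul_right θ Φ]
      congr 1; funext π
      rw [h π θ h3, h1, h2]
    rw [Finset.sum_congr rfl this, Finset.sum_const, nsmul_eq_mul, Finset.card_erase_of_mem ha,
      Nat.cast_sub (Finset.card_pos.mpr ⟨a, ha⟩), Nat.cast_one]
  rw [Finset.sum_congr rfl this, Finset.sum_const, nsmul_eq_mul]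
  ring

variable {V : Type*} [Fintype V] [DecidableEq V]

/-- degree in a set of positions -/
noncomputable def dR (u : P → V) (R : Finset P) (i : V) : ℝ := ((R.filter (fun a => u a = i)).card : ℝ)

lemma dR_sum (u : P → V) (R : Finset P) (f : V → ℝ) :
    ∑ a ∈ R, f (u a) = ∑ i, dR u R i * f i := by
  rw [← Finset.sum_fiberwise R u]
  refine Finset.sum_congr rfl fun i _ => ?_
  rw [Finset.sum_congr rfl (g := fun _ => f i) (fun a ha => by rw [(Finset.mem_filter.mp ha).2]),
    Finset.sum_const, nsmul_eq_mul, dR]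

lemma dR_total (u : P → V) (R : Finset P) : ∑ i, dR u R i = R.card := by
  have := dR_sum u R (fun _ => 1)
  simp at this
  exact this.symm

lemma dR_nonneg (u : P → V) (R : Finset P) (i : V) : 0 ≤ dR u R i := Nat.cast_nonneg _

lemma dR_sq (u : P → V) (R : Finset P) :
    ∑ i, (dR u R i)^2 = R.card + ∑ a ∈ R, ∑ b ∈ R.erase a, (if u a = u b then (1:ℝ) else 0) := by
  have h1 : ∀ i, (dR u R i)^2 = dR u R i * dR u R i := fun i => by ring
  simp only [h1]
  rw [← dR_sum u R (fun i => dR u R i)]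
  have : ∀ a ∈ R, dR u R (u a) = 1 + ∑ b ∈ R.erase a, (if u a = u b then (1:ℝ) else 0) := by
    intro a ha
    have h2 : dR u R (u a) = ∑ b ∈ R, (if u a = u b then (1:ℝ) else 0) := by
      rw [dR, Finset.sum_ite]; simp [eq_comm]
    rw [h2, ← Finset.add_sum_erase _ _ ha]; simp
  rw [Finset.sum_congr rfl this, Finset.sum_add_distrib]; simp

variable (w : P → V) (γ : ℕ)

lemma collide_prob (hw : ∀ i, (univ.filter (fun x => w x = i)).card = γ) {a b : P} (hab : a ≠ b) :
    ((Fintype.card P : ℝ) - 1) * pE (fun π : Equiv.Perm P => if w (π a) = w (π b) then (1:ℝ) else 0)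
      = γ - 1 := by
  have h1 : ∀ b' ∈ univ.erase a, pE (fun π : Equiv.Perm P => if w (π a) = w (π b') then (1:ℝ) else 0)
      = pE (fun π : Equiv.Perm P => if w (π a) = w (π b) then (1:ℝ) else 0) := by
    intro b' hb'
    rw [← pE_mul_right (Equiv.swap b b') (fun π : Equiv.Perm P => if w (π a) = w (π b) then (1:ℝ) else 0)]
    congr 1; funext π
    rw [Equiv.Perm.mul_apply, Equiv.Perm.mul_apply, Equiv.swap_apply_left,
      Equiv.swap_apply_of_ne_of_ne hab (Finset.ne_of_mem_erase hb').symm]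
  have h2 : ∀ π : Equiv.Perm P, ∑ b' ∈ univ.erase a, (if w (π a) = w (π b') then (1:ℝ) else 0) = γ - 1 := by
    intro π
    have h3 := Finset.add_sum_erase univ (fun b' => if w (π a) = w (π b') then (1:ℝ) else 0) (Finset.mem_univ a)
    have h4 : ∑ b', (if w (π a) = w (π b') then (1:ℝ) else 0) = γ := by
      rw [Equiv.sum_comp π (fun b' => if w (π a) = w b' then (1:ℝ) else 0)]
      rw [← hw (w (π a))]
      simp [eq_comm]
    rw [h4] at h3
    simp only [if_true] at h3
    linarith
  have h5 : pE (fun π : Equiv.Perm P => ∑ b' ∈ univ.erase a, (if w (π a) = w (π b') then (1:ℝ) else 0)) = γ - 1 := by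
    simp only [h2]; exact pE_const _
  rw [pE_sum, Finset.sum_congr rfl h1, Finset.sum_const, nsmul_eq_mul, Finset.card_erase_of_mem (Finset.mem_univ a),
    Nat.cast_sub (Finset.card_pos.mpr ⟨a, Finset.mem_univ a⟩), Nat.cast_one, Finset.card_univ] at h5
  exact h5

lemma card_pos_eq (hw : ∀ i, (univ.filter (fun x => w x = i)).card = γ) :
    Fintype.card P = Fintype.card V * γ := by
  rw [← Finset.card_univ, Finset.card_eq_sum_card_fiberwise (f := w) (t := univ) (by intro x _; simp)]
  simp [hw]

/-- variance of the residual degrees -/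
lemma dR_var (hw : ∀ i, (univ.filter (fun x => w x = i)).card = γ) (hγ : 1 ≤ γ) (R : Finset P)
    (hR : 2 ≤ R.card) (hV : 0 < Fintype.card V) :
    pE (fun π : Equiv.Perm P => ∑ i, (dR (fun x => w (π x)) R i - R.card / Fintype.card V)^2) ≤ R.card := by
  set n : ℝ := ((Fintype.card V : ℕ) : ℝ) with hn
  set D : ℝ := ((R.card : ℕ) : ℝ) with hD
  have hn0 : 0 < n := by rw [hn]; exact_mod_cast hV
  have hD2 : 2 ≤ D := by rw [hD]; exact_mod_cast hR
  have hN : (Fintype.card P : ℝ) = n * γ := by rw [card_pos_eq w γ hw]; push_cast; rfl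
  have hDN : D ≤ n * γ := by rw [← hN, hD]; exact_mod_cast Finset.card_le_univ R
  have hg1 : (1:ℝ) ≤ γ := by exact_mod_cast hγ
  have e1 : ∀ π : Equiv.Perm P, ∑ i, (dR (fun x => w (π x)) R i - D / n)^2
      = (D + ∑ a ∈ R, ∑ b ∈ R.erase a, (if w (π a) = w (π b) then (1:ℝ) else 0)) - D^2/n := by
    intro π
    rw [← dR_sq (fun x => w (π x)) R]
    have : ∀ i, (dR (fun x => w (π x)) R i - D / n)^2
      = (dR (fun x => w (π x)) R i)^2 - 2*(D/n) * dR (fun x => w (π x)) R i + (D/n)^2 := fun i => by ring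
    simp only [this]
    rw [Finset.sum_add_distrib, Finset.sum_sub_distrib, ← Finset.mul_sum, dR_total, Finset.sum_const,
      Finset.card_univ, nsmul_eq_mul, ← hn, ← hD]
    field_simp; ring
  simp only [e1]
  rw [pE_sub, pE_add, pE_const, pE_const, pE_sum]
  have h2 : ∀ a ∈ R, pE (fun π : Equiv.Perm P => ∑ b ∈ R.erase a, (if w (π a) = w (π b) then (1:ℝ) else 0))
      ≤ (D - 1) * (1/n) := by
    intro a ha
    rw [pE_sum]
    have : ∀ b ∈ R.erase a, pE (fun π : Equiv.Perm P => (if w (π a) = w (π b) then (1:ℝ) else 0)) ≤ 1/n := by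
      intro b hb
      have := collide_prob w γ hw (Finset.ne_of_mem_erase hb).symm
      rw [hN] at this
      have h3 : 0 < n * γ - 1 := by linarith
      have h4 : pE (fun π : Equiv.Perm P => (if w (π a) = w (π b) then (1:ℝ) else 0)) = (γ - 1)/(n*γ-1) := by
        rw [eq_div_iff h3.ne', mul_comm]; exact this
      rw [h4, div_le_div_iff₀ h3 hn0]
      have : 1 ≤ n := by rw [hn]; exact_mod_cast hV
      nlinarith
    refine (Finset.sum_le_sum this).trans ?_
    rw [Finset.sum_const, nsmul_eq_mul, Finset.card_erase_of_mem ha,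
      Nat.cast_sub (Finset.card_pos.mpr ⟨a, ha⟩), Nat.cast_one]
  have h3 := Finset.sum_le_sum h2
  rw [Finset.sum_const, nsmul_eq_mul] at h3
  have h4 : D * ((D - 1) * (1/n)) ≤ D^2/n := by
    rw [show D * ((D - 1) * (1/n)) = (D*(D-1))/n by ring]
    gcongr; nlinarith
  linarith

/-- expected total variation distance -/
lemma dR_tv (hw : ∀ i, (univ.filter (fun x => w x = i)).card = γ) (hγ : 1 ≤ γ) (R : Finset P)
    (hR : 2 ≤ R.card) (hV : 0 < Fintype.card V) :
    pE (fun π : Equiv.Perm P => ∑ i, |dR (fun x => w (π x)) R i / R.card - 1 / Fintype.card V|)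
      ≤ Real.sqrt (Fintype.card V / R.card) := by
  have hv := dR_var w γ hw hγ R hR hV
  set n : ℝ := ((Fintype.card V : ℕ) : ℝ) with hn
  set D : ℝ := ((R.card : ℕ) : ℝ) with hD
  have hn0 : 0 < n := by rw [hn]; exact_mod_cast hV
  have hD2 : 2 ≤ D := by rw [hD]; exact_mod_cast hR
  have hD0 : 0 < D := by linarith
  set s := Real.sqrt (n / D) with hs
  have hs0 : 0 < s := Real.sqrt_pos.mpr (by positivity)
  have hs2 : s^2 = n/D := Real.sq_sqrt (by positivity)
  -- |z| ≤ (θ + z²/θ)/2 with θ = s / n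
  have e : ∀ π : Equiv.Perm P, ∑ i, |dR (fun x => w (π x)) R i / D - 1 / n|
      ≤ s/2 + (n/(2*s*D^2)) * ∑ i, (dR (fun x => w (π x)) R i - D / n)^2 := by
    intro π
    have : ∀ i, |dR (fun x => w (π x)) R i / D - 1 / n| ≤ s/(2*n) + (n/(2*s*D^2)) * (dR (fun x => w (π x)) R i - D / n)^2 := by
      intro i
      set z := dR (fun x => w (π x)) R i / D - 1 / n with hz
      have h1 : dR (fun x => w (π x)) R i - D / n = D * z := by rw [hz]; field_simp
      rw [h1]
      have h2 : s/(2*n) + (n/(2*s*D^2)) * (D*z)^2 - |z| = n/(2*s) * (|z| - s/n)^2 := by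
        have : (D*z)^2 = D^2 * |z|^2 := by rw [sq_abs]; ring
        rw [this]; field_simp; ring
      have h3 : 0 ≤ n/(2*s) * (|z| - s/n)^2 := by positivity
      linarith
    refine (Finset.sum_le_sum fun i _ => this i).trans ?_
    rw [Finset.sum_add_distrib, ← Finset.mul_sum, Finset.sum_const, Finset.card_univ, nsmul_eq_mul, ← hn]
    have : n * (s/(2*n)) = s/2 := by field_simp
    rw [this]
  refine (pE_mono e).trans ?_
  rw [pE_add, pE_const, pE_smul]
  have : (n/(2*s*D^2)) * pE (fun π : Equiv.Perm P => ∑ i, (dR (fun x => w (π x)) R i - D / n)^2) ≤ (n/(2*s*D^2)) * D := by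
    gcongr
  have h5 : (n/(2*s*D^2)) * D = s/2 := by
    have : n = s^2 * D := by rw [hs2]; field_simp
    rw [this]; field_simp
  linarith

end sym

open MeasureTheory Filter Finset
set_option linter.unusedSectionVars false

/-! ### Part 4: one-edge step -/

lemma spin_pm (b : Bool) : spin b = 1 ∨ spin b = -1 := by cases b <;> simp [spin]
lemma spin_sq (b : Bool) : spin b * spin b = 1 := by cases b <;> simp [spin]
lemma spin2_pm (b c : Bool) : spin b * spin c = 1 ∨ spin b * spin c = -1 := by
  cases b <;> cases c <;> simp [spin]

lemma pE_abs_le_pE {α : Type*} [Fintype α] {f g : α → ℝ} (h : ∀ a, |f a| ≤ g a) : |pE f| ≤ pE g := by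
  rw [abs_le]
  constructor
  · have := pE_mono (f := fun a => -1 * g a) (g := f) fun a => by linarith [(abs_le.mp (h a)).1]
    rw [pE_smul] at this; linarith
  · exact pE_mono fun a => (abs_le.mp (h a)).2

section step
variable {P : Type*} [Fintype P] [DecidableEq P] {V : Type*} [Fintype V] [DecidableEq V]
variable (w : P → V) (γ : ℕ) {B : Finset (V → Bool)}

noncomputable def gX (B : Finset (V → Bool)) (a : (V → Bool) → ℝ) (i j : V) : ℝ :=
  gA B a (fun σ => spin (σ i) * spin (σ j))

lemma gX_abs (hB : B.Nonempty) (a : (V → Bool) → ℝ) (i j : V) : |gX B a i j| ≤ 1 :=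
  gA_abs_le hB a _ 1 fun σ _ => sign_abs (spin2_pm _ _)

lemma gX_self (hB : B.Nonempty) (a : (V → Bool) → ℝ) (i : V) : gX B a i i = 1 := by
  unfold gX; simp only [spin_sq]; exact gA_const hB a 1

lemma gX_sum (hB : B.Nonempty) (a : (V → Bool) → ℝ) (u : P → V) (R : Finset P) :
    ∑ x ∈ R, ∑ y ∈ R.erase x, gX B a (u x) (u y)
      = gA B a (fun σ => (∑ x ∈ R, spin (σ (u x)))^2) - R.card := by
  have h1 : gA B a (fun σ => (∑ x ∈ R, spin (σ (u x)))^2) = ∑ x ∈ R, ∑ y ∈ R, gX B a (u x) (u y) := by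
    have : ∀ σ : V → Bool, (∑ x ∈ R, spin (σ (u x)))^2 = ∑ x ∈ R, ∑ y ∈ R, spin (σ (u x)) * spin (σ (u y)) := by
      intro σ; rw [sq, Finset.sum_mul_sum]
    simp only [this]
    rw [gA_sum]
    refine Finset.sum_congr rfl fun x _ => ?_
    rw [gA_sum]; rfl
  rw [h1]
  have h2 : ∀ x ∈ R, ∑ y ∈ R, gX B a (u x) (u y) = 1 + ∑ y ∈ R.erase x, gX B a (u x) (u y) := by
    intro x hx
    rw [← Finset.add_sum_erase _ _ hx, gX_self hB]
  rw [Finset.sum_congr rfl h2, Finset.sum_add_distrib]; simp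

variable {R : Finset P} {x y : P} (a : Equiv.Perm P → (V → Bool) → ℝ)

lemma step_sym (hx : x ∈ R) (hy : y ∈ R) (hxy : x ≠ y)
    (ha : ∀ π θ : Equiv.Perm P, (∀ z ∉ R, θ z = z) → a (π * θ) = a π) (F : ℝ → ℝ) :
    (R.card : ℝ) * (R.card - 1) * pE (fun π => F (gX B (a π) (w (π x)) (w (π y))))
      = pE (fun π => ∑ p ∈ R, ∑ q ∈ R.erase p, F (gX B (a π) (w (π p)) (w (π q)))) := by
  refine pE_sym2 R hx hy hxy _ (fun π p q => F (gX B (a π) (w (π p)) (w (π q)))) ?_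
  intro π θ h
  simp only [ha π θ h, Equiv.Perm.mul_apply]

lemma two_le_card (hx : x ∈ R) (hy : y ∈ R) (hxy : x ≠ y) : 2 ≤ R.card :=
  Finset.one_lt_card.mpr ⟨x, hx, y, hy, hxy⟩

lemma step_lin_ge (hB : B.Nonempty) (hx : x ∈ R) (hy : y ∈ R) (hxy : x ≠ y)
    (ha : ∀ π θ : Equiv.Perm P, (∀ z ∉ R, θ z = z) → a (π * θ) = a π) :
    -(1 / ((R.card : ℝ) - 1)) ≤ pE (fun π => gX B (a π) (w (π x)) (w (π y))) := by
  have h := step_sym (B := B) w a hx hy hxy ha id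
  simp only [id] at h
  have h2 : -(R.card : ℝ) ≤ pE (fun π => ∑ p ∈ R, ∑ q ∈ R.erase p, gX B (a π) (w (π p)) (w (π q))) := by
    rw [← pE_const (α := Equiv.Perm P) (-(R.card : ℝ))]
    refine pE_mono fun π => ?_
    rw [gX_sum hB (a π) (fun x => w (π x)) R]
    have : 0 ≤ gA B (a π) (fun σ => (∑ x ∈ R, spin (σ (w (π x))))^2) := by
      rw [← gA_const hB (a π) 0]; exact gA_mono _ _ _ fun σ _ => sq_nonneg _
    linarith
  rw [← h] at h2
  have hD : (2:ℝ) ≤ R.card := by exact_mod_cast two_le_card hx hy hxy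
  set D : ℝ := ((R.card : ℕ) : ℝ)
  set X := pE (fun π => gX B (a π) (w (π x)) (w (π y)))
  have h3 : 0 < D - 1 := by linarith
  rw [← neg_div, div_le_iff₀ h3]
  nlinarith

lemma step_lin_le (hw : ∀ i, (univ.filter (fun x => w x = i)).card = γ) (hγ : 1 ≤ γ)
    (hV : 0 < Fintype.card V)
    (hB : B.Nonempty) (hx : x ∈ R) (hy : y ∈ R) (hxy : x ≠ y)
    (ha : ∀ π θ : Equiv.Perm P, (∀ z ∉ R, θ z = z) → a (π * θ) = a π)
    (L : ℝ) (hL : ∀ σ ∈ B, (∑ i, spin (σ i))^2 ≤ L) :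
    pE (fun π => gX B (a π) (w (π x)) (w (π y)))
      ≤ 2 * Fintype.card V / ((R.card : ℝ) - 1) + 4 * L / (Fintype.card V : ℝ)^2 := by
  have h := step_sym (B := B) w a hx hy hxy ha id
  simp only [id] at h
  have hc := two_le_card hx hy hxy
  have hv := dR_var w γ hw hγ R hc hV
  have hD : (2:ℝ) ≤ R.card := by exact_mod_cast hc
  set n : ℝ := ((Fintype.card V : ℕ) : ℝ) with hn
  set D : ℝ := ((R.card : ℕ) : ℝ) with hDD
  have hn0 : 0 < n := by rw [hn]; exact_mod_cast hV
  have hL0 : 0 ≤ L := by obtain ⟨σ, hσ⟩ := hB; exact (sq_nonneg _).trans (hL σ hσ)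
  have h2 : pE (fun π => ∑ p ∈ R, ∑ q ∈ R.erase p, gX B (a π) (w (π p)) (w (π q)))
      ≤ pE (fun π : Equiv.Perm P => 2 * n * (∑ i, (dR (fun x => w (π x)) R i - D / n)^2) + 2 * (D/n)^2 * L) := by
    refine pE_mono fun π => ?_
    rw [gX_sum hB (a π) (fun x => w (π x)) R]
    have : gA B (a π) (fun σ => (∑ x ∈ R, spin (σ (w (π x))))^2)
        ≤ 2 * n * (∑ i, (dR (fun x => w (π x)) R i - D / n)^2) + 2 * (D/n)^2 * L := by
      rw [← gA_const hB (a π) (2 * n * (∑ i, (dR (fun x => w (π x)) R i - D / n)^2) + 2 * (D/n)^2 * L)]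
      refine gA_mono _ _ _ fun σ hσ => ?_
      rw [dR_sum (fun x => w (π x)) R (fun i => spin (σ i))]
      have e1 : ∑ i, dR (fun x => w (π x)) R i * spin (σ i)
          = ∑ i, (dR (fun x => w (π x)) R i - D / n) * spin (σ i) + (D/n) * ∑ i, spin (σ i) := by
        rw [Finset.mul_sum, ← Finset.sum_add_distrib]
        exact Finset.sum_congr rfl fun i _ => by ring
      rw [e1]
      have e2 : (∑ i, (dR (fun x => w (π x)) R i - D / n) * spin (σ i))^2
          ≤ (∑ i, (dR (fun x => w (π x)) R i - D / n)^2) * n := by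
        refine (Finset.sum_mul_sq_le_sq_mul_sq _ _ _).trans_eq ?_
        congr 1
        simp only [sq, spin_sq]; simp [hn]
      have e3 := hL σ hσ
      set S := ∑ i, (dR (fun x => w (π x)) R i - D / n) * spin (σ i)
      set T := ∑ i, spin (σ i)
      have e4 : (S + D/n*T)^2 ≤ 2*S^2 + 2*((D/n)^2*T^2) := by nlinarith [sq_nonneg (S - D/n*T)]
      have e5 : (D/n)^2*T^2 ≤ (D/n)^2*L := by gcongr
      linarith
    linarith
  rw [← h, pE_add, pE_smul, pE_const] at h2
  set X := pE (fun π => gX B (a π) (w (π x)) (w (π y)))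
  have h3 : D * (D-1) * X ≤ 2 * n * D + 2 * (D/n)^2*L := by
    refine h2.trans ?_
    gcongr
  have hd1 : 0 < D - 1 := by linarith
  have hd0 : 0 < D := by linarith
  have h4 : X ≤ (2 * n * D + 2 * (D/n)^2*L) / (D*(D-1)) := by
    rw [le_div_iff₀ (by positivity)]; linarith
  refine h4.trans ?_
  rw [add_div]
  have h5 : 2 * n * D / (D*(D-1)) = 2 * n / (D-1) := by field_simp
  have h6 : 2 * (D/n)^2*L / (D*(D-1)) ≤ 4 * L / n^2 := by
    have : 2 * (D/n)^2*L / (D*(D-1)) = (2 * D * L) / (n^2 * (D-1)) := by field_simp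
    rw [this, div_le_div_iff₀ (by positivity) (by positivity)]
    have : D ≤ 2 * (D-1) := by linarith
    calc 2 * D * L * n^2 = (2 * L * n^2) * D := by ring
      _ ≤ (2 * L * n^2) * (2 * (D-1)) := by gcongr
      _ = _ := by ring
  linarith

lemma tv_sum (n D : ℝ) (hn : (Fintype.card V : ℝ) = n) (hn0 : 0 < n) (hD0 : 0 < D) (d : V → ℝ) (hd : ∀ i, 0 ≤ d i)
    (hdt : ∑ i, d i = D) (Y : V → V → ℝ) (hY0 : ∀ i j, 0 ≤ Y i j) (hY1 : ∀ i j, Y i j ≤ 1) :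
    |(∑ i, ∑ j, d i * d j * Y i j) / D^2 - (∑ i, ∑ j, Y i j)/n^2| ≤ 2 * ∑ i, |d i / D - 1/n| := by
  have e : (∑ i, ∑ j, d i * d j * Y i j) / D^2 - (∑ i, ∑ j, Y i j)/n^2
      = ∑ i, ∑ j, ((d i / D) * (d j / D - 1/n) + (1/n) * (d i / D - 1/n)) * Y i j := by
    rw [Finset.sum_div, Finset.sum_div, ← Finset.sum_sub_distrib]
    refine Finset.sum_congr rfl fun i _ => ?_
    rw [Finset.sum_div, Finset.sum_div, ← Finset.sum_sub_distrib]
    refine Finset.sum_congr rfl fun j _ => ?_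
    field_simp; ring
  rw [e]
  have e1 : ∀ i j, |((d i / D) * (d j / D - 1/n) + (1/n) * (d i / D - 1/n)) * Y i j|
      ≤ (d i / D) * |d j / D - 1/n| + (1/n) * |d i / D - 1/n| := by
    intro i j
    rw [abs_mul, abs_of_nonneg (hY0 i j)]
    have h1 : |(d i / D) * (d j / D - 1/n) + (1/n) * (d i / D - 1/n)|
        ≤ (d i / D) * |d j / D - 1/n| + (1/n) * |d i / D - 1/n| := by
      refine (abs_add_le _ _).trans_eq ?_
      rw [abs_mul, abs_mul, abs_of_nonneg (div_nonneg (hd i) hD0.le), abs_of_nonneg (by positivity : 0 ≤ 1/n)]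
    calc _ ≤ |(d i / D) * (d j / D - 1/n) + (1/n) * (d i / D - 1/n)| * 1 := by
            gcongr; exact hY1 i j
      _ ≤ _ := by rw [mul_one]; exact h1
  refine (Finset.abs_sum_le_sum_abs _ _).trans ?_
  refine (Finset.sum_le_sum fun i _ => (Finset.abs_sum_le_sum_abs _ _).trans
    (Finset.sum_le_sum fun j _ => e1 i j)).trans_eq ?_
  simp only [Finset.sum_add_distrib, ← Finset.mul_sum, Finset.sum_const, Finset.card_univ, nsmul_eq_mul]
  rw [← Finset.sum_mul, ← Finset.sum_div, hdt, hn, ← mul_assoc]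
  rw [div_self hD0.ne', one_div_mul_cancel hn0.ne']; ring

lemma step_quad (hw : ∀ i, (univ.filter (fun x => w x = i)).card = γ) (hγ : 1 ≤ γ)
    (hV : 0 < Fintype.card V)
    (hB : B.Nonempty) (hx : x ∈ R) (hy : y ∈ R) (hxy : x ≠ y)
    (ha : ∀ π θ : Equiv.Perm P, (∀ z ∉ R, θ z = z) → a (π * θ) = a π) :
    |pE (fun π => 1 - (gX B (a π) (w (π x)) (w (π y)))^2)
       - pE (fun π => (∑ i, ∑ j, (1 - (gX B (a π) i j)^2)) / (Fintype.card V : ℝ)^2)|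
      ≤ 2 * Real.sqrt (Fintype.card V / R.card) + 1 / R.card := by
  have h := step_sym (B := B) w a hx hy hxy ha (fun t => 1 - t^2)
  have hc := two_le_card hx hy hxy
  have hv := dR_tv w γ hw hγ R hc hV
  have hD : (2:ℝ) ≤ R.card := by exact_mod_cast hc
  set n : ℝ := ((Fintype.card V : ℕ) : ℝ) with hn
  set D : ℝ := ((R.card : ℕ) : ℝ) with hDD
  have hn0 : 0 < n := by rw [hn]; exact_mod_cast hV
  have hd0 : 0 < D := by linarith
  have hX : ∀ π i j, (gX B (a π) i j)^2 ≤ 1 := fun π i j => by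
    rw [sq_le_one_iff_abs_le_one]; exact gX_abs hB _ _ _
  have e1 : ∀ π : Equiv.Perm P, ∑ p ∈ R, ∑ q ∈ R.erase p, (1 - (gX B (a π) (w (π p)) (w (π q)))^2)
      = ∑ i, ∑ j, dR (fun x => w (π x)) R i * dR (fun x => w (π x)) R j * (1 - (gX B (a π) i j)^2) := by
    intro π
    have : ∀ p ∈ R, ∑ q ∈ R.erase p, (1 - (gX B (a π) (w (π p)) (w (π q)))^2)
        = ∑ j, dR (fun x => w (π x)) R j * (1 - (gX B (a π) (w (π p)) j)^2) := by
      intro p hp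
      rw [← dR_sum (fun x => w (π x)) R (fun j => 1 - (gX B (a π) (w (π p)) j)^2),
        ← Finset.add_sum_erase _ _ hp, gX_self hB]
      ring
    rw [Finset.sum_congr rfl this, dR_sum (fun x => w (π x)) R
      (fun i => ∑ j, dR (fun x => w (π x)) R j * (1 - (gX B (a π) i j)^2))]
    refine Finset.sum_congr rfl fun i _ => ?_
    rw [Finset.mul_sum]
    exact Finset.sum_congr rfl fun j _ => by ring
  simp only [e1] at h
  set U := pE (fun π => 1 - (gX B (a π) (w (π x)) (w (π y)))^2)
  have h2 : |pE (fun π : Equiv.Perm P => (∑ i, ∑ j, dR (fun x => w (π x)) R i * dR (fun x => w (π x)) R j * (1 - (gX B (a π) i j)^2)) / D^2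
      - (∑ i, ∑ j, (1 - (gX B (a π) i j)^2)) / n^2)| ≤ 2 * Real.sqrt (n/D) := by
    have h3 : ∀ π : Equiv.Perm P, |(∑ i, ∑ j, dR (fun x => w (π x)) R i * dR (fun x => w (π x)) R j * (1 - (gX B (a π) i j)^2)) / D^2
      - (∑ i, ∑ j, (1 - (gX B (a π) i j)^2)) / n^2| ≤ 2 * ∑ i, |dR (fun x => w (π x)) R i / D - 1/n| := fun π =>
      tv_sum n D hn.symm hn0 hd0 _ (fun i => dR_nonneg _ _ i) (dR_total _ _) _
        (fun i j => by have := hX π i j; linarith) (fun i j => by nlinarith [sq_nonneg (gX B (a π) i j)])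
    have h4 : pE (fun π : Equiv.Perm P => 2 * ∑ i, |dR (fun x => w (π x)) R i / D - 1/n|) ≤ 2 * Real.sqrt (n/D) := by
      rw [pE_smul]; gcongr
    exact (pE_abs_le_pE h3).trans h4
  rw [pE_sub, pE_div, ← h] at h2
  have hU : |U| ≤ 1 := by
    refine pE_abs_le fun π => ?_
    have := hX π (w (π x)) (w (π y))
    rw [abs_le]; constructor <;> nlinarith [sq_nonneg (gX B (a π) (w (π x)) (w (π y)))]
  have h5 : D * (D-1) * U / D^2 = U - U/D := by field_simp
  rw [h5] at h2
  have h6 : |U / D| ≤ 1/D := by rw [abs_div, abs_of_pos hd0]; gcongr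
  rw [abs_le] at h2 h6 ⊢
  constructor <;> linarith [h2.1, h2.2, h6.1, h6.2]

end step

open MeasureTheory Filter Finset
set_option linter.unusedSectionVars false
set_option linter.unusedVariables false

/-! ### Part 5: interpolation -/

section interp
variable {n K : ℕ}

noncomputable def ev (w : Fin K × Bool → Fin n) (π : Equiv.Perm (Fin K × Bool)) (k : Fin K)
    (σ : Fin n → Bool) : ℝ := spin (σ (w (π (k, false)))) * spin (σ (w (π (k, true))))

noncomputable def aw (w : Fin K × Bool → Fin n) (b : ℝ) (π : Equiv.Perm (Fin K × Bool)) (k : ℕ)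
    (σ : Fin n → Bool) : ℝ := ∑ l : Fin K, if l.val < k then -b * ev w π l σ else 0

noncomputable def sS (σ : Fin n → Bool) (p : Fin n × Fin n) : ℝ := spin (σ p.1) * spin (σ p.2)

lemma sS_pm (σ : Fin n → Bool) (p : Fin n × Fin n) : sS σ p = 1 ∨ sS σ p = -1 := spin2_pm _ _

lemma aw_zero (w : Fin K × Bool → Fin n) (b : ℝ) (π : Equiv.Perm (Fin K × Bool)) (σ : Fin n → Bool) :
    aw w b π 0 σ = 0 := by simp [aw]

lemma aw_succ (w : Fin K × Bool → Fin n) (b : ℝ) (π : Equiv.Perm (Fin K × Bool)) {k : ℕ} (hk : k < K)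
    (σ : Fin n → Bool) : aw w b π (k+1) σ = aw w b π k σ + -b * ev w π ⟨k, hk⟩ σ := by
  unfold aw
  rw [← sub_eq_iff_eq_add', ← Finset.sum_sub_distrib, Finset.sum_eq_single (⟨k, hk⟩ : Fin K)]
  · simp
  · intro l _ hl
    have : l.val ≠ k := fun h => hl (Fin.ext h)
    by_cases h : l.val < k
    · rw [if_pos h, if_pos (by omega), sub_self]
    · rw [if_neg h, if_neg (by omega), sub_self]
  · simp

lemma aw_inv (w : Fin K × Bool → Fin n) (b : ℝ) (k : ℕ) (π θ : Equiv.Perm (Fin K × Bool))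
    (h : ∀ z ∉ univ.filter (fun x : Fin K × Bool => k ≤ x.1.val), θ z = z) (σ : Fin n → Bool) :
    aw w b (π * θ) k σ = aw w b π k σ := by
  unfold aw
  refine Finset.sum_congr rfl fun l _ => ?_
  by_cases hl : l.val < k
  · rw [if_pos hl, if_pos hl]
    unfold ev
    rw [Equiv.Perm.mul_apply, Equiv.Perm.mul_apply, h (l, false) (by simp [hl]), h (l, true) (by simp [hl])]
  · rw [if_neg hl, if_neg hl]

lemma card_tail (k : ℕ) : (univ.filter (fun x : Fin K × Bool => k ≤ x.1.val)).card = 2 * (K - k) := by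
  have h : univ.filter (fun x : Fin K × Bool => k ≤ x.1.val)
      = (univ.filter (fun l : Fin K => k ≤ l.val)) ×ˢ (univ : Finset Bool) := by
    ext ⟨l, c⟩; simp
  rw [h, Finset.card_product, Finset.card_univ, Fintype.card_bool]
  have h2 : (univ.filter (fun l : Fin K => l.val < k)).card = min k K := by
    rw [Fin.card_filter_val_lt, min_comm]
  have h3 := Finset.card_filter_add_card_filter_not (s := (univ : Finset (Fin K))) (fun l : Fin K => l.val < k)
  simp only [not_lt] at h3
  rw [h2, Finset.card_univ, Fintype.card_fin] at h3
  omega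

variable (w : Fin K × Bool → Fin n) (γ : ℕ) {B : Finset (Fin n → Bool)} (b : ℝ)

noncomputable def Qk (B : Finset (Fin n → Bool)) (k : ℕ) (g : (Fin n → Bool) → ℝ) : ℝ :=
  pE (fun π => (∑ i, ∑ j, (1 - (gX B (fun σ => aw w b π k σ + g σ) i j)^2)) / (n : ℝ)^2)

noncomputable def Lk (B : Finset (Fin n → Bool)) (k : ℕ) (g : (Fin n → Bool) → ℝ) : ℝ :=
  pE (fun π => gL B (fun σ => aw w b π k σ + g σ))

noncomputable def errm (b n m : ℝ) : ℝ := b * min 1 (2 * n / m) + 2 * b^2 * Real.sqrt (n / m) + 6 * b^3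

lemma step_expand (hB : B.Nonempty) (hb0 : 0 ≤ b) (hb : b ≤ 1/4) {k : ℕ} (hk : k < K) (g : (Fin n → Bool) → ℝ) :
    |Lk w b B (k+1) g - Lk w b B k g -
      (-b * pE (fun π => gX B (fun σ => aw w b π k σ + g σ) (w (π (⟨k,hk⟩,false))) (w (π (⟨k,hk⟩,true))))
       + b^2/2 * pE (fun π => 1 - (gX B (fun σ => aw w b π k σ + g σ) (w (π (⟨k,hk⟩,false))) (w (π (⟨k,hk⟩,true))))^2))| ≤ 6*b^3 := by
  unfold Lk
  rw [← pE_smul, ← pE_smul, ← pE_add, ← pE_sub, ← pE_sub]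
  refine pE_abs_le fun π => ?_
  have := gL_edge hB (fun σ => aw w b π k σ + g σ) (fun σ => ev w π ⟨k, hk⟩ σ) (fun σ => spin2_pm _ _) b hb0 hb
  have e : (fun σ => aw w b π (k+1) σ + g σ) = fun σ => aw w b π k σ + g σ + -b * ev w π ⟨k, hk⟩ σ := by
    funext σ; rw [aw_succ w b π hk]; ring
  rw [e]
  exact this

lemma Qk_stab (hB : B.Nonempty) (hb0 : 0 ≤ b) (hb : b ≤ 1/4) (hn : 0 < n) {k : ℕ} (hk : k < K) (g : (Fin n → Bool) → ℝ) :
    |Qk w b B (k+1) g - Qk w b B k g| ≤ 12 * b := by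
  unfold Qk
  rw [← pE_sub]
  refine pE_abs_le fun π => ?_
  have e : (fun σ => aw w b π (k+1) σ + g σ) = fun σ => aw w b π k σ + g σ + -b * ev w π ⟨k, hk⟩ σ := by
    funext σ; rw [aw_succ w b π hk]; ring
  rw [e, ← sub_div, ← Finset.sum_sub_distrib]
  simp only [← Finset.sum_sub_distrib]
  have h1 : ∀ i j : Fin n, |(1 - (gX B (fun σ => aw w b π k σ + g σ + -b * ev w π ⟨k, hk⟩ σ) i j)^2)
      - (1 - (gX B (fun σ => aw w b π k σ + g σ) i j)^2)| ≤ 12 * b := by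
    intro i j
    have hs := gA_stab hB (fun σ => aw w b π k σ + g σ) (fun σ => ev w π ⟨k, hk⟩ σ)
      (fun σ => spin (σ i) * spin (σ j)) (fun σ => spin2_pm _ _) (fun σ => sign_abs (spin2_pm _ _)) b hb0 hb
    change |gX B (fun σ => aw w b π k σ + g σ + -b * ev w π ⟨k, hk⟩ σ) i j - gX B (fun σ => aw w b π k σ + g σ) i j| ≤ 6*b at hs
    have ha := gX_abs hB (fun σ => aw w b π k σ + g σ + -b * ev w π ⟨k, hk⟩ σ) i j
    have hc := gX_abs hB (fun σ => aw w b π k σ + g σ) i j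
    set X' := gX B (fun σ => aw w b π k σ + g σ + -b * ev w π ⟨k, hk⟩ σ) i j
    set X := gX B (fun σ => aw w b π k σ + g σ) i j
    have : (1 - X'^2) - (1 - X^2) = -((X' - X) * (X' + X)) := by ring
    rw [this, abs_neg, abs_mul]
    have h2 : |X' + X| ≤ 2 := (abs_add_le _ _).trans (by linarith)
    calc |X' - X| * |X' + X| ≤ (6*b) * 2 := by gcongr
      _ = 12 * b := by ring
  rw [abs_div, abs_of_pos (by positivity : (0:ℝ) < (n:ℝ)^2), div_le_iff₀ (by positivity)]
  refine (Finset.abs_sum_le_sum_abs _ _).trans ?_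
  refine (Finset.sum_le_sum fun i _ => (Finset.abs_sum_le_sum_abs _ _).trans
    (Finset.sum_le_sum fun j _ => h1 i j)).trans_eq ?_
  simp; ring

variable (hw : ∀ i, (univ.filter (fun x => w x = i)).card = γ)

lemma err_aux (hn : 0 < n) {k : ℕ} (hk : k < K) :
    2 * Real.sqrt ((n:ℝ) / ((2 * (K - k) : ℕ) : ℝ)) + 1 / ((2 * (K - k) : ℕ) : ℝ) ≤ 4 * Real.sqrt (n / ((K:ℝ) - k)) := by
  have hm : (1:ℝ) ≤ (K:ℝ) - k := by
    have : (k:ℝ) + 1 ≤ K := by exact_mod_cast hk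
    linarith
  have e : ((2 * (K - k) : ℕ) : ℝ) = 2 * ((K:ℝ) - k) := by rw [Nat.cast_mul, Nat.cast_sub hk.le]; norm_num
  rw [e]
  set m := (K:ℝ) - k
  have hn1 : (1:ℝ) ≤ n := by exact_mod_cast hn
  have h1 : Real.sqrt ((n:ℝ) / (2*m)) ≤ Real.sqrt (n/m) := by
    apply Real.sqrt_le_sqrt
    gcongr; linarith
  have h2 : 1/(2*m) ≤ Real.sqrt (n/m) := by
    apply Real.le_sqrt_of_sq_le
    rw [div_pow, div_le_div_iff₀ (by positivity) (by positivity)]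
    nlinarith
  nlinarith [Real.sqrt_nonneg ((n:ℝ)/m)]

lemma step_up (hw : ∀ i, (univ.filter (fun x => w x = i)).card = γ) (hγ : 1 ≤ γ)
    (hB : B.Nonempty) (hb0 : 0 ≤ b) (hb : b ≤ 1/4) (hn : 0 < n) {k : ℕ} (hk : k < K) (g : (Fin n → Bool) → ℝ) :
    Lk w b B (k+1) g - Lk w b B k g - b^2/2 * Qk w b B k g ≤ errm b n ((K:ℝ) - k) := by
  have h0 := step_expand (B := B) w b hB hb0 hb hk g
  have hx : ((⟨k,hk⟩,false) : Fin K × Bool) ∈ univ.filter (fun x : Fin K × Bool => k ≤ x.1.val) := by simp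
  have hy : ((⟨k,hk⟩,true) : Fin K × Bool) ∈ univ.filter (fun x : Fin K × Bool => k ≤ x.1.val) := by simp
  have hxy : ((⟨k,hk⟩,false) : Fin K × Bool) ≠ (⟨k,hk⟩,true) := by simp
  have ha : ∀ π θ : Equiv.Perm (Fin K × Bool), (∀ z ∉ univ.filter (fun x : Fin K × Bool => k ≤ x.1.val), θ z = z) →
    (fun σ => aw w b (π * θ) k σ + g σ) = (fun σ => aw w b π k σ + g σ) := by
    intro π θ h; funext σ; rw [aw_inv w b k π θ h]
  have h1 := step_lin_ge (B := B) w (fun π σ => aw w b π k σ + g σ) hB hx hy hxy ha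
  have h2 := step_quad (B := B) w γ (fun π σ => aw w b π k σ + g σ) hw hγ (by simpa using hn) hB hx hy hxy ha
  rw [card_tail] at h1 h2
  rw [Fintype.card_fin] at h2
  have h3 := err_aux hn hk
  change |_ - Qk w b B k g| ≤ _ at h2
  have hm : (1:ℝ) ≤ (K:ℝ) - k := by
    have : (k:ℝ) + 1 ≤ K := by exact_mod_cast hk
    linarith
  have e : ((2 * (K - k) : ℕ) : ℝ) = 2 * ((K:ℝ) - k) := by rw [Nat.cast_mul, Nat.cast_sub hk.le]; norm_num
  rw [e] at h1
  unfold errm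
  set U := pE (fun π => 1 - (gX B (fun σ => aw w b π k σ + g σ) (w (π (⟨k,hk⟩,false))) (w (π (⟨k,hk⟩,true))))^2)
  set X := pE (fun π => gX B (fun σ => aw w b π k σ + g σ) (w (π (⟨k,hk⟩,false))) (w (π (⟨k,hk⟩,true))))
  set m := (K:ℝ) - k
  have hn1 : (1:ℝ) ≤ n := by exact_mod_cast hn
  have h4 : 1 / (2*m-1) ≤ min 1 (2*n/m) := by
    apply le_min
    · rw [div_le_one (by linarith)]; linarith
    · rw [div_le_div_iff₀ (by linarith) (by linarith)]; nlinarith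
  have h5 : -b * X ≤ b * min 1 (2*n/m) := by nlinarith
  have h6 : b^2/2 * (U - Qk w b B k g) ≤ b^2/2 * (4 * Real.sqrt (n / m)) := by
    gcongr; linarith [(abs_le.mp h2).2]
  have h7 := (abs_le.mp h0).2
  linarith

lemma step_lo (hw : ∀ i, (univ.filter (fun x => w x = i)).card = γ) (hγ : 1 ≤ γ)
    (hB : B.Nonempty) (hb0 : 0 ≤ b) (hb : b ≤ 1/4) (hn : 0 < n) {k : ℕ} (hk : k < K) (g : (Fin n → Bool) → ℝ)
    (L : ℝ) (hL : ∀ σ ∈ B, (∑ i, spin (σ i))^2 ≤ L) :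
    -(errm b n ((K:ℝ) - k) + b * (4 * L / (n:ℝ)^2)) ≤ Lk w b B (k+1) g - Lk w b B k g - b^2/2 * Qk w b B k g := by
  have h0 := step_expand (B := B) w b hB hb0 hb hk g
  have hx : ((⟨k,hk⟩,false) : Fin K × Bool) ∈ univ.filter (fun x : Fin K × Bool => k ≤ x.1.val) := by simp
  have hy : ((⟨k,hk⟩,true) : Fin K × Bool) ∈ univ.filter (fun x : Fin K × Bool => k ≤ x.1.val) := by simp
  have hxy : ((⟨k,hk⟩,false) : Fin K × Bool) ≠ (⟨k,hk⟩,true) := by simp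
  have ha : ∀ π θ : Equiv.Perm (Fin K × Bool), (∀ z ∉ univ.filter (fun x : Fin K × Bool => k ≤ x.1.val), θ z = z) →
    (fun σ => aw w b (π * θ) k σ + g σ) = (fun σ => aw w b π k σ + g σ) := by
    intro π θ h; funext σ; rw [aw_inv w b k π θ h]
  have h1 := step_lin_le (B := B) w γ (fun π σ => aw w b π k σ + g σ) hw hγ (by simpa using hn) hB hx hy hxy ha L hL
  have h2 := step_quad (B := B) w γ (fun π σ => aw w b π k σ + g σ) hw hγ (by simpa using hn) hB hx hy hxy ha
  rw [card_tail] at h1 h2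
  rw [Fintype.card_fin] at h1 h2
  have h3 := err_aux hn hk
  change |_ - Qk w b B k g| ≤ _ at h2
  have hm : (1:ℝ) ≤ (K:ℝ) - k := by
    have : (k:ℝ) + 1 ≤ K := by exact_mod_cast hk
    linarith
  have e : ((2 * (K - k) : ℕ) : ℝ) = 2 * ((K:ℝ) - k) := by rw [Nat.cast_mul, Nat.cast_sub hk.le]; norm_num
  rw [e] at h1
  have hX1 : pE (fun π => gX B (fun σ => aw w b π k σ + g σ) (w (π (⟨k,hk⟩,false))) (w (π (⟨k,hk⟩,true)))) ≤ 1 :=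
    (abs_le.mp (pE_abs_le fun π => gX_abs hB _ _ _)).2
  unfold errm
  set U := pE (fun π => 1 - (gX B (fun σ => aw w b π k σ + g σ) (w (π (⟨k,hk⟩,false))) (w (π (⟨k,hk⟩,true))))^2)
  set X := pE (fun π => gX B (fun σ => aw w b π k σ + g σ) (w (π (⟨k,hk⟩,false))) (w (π (⟨k,hk⟩,true))))
  set m := (K:ℝ) - k
  have hn1 : (1:ℝ) ≤ n := by exact_mod_cast hn
  have hL0 : 0 ≤ L := by obtain ⟨σ, hσ⟩ := hB; exact (sq_nonneg _).trans (hL σ hσ)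
  have hL1 : 0 ≤ 4 * L / (n:ℝ)^2 := by positivity
  have h4 : 2 * n / (2*m-1) ≤ 2*n/m := by
    gcongr; linarith
  have h45 : X ≤ min 1 (2*n/m) + 4 * L / (n:ℝ)^2 := by
    rcases min_cases 1 (2*(n:ℝ)/m) with h | h <;> rw [h.1] <;> linarith
  have h5 : b * X ≤ b * (min 1 (2*n/m) + 4 * L / (n:ℝ)^2) := by gcongr
  have h6 : b^2/2 * (Qk w b B k g - U) ≤ b^2/2 * (4 * Real.sqrt (n / m)) := by
    gcongr; linarith [(abs_le.mp h2).1]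
  have h7 := (abs_le.mp h0).1
  linarith

end interp

open MeasureTheory Filter Finset
set_option linter.unusedSectionVars false
set_option linter.unusedVariables false

/-! ### Part 6: gaussian interpolation, summing up -/

lemma interp_step (F0 F1 Q0 Q1 : ℝ → ℝ) (A β2 e r0 r1 : ℝ) (hA : 0 ≤ A)
    (h0 : ∀ r, HasDerivAt F0 (r * (A * Q0 r)) r) (h1 : ∀ r, HasDerivAt F1 (r * (A * Q1 r)) r)
    (hr1 : 0 ≤ r1) (hr : r1 < r0) (hd : (r0^2 - r1^2) * A = 2 * β2)
    (he0 : ∀ r, F1 r - F0 r - β2 * Q0 r ≤ e) (he1 : ∀ r, F1 r - F0 r - β2 * Q1 r ≤ e) :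
    F1 r1 - F0 r0 ≤ e := by
  set δ := r0^2 - r1^2 with hδ
  have hδ0 : 0 < δ := by rw [hδ]; nlinarith
  set wt : ℝ → ℝ := fun r => (r^2 - r1^2)/δ with hwt
  have hw' : ∀ r, HasDerivAt wt (2*r/δ) r := by
    intro r
    have := ((hasDerivAt_pow 2 r).sub_const (r1^2)).div_const δ
    refine this.congr_deriv ?_
    norm_num
  set h : ℝ → ℝ := fun r => wt r * F0 r + (1 - wt r) * F1 r + e * wt r with hh
  have hder : ∀ r, HasDerivAt h ((2*r/δ) * F0 r + wt r * (r * (A * Q0 r)) + ((-(2*r/δ)) * F1 r + (1 - wt r) * (r * (A * Q1 r))) + e * (2*r/δ)) r := by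
    intro r
    exact (((hw' r).mul (h0 r)).add (((hw' r).const_sub 1).mul (h1 r))).add ((hw' r).const_mul e)
  have hmono : MonotoneOn h (Set.Icc r1 r0) := by
    apply monotoneOn_of_deriv_nonneg (convex_Icc _ _)
    · exact fun r _ => (hder r).continuousAt.continuousWithinAt
    · exact fun r _ => (hder r).differentiableAt.differentiableWithinAt
    · intro r hr'
      rw [interior_Icc] at hr'
      rw [(hder r).deriv]
      have hr0 : 0 ≤ r := hr1.trans hr'.1.le
      have w0 : 0 ≤ wt r := div_nonneg (by nlinarith [hr'.1]) hδ0.le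
      have w1 : wt r ≤ 1 := by
        rw [hwt]; simp only; rw [div_le_one hδ0, hδ]; nlinarith [hr'.2]
      have hA2 : A = 2 * β2 / δ := by rw [eq_div_iff hδ0.ne', mul_comm]; exact hd
      have e1 := mul_le_mul_of_nonneg_left (he0 r) w0
      have e2 := mul_le_mul_of_nonneg_left (he1 r) (by linarith : 0 ≤ 1 - wt r)
      have : (2*r/δ) * F0 r + wt r * (r * (A * Q0 r)) + ((-(2*r/δ)) * F1 r + (1 - wt r) * (r * (A * Q1 r))) + e * (2*r/δ)
          = (2*r/δ) * (e - (F1 r - F0 r) + β2 * (wt r * Q0 r + (1 - wt r) * Q1 r)) := by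
        rw [hA2]; field_simp; ring
      rw [this]
      apply mul_nonneg (by positivity)
      nlinarith
  have := hmono (Set.left_mem_Icc.mpr hr.le) (Set.right_mem_Icc.mpr hr.le) hr.le
  have w1 : wt r1 = 0 := by simp [hwt]
  have w0 : wt r0 = 1 := by simp [hwt, ← hδ, hδ0.ne']
  simp only [hh, w1, w0] at this
  linarith

section gi
variable {n K : ℕ} (w : Fin K × Bool → Fin n) (γ : ℕ) {B : Finset (Fin n → Bool)} (b : ℝ)

noncomputable def Fk (B : Finset (Fin n → Bool)) (k : ℕ) (r : ℝ) : ℝ :=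
  pE (fun π => ∫ J, gL B (fun σ => aw w b π k σ + r * lf sS J σ) ∂(gm (Fin n × Fin n)))

noncomputable def QFk (B : Finset (Fin n → Bool)) (k : ℕ) (r : ℝ) : ℝ :=
  ∫ J, Qk w b B k (fun σ => r * lf sS J σ) ∂(gm (Fin n × Fin n))

lemma integral_pE {α Ω : Type*} [Fintype α] [MeasurableSpace Ω] (μ : Measure Ω) (f : α → Ω → ℝ)
    (hf : ∀ a, Integrable (f a) μ) : ∫ J, pE (fun a => f a J) ∂μ = pE (fun a => ∫ J, f a J ∂μ) := by
  unfold pE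
  rw [integral_div, integral_finsetSum _ fun a _ => hf a]

lemma integrable_pE {α Ω : Type*} [Fintype α] [MeasurableSpace Ω] (μ : Measure Ω) (f : α → Ω → ℝ)
    (hf : ∀ a, Integrable (f a) μ) : Integrable (fun J => pE (fun a => f a J)) μ := by
  unfold pE
  exact (integrable_finsetSum _ fun a _ => hf a).div_const _

lemma Fk_eq (hB : B.Nonempty) (k : ℕ) (r : ℝ) :
    Fk w b B k r = ∫ J, Lk w b B k (fun σ => r * lf sS J σ) ∂(gm (Fin n × Fin n)) := by
  unfold Fk Lk
  rw [integral_pE _ _ fun π => gL_integrable sS hB sS_pm _ r]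

lemma Lk_integrable (hB : B.Nonempty) (k : ℕ) (r : ℝ) :
    Integrable (fun J => Lk w b B k (fun σ => r * lf sS J σ)) (gm (Fin n × Fin n)) :=
  integrable_pE _ _ fun π => gL_integrable sS hB sS_pm _ r

lemma gXsq_integrable (hB : B.Nonempty) (A : (Fin n → Bool) → ℝ) (r : ℝ) (i j : Fin n) :
    Integrable (fun J => 1 - (gX B (fun σ => A σ + r * lf sS J σ) i j)^2) (gm (Fin n × Fin n)) :=
    (gA_sq_integrable sS hB A (fun σ => spin (σ i) * spin (σ j)) r (fun σ => sign_abs (spin2_pm _ _)))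

lemma Qk_integrable (hB : B.Nonempty) (k : ℕ) (r : ℝ) :
    Integrable (fun J => Qk w b B k (fun σ => r * lf sS J σ)) (gm (Fin n × Fin n)) :=
  integrable_pE _ _ fun π => (integrable_finsetSum _ fun i _ => integrable_finsetSum _ fun j _ =>
    gXsq_integrable hB _ r i j).div_const _

lemma Fk_deriv (hB : B.Nonempty) (hn : 0 < n) (k : ℕ) (r : ℝ) :
    HasDerivAt (Fk w b B k) (r * ((n:ℝ)^2 * QFk w b B k r)) r := by
  have h : ∀ π, HasDerivAt (fun r => ∫ J, gL B (fun σ => aw w b π k σ + r * lf sS J σ) ∂(gm (Fin n × Fin n)))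
     (r * ((n:ℝ)^2 * ∫ J, (∑ i, ∑ j, (1 - (gX B (fun σ => aw w b π k σ + r * lf sS J σ) i j)^2)) / (n : ℝ)^2 ∂(gm (Fin n × Fin n)))) r := by
    intro π
    refine (gG_hasDerivAt sS hB sS_pm (aw w b π k) r).congr_deriv ?_
    rw [integral_div, integral_finsetSum _ fun i _ => integrable_finsetSum _ fun j _ =>
      gXsq_integrable hB _ r i j]
    have hn' : (n:ℝ) ≠ 0 := by positivity
    rw [mul_div_cancel₀ _ (by positivity), Fintype.sum_prod_type]
    congr 1
    refine Finset.sum_congr rfl fun i _ => ?_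
    rw [integral_finsetSum _ fun j _ => gXsq_integrable hB _ r i j]
    rfl
  unfold QFk Qk
  rw [integral_pE _ _ fun π => (integrable_finsetSum _ fun i _ => integrable_finsetSum _ fun j _ =>
    gXsq_integrable hB _ r i j).div_const _, ← pE_smul, ← pE_smul]
  unfold Fk pE
  exact (HasDerivAt.fun_sum fun π _ => h π).div_const _

lemma D1_integrable (hB : B.Nonempty) (k : ℕ) (r : ℝ) :
    Integrable (fun J => Lk w b B (k+1) (fun σ => r * lf sS J σ) - Lk w b B k (fun σ => r * lf sS J σ)) (gm (Fin n × Fin n)) :=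
  (Lk_integrable w b hB _ r).sub (Lk_integrable w b hB _ r)

lemma F_up (hB : B.Nonempty) (k : ℕ) (e : ℝ) (r : ℝ)
    (h : ∀ g, Lk w b B (k+1) g - Lk w b B k g - b^2/2 * Qk w b B k g ≤ e) :
    Fk w b B (k+1) r - Fk w b B k r - b^2/2 * QFk w b B k r ≤ e := by
  rw [Fk_eq w b hB, Fk_eq w b hB, QFk, ← integral_const_mul, ← integral_sub (Lk_integrable w b hB _ r) (Lk_integrable w b hB _ r),
    ← integral_sub (D1_integrable w b hB k r) ((Qk_integrable w b hB k r).const_mul _)]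
  have : ∫ J : Fin n × Fin n → ℝ, e ∂(gm (Fin n × Fin n)) = e := by simp
  rw [← this]
  exact integral_mono ((D1_integrable w b hB k r).sub ((Qk_integrable w b hB k r).const_mul _))
    (integrable_const _) fun J => h _

lemma F_lo (hB : B.Nonempty) (k : ℕ) (e : ℝ) (r : ℝ)
    (h : ∀ g, -e ≤ Lk w b B (k+1) g - Lk w b B k g - b^2/2 * Qk w b B k g) :
    -e ≤ Fk w b B (k+1) r - Fk w b B k r - b^2/2 * QFk w b B k r := by
  rw [Fk_eq w b hB, Fk_eq w b hB, QFk, ← integral_const_mul, ← integral_sub (Lk_integrable w b hB _ r) (Lk_integrable w b hB _ r),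
    ← integral_sub (D1_integrable w b hB k r) ((Qk_integrable w b hB k r).const_mul _)]
  have : ∫ J : Fin n × Fin n → ℝ, -e ∂(gm (Fin n × Fin n)) = -e := by simp
  rw [← this]
  exact integral_mono (integrable_const _) ((D1_integrable w b hB k r).sub ((Qk_integrable w b hB k r).const_mul _))
    fun J => h _

lemma QF_stab (hB : B.Nonempty) (hb0 : 0 ≤ b) (hb : b ≤ 1/4) (hn : 0 < n) {k : ℕ} (hk : k < K) (r : ℝ) :
    |QFk w b B (k+1) r - QFk w b B k r| ≤ 12 * b := by
  unfold QFk
  rw [← integral_sub (Qk_integrable w b hB _ r) (Qk_integrable w b hB _ r)]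
  have := norm_integral_le_of_norm_le_const (μ := gm (Fin n × Fin n)) (C := 12 * b)
    (f := fun J => Qk w b B (k+1) (fun σ => r * lf sS J σ) - Qk w b B k (fun σ => r * lf sS J σ))
    (Filter.Eventually.of_forall fun J => Qk_stab w b hB hb0 hb hn hk _)
  simpa using this

noncomputable def rk (c : ℝ) (K k : ℕ) : ℝ := c * Real.sqrt (1 - k / K)

lemma rk_props {c : ℝ} (hc : 0 < c) {k : ℕ} (hk : k < K) :
    0 ≤ rk c K (k+1) ∧ rk c K (k+1) < rk c K k ∧ (rk c K k)^2 - (rk c K (k+1))^2 = c^2 / K := by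
  have hK : (0:ℝ) < K := by exact_mod_cast (by omega : 0 < K)
  have h1 : (k:ℝ) + 1 ≤ K := by exact_mod_cast hk
  have h2 : 0 ≤ 1 - ((k+1 : ℕ):ℝ) / K := by
    rw [sub_nonneg, div_le_one hK]; push_cast; exact h1
  have h3 : 1 - ((k+1 : ℕ):ℝ) / K < 1 - (k:ℝ)/K := by
    gcongr; push_cast; linarith
  refine ⟨by unfold rk; positivity, ?_, ?_⟩
  · unfold rk
    have := Real.sqrt_lt_sqrt h2 h3
    gcongr
  · unfold rk
    rw [mul_pow, mul_pow, Real.sq_sqrt h2, Real.sq_sqrt (h2.trans h3.le)]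
    push_cast; field_simp; ring

lemma tel_up (hw : ∀ i, (univ.filter (fun x => w x = i)).card = γ) (hγ : 1 ≤ γ)
    (hB : B.Nonempty) (hb0 : 0 ≤ b) (hb : b ≤ 1/4) (hn : 0 < n) (c : ℝ) (hc : 0 < c)
    (hcb : c^2 * (n:ℝ)^2 = K * b^2) {k : ℕ} (hk : k ≤ K) :
    Fk w b B k (rk c K k) - Fk w b B 0 (rk c K 0) ≤ ∑ j ∈ range k, (errm b n ((K:ℝ) - j) + 6 * b^3) := by
  induction k with
  | zero => simp
  | succ k ih =>
    rw [Finset.sum_range_succ]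
    have hk' : k < K := hk
    have ih' := ih hk'.le
    obtain ⟨h1, h2, h3⟩ := rk_props hc hk'
    have hK : (0:ℝ) < K := by exact_mod_cast (by omega : 0 < K)
    have hup : ∀ r, Fk w b B (k+1) r - Fk w b B k r - b^2/2 * QFk w b B k r ≤ errm b n ((K:ℝ) - k) :=
      fun r => F_up w b hB k _ r fun g => step_up w γ b hw hγ hB hb0 hb hn hk' g
    have := interp_step (Fk w b B k) (Fk w b B (k+1)) (QFk w b B k) (QFk w b B (k+1)) ((n:ℝ)^2) (b^2/2)
      (errm b n ((K:ℝ) - k) + 6 * b^3) (rk c K k) (rk c K (k+1)) (by positivity) (Fk_deriv w b hB hn k)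
      (Fk_deriv w b hB hn (k+1)) h1 h2 (by rw [h3, div_mul_eq_mul_div, hcb]; field_simp)
      (fun r => by have := hup r; have : 0 ≤ b^3 := by positivity
                   linarith)
      (fun r => by
        have h5 := hup r
        have h6 := (abs_le.mp (QF_stab w b hB hb0 hb hn hk' r)).1
        have : b^2/2 * (QFk w b B k r - QFk w b B (k+1) r) ≤ b^2/2*(12*b) := by gcongr; linarith
        nlinarith)
    linarith

lemma tel_lo (hw : ∀ i, (univ.filter (fun x => w x = i)).card = γ) (hγ : 1 ≤ γ)
    (hB : B.Nonempty) (hb0 : 0 ≤ b) (hb : b ≤ 1/4) (hn : 0 < n) (c : ℝ) (hc : 0 < c)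
    (hcb : c^2 * (n:ℝ)^2 = K * b^2) 
    (L : ℝ) (hL : ∀ σ ∈ B, (∑ i, spin (σ i))^2 ≤ L) {k : ℕ} (hk : k ≤ K) :
    -(∑ j ∈ range k, (errm b n ((K:ℝ) - j) + b * (4 * L / (n:ℝ)^2) + 6 * b^3)) ≤ Fk w b B k (rk c K k) - Fk w b B 0 (rk c K 0) := by
  induction k with
  | zero => simp
  | succ k ih =>
    rw [Finset.sum_range_succ]
    have hk' : k < K := hk
    have ih' := ih hk'.le
    obtain ⟨h1, h2, h3⟩ := rk_props hc hk'
    have hK : (0:ℝ) < K := by exact_mod_cast (by omega : 0 < K)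
    have hup : ∀ r, -(errm b n ((K:ℝ) - k) + b * (4 * L / (n:ℝ)^2)) ≤ Fk w b B (k+1) r - Fk w b B k r - b^2/2 * QFk w b B k r :=
      fun r => F_lo w b hB k _ r fun g => step_lo w γ b hw hγ hB hb0 hb hn hk' g L hL
    have := interp_step (fun r => - Fk w b B k r) (fun r => -Fk w b B (k+1) r) (fun r => -QFk w b B k r) (fun r => -QFk w b B (k+1) r) ((n:ℝ)^2) (b^2/2)
      (errm b n ((K:ℝ) - k) + b * (4 * L / (n:ℝ)^2) + 6 * b^3) (rk c K k) (rk c K (k+1)) (by positivity)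
      (fun r => ((Fk_deriv w b hB hn k r).neg).congr_deriv (by ring))
      (fun r => ((Fk_deriv w b hB hn (k+1) r).neg).congr_deriv (by ring)) h1 h2 (by rw [h3, div_mul_eq_mul_div, hcb]; field_simp)
      (fun r => by have := hup r; have : 0 ≤ b^3 := by positivity
                   linarith)
      (fun r => by
        have h5 := hup r
        have h6 := (abs_le.mp (QF_stab w b hB hb0 hb hn hk' r)).2
        have : b^2/2 * (QFk w b B (k+1) r - QFk w b B k r) ≤ b^2/2*(12*b) := by gcongr
        nlinarith)
    linarith

end gi

open MeasureTheory Filter Finset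
set_option linter.unusedSectionVars false
set_option linter.unusedVariables false

/-! ### Part 7: free energy comparison -/

lemma sum_min_le (a : ℝ) (ha : 0 < a) (K : ℕ) :
    ∑ j ∈ range K, min 1 (a / ((j:ℝ)+1)) ≤ 2 * a * Real.log (1 + K/a) := by
  induction K with
  | zero => simp
  | succ k ih =>
    rw [Finset.sum_range_succ]
    have h1 : min 1 (a / ((k:ℝ)+1)) ≤ 2 * a / (a + k + 1) := by
      have hp : 0 < a + k + 1 := by positivity
      by_cases h : a ≤ (k:ℝ)+1
      · refine (min_le_right _ _).trans ?_
        rw [div_le_div_iff₀ (by positivity) hp]; nlinarith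
      · refine (min_le_left _ _).trans ?_
        rw [le_div_iff₀ hp]; linarith
    have h2 : 1/(a+k+1) ≤ Real.log (1 + (k+1:ℕ)/a) - Real.log (1 + k/a) := by
      rw [← Real.log_div (by positivity) (by positivity)]
      have e : (1 + ((k+1:ℕ):ℝ)/a) / (1 + k/a) = ((a+k)/(a+k+1))⁻¹ := by push_cast; field_simp; ring
      rw [e, Real.log_inv]
      have := Real.log_le_sub_one_of_pos (x := (a+k)/(a+k+1)) (by positivity)
      have e2 : (a+k)/(a+k+1) - 1 = - (1/(a+k+1)) := by field_simp; ring
      linarith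
    have h3 : 2 * a / (a+k+1) ≤ 2 * a * (Real.log (1 + (k+1:ℕ)/a) - Real.log (1 + k/a)) := by
      rw [show 2 * a / (a+k+1) = 2 * a * (1/(a+k+1)) by ring]; gcongr
    linarith

lemma sum_inv_sqrt_le (K : ℕ) : ∑ j ∈ range K, 1 / Real.sqrt ((j:ℝ)+1) ≤ 2 * Real.sqrt K := by
  induction K with
  | zero => simp
  | succ k ih =>
    rw [Finset.sum_range_succ]
    have hs : 0 < Real.sqrt ((k:ℝ)+1) := Real.sqrt_pos.mpr (by positivity)
    have h1 : 1 / Real.sqrt ((k:ℝ)+1) ≤ 2 * (Real.sqrt ((k:ℝ)+1) - Real.sqrt k) := by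
      rw [div_le_iff₀ hs]
      have h2 : Real.sqrt ((k:ℝ)+1)^2 = k+1 := Real.sq_sqrt (by positivity)
      have h3 : Real.sqrt (k:ℝ)^2 = k := Real.sq_sqrt (by positivity)
      nlinarith [sq_nonneg (Real.sqrt ((k:ℝ)+1) - Real.sqrt k)]
    push_cast
    linarith

lemma sum_errm (b n : ℝ) (hb : 0 ≤ b) (hn : 0 < n) (K : ℕ) :
    ∑ j ∈ range K, errm b n ((K:ℝ) - j) ≤ 4 * b * n * Real.log (1 + K/(2*n)) + 4 * b^2 * Real.sqrt n * Real.sqrt K + 6 * b^3 * K := by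
  have h1 : ∑ j ∈ range K, errm b n ((K:ℝ) - j) = ∑ j ∈ range K, errm b n ((j:ℝ)+1) := by
    rw [← Finset.sum_range_reflect]
    refine Finset.sum_congr rfl fun j hj => ?_
    have : j < K := Finset.mem_range.mp hj
    congr 1
    rw [Nat.sub_sub, Nat.cast_sub (by omega)]; push_cast; ring
  rw [h1]
  unfold errm
  rw [Finset.sum_add_distrib, Finset.sum_add_distrib, ← Finset.mul_sum, ← Finset.mul_sum]
  have h2 := sum_min_le (2*n) (by positivity) K
  have h3 : ∑ j ∈ range K, Real.sqrt (n / ((j:ℝ)+1)) ≤ Real.sqrt n * (2 * Real.sqrt K) := by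
    refine le_trans (le_of_eq ?_) (mul_le_mul_of_nonneg_left (sum_inv_sqrt_le K) (Real.sqrt_nonneg n))
    rw [Finset.mul_sum]
    refine Finset.sum_congr rfl fun j _ => ?_
    rw [Real.sqrt_div hn.le]; ring
  have h4 := mul_le_mul_of_nonneg_left h2 hb
  have h5 := mul_le_mul_of_nonneg_left h3 (by positivity : 0 ≤ 2 * b^2)
  simp only [Finset.sum_const, Finset.card_range, nsmul_eq_mul]
  linarith

noncomputable def EE (β γ : ℝ) : ℝ := (4*β*Real.log (1+γ/4) + 4*β^2 + 12*β^3 + 2*β)/Real.sqrt γ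

lemma total_err (β γ n : ℝ) (K : ℕ) (hβ : 0 < β) (hγ : 1 ≤ γ) (hn : 0 < n) (hK : 2 * (K:ℝ) = n * γ) :
    ∑ j ∈ range K, (errm (β/Real.sqrt γ) n ((K:ℝ) - j) + (β/Real.sqrt γ) * (4 * (n^2/γ) / n^2) + 6 * (β/Real.sqrt γ)^3)
      ≤ n * EE β γ := by
  have hg0 : 0 < γ := by linarith
  set s := Real.sqrt γ with hs
  have hs0 : 0 < s := Real.sqrt_pos.mpr hg0
  have hs1 : 1 ≤ s := by rw [hs]; exact Real.one_le_sqrt.mpr hγ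
  have hs2 : s^2 = γ := Real.sq_sqrt hg0.le
  rw [Finset.sum_add_distrib, Finset.sum_add_distrib]
  have h1 := sum_errm (β/s) n (by positivity) hn K
  simp only [Finset.sum_const, Finset.card_range, nsmul_eq_mul]
  have hK' : (K:ℝ) = n * s^2 / 2 := by rw [hs2]; linarith
  have e1 : (K:ℝ)/(2*n) = γ/4 := by rw [hK', hs2]; field_simp; norm_num
  have e2 : Real.sqrt n * Real.sqrt K ≤ n * s := by
    rw [← Real.sqrt_mul hn.le]
    apply Real.sqrt_le_iff.mpr
    refine ⟨by positivity, ?_⟩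
    rw [hK']; nlinarith [sq_nonneg (n*s)]
  rw [e1] at h1
  have e3 : 4 * (β/s)^2 * Real.sqrt n * Real.sqrt K ≤ 4 * (β/s)^2 * (n*s) := by
    rw [mul_assoc]; gcongr
  have e4 : (K:ℝ) * (β/s * (4 * (n^2/γ)/n^2)) = n * (2 * β / s) := by
    rw [hK', ← hs2]; field_simp; ring
  have e5 : 4 * (β/s) * n * Real.log (1+γ/4) + 4 * (β/s)^2 * (n*s) + 6 * (β/s)^3 * K + n * (2*β/s) + K * (6 * (β/s)^3) = n * ((4*β*Real.log (1+γ/4) + 4*β^2 + 6*β^3 + 2*β)/s) := by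
    rw [hK']; field_simp; ring
  have e6 : n * ((4*β*Real.log (1+γ/4) + 4*β^2 + 6*β^3 + 2*β)/s) ≤ n * EE β γ := by
    unfold EE
    rw [← hs]
    gcongr
    linarith [pow_pos hβ 3]
  linarith

section fe
variable {n K : ℕ} (w : Fin K × Bool → Fin n) (γ : ℕ) {B : Finset (Fin n → Bool)} (β : ℝ)

lemma Fk_end (b : ℝ) (c : ℝ) (hK : 0 < K) : Fk w b B K (rk c K K) = pE (fun π => gL B (aw w b π K)) := by
  have : rk c K K = 0 := by
    have : (K:ℝ) ≠ 0 := by positivity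
    simp [rk, this]
  unfold Fk
  rw [this]
  simp

lemma Fk_start (b : ℝ) (c : ℝ) : Fk w b B 0 (rk c K 0) = ∫ J, gL B (fun σ => c * lf sS J σ) ∂(gm (Fin n × Fin n)) := by
  have : rk c K 0 = c := by simp [rk]
  unfold Fk
  rw [this]
  simp only [aw_zero, zero_add]
  exact pE_const _

lemma cb_rel (hn : 0 < n) (hγ : 1 ≤ γ) (hK : 2 * K = n * γ) :
    (β/Real.sqrt (2*n))^2 * (n:ℝ)^2 = K * (β/Real.sqrt γ)^2 := by
  have hg : (0:ℝ) < γ := by exact_mod_cast hγ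
  have hn' : (0:ℝ) < n := by exact_mod_cast hn
  have hK' : 2 * (K:ℝ) = n * γ := by exact_mod_cast hK
  rw [div_pow, div_pow, Real.sq_sqrt (by positivity), Real.sq_sqrt hg.le]
  have : (K:ℝ) = n*γ/2 := by linarith
  rw [this]; field_simp

lemma fe_up (hw : ∀ i, (univ.filter (fun x => w x = i)).card = γ) (hγ : 1 ≤ γ)
    (hB : B.Nonempty) (hβ : 0 < β) (hb : β / Real.sqrt γ ≤ 1/4) (hn : 0 < n) (hK : 2 * K = n * γ) :
    pE (fun π => gL B (aw w (β / Real.sqrt γ) π K))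
      ≤ ∫ J, gL B (fun σ => (β / Real.sqrt (2*n)) * lf sS J σ) ∂(gm (Fin n × Fin n)) + n * EE β γ := by
  have hg : (1:ℝ) ≤ γ := by exact_mod_cast hγ
  have hn' : (0:ℝ) < n := by exact_mod_cast hn
  have hK' : 2 * (K:ℝ) = n * γ := by exact_mod_cast hK
  have hK0 : 0 < K := by
    have : 0 < n * γ := by positivity
    omega
  have h := tel_up w γ (β / Real.sqrt γ) hw hγ hB (by positivity) hb hn (β / Real.sqrt (2*n)) (by positivity)
    (cb_rel γ β hn hγ hK) le_rfl
  rw [Fk_end w _ _ hK0, Fk_start] at h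
  have h2 := total_err β γ n K hβ hg hn' hK'
  have h3 : ∑ j ∈ range K, (errm (β/Real.sqrt γ) n ((K:ℝ) - j) + 6 * (β/Real.sqrt γ)^3)
     ≤ ∑ j ∈ range K, (errm (β/Real.sqrt γ) n ((K:ℝ) - j) + (β/Real.sqrt γ) * (4 * ((n:ℝ)^2/γ) / (n:ℝ)^2) + 6 * (β/Real.sqrt γ)^3) := by
    refine Finset.sum_le_sum fun j _ => ?_
    have : 0 ≤ (β/Real.sqrt γ) * (4 * ((n:ℝ)^2/γ) / (n:ℝ)^2) := by positivity
    linarith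
  linarith

lemma fe_lo (hw : ∀ i, (univ.filter (fun x => w x = i)).card = γ) (hγ : 1 ≤ γ)
    (hB : B.Nonempty) (hβ : 0 < β) (hb : β / Real.sqrt γ ≤ 1/4) (hn : 0 < n) (hK : 2 * K = n * γ)
    (hL : ∀ σ ∈ B, (∑ i, spin (σ i))^2 ≤ (n:ℝ)^2 / γ) :
    ∫ J, gL B (fun σ => (β / Real.sqrt (2*n)) * lf sS J σ) ∂(gm (Fin n × Fin n)) - n * EE β γ
     ≤ pE (fun π => gL B (aw w (β / Real.sqrt γ) π K)) := by
  have hg : (1:ℝ) ≤ γ := by exact_mod_cast hγ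
  have hn' : (0:ℝ) < n := by exact_mod_cast hn
  have hK' : 2 * (K:ℝ) = n * γ := by exact_mod_cast hK
  have hK0 : 0 < K := by
    have : 0 < n * γ := by positivity
    omega
  have h := tel_lo w γ (β / Real.sqrt γ) hw hγ hB (by positivity) hb hn (β / Real.sqrt (2*n)) (by positivity)
    (cb_rel γ β hn hγ hK) _ hL le_rfl
  rw [Fk_end w _ _ hK0, Fk_start] at h
  have h2 := total_err β γ n K hβ hg hn' hK'
  linarith

end fe

open MeasureTheory Filter Finset
set_option linter.unusedSectionVars false
set_option linter.unusedVariables false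

/-! ### Part 8: zero temperature and gauge symmetry -/

section gauge
variable {n : ℕ}

lemma gm_flip_mp {ι : Type*} [Fintype ι] (s : ι → ℝ) (hs : ∀ p, s p = 1 ∨ s p = -1) :
    MeasurePreserving (fun (J : ι → ℝ) p => J p * s p) (gm ι) (gm ι) := by
  refine measurePreserving_pi (fun _ => ProbabilityTheory.gaussianReal 0 1) (fun _ => ProbabilityTheory.gaussianReal 0 1)
    (f := fun p x => x * s p) fun p => ?_
  refine ⟨by fun_prop, ?_⟩
  rw [ProbabilityTheory.gaussianReal_map_mul_const]
  have : (s p)^2 = 1 := by rcases hs p with h | h <;> rw [h] <;> norm_num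
  congr 1
  · simp
  · ext; simp [this]

noncomputable def XJ (J : Fin n × Fin n → ℝ) (σ : Fin n → Bool) : ℝ := (Real.sqrt (2 * n))⁻¹ * lf sS J σ

lemma XJ_eq (J : Fin n × Fin n → ℝ) (σ : Fin n → Bool) : -HSK n J σ = XJ J σ := by
  unfold HSK XJ lf sS
  rw [neg_mul, neg_neg]
  simp only [mul_assoc]

noncomputable def mxB (B : Finset (Fin n → Bool)) (hB : B.Nonempty) (J : Fin n × Fin n → ℝ) : ℝ := B.sup' hB (XJ J)

lemma mxB_abs (B : Finset (Fin n → Bool)) (hB : B.Nonempty) (J : Fin n × Fin n → ℝ) :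
    |mxB B hB J| ≤ (Real.sqrt (2 * n))⁻¹ * ∑ p, |J p| := by
  obtain ⟨σ, hσ, h⟩ := Finset.exists_mem_eq_sup' hB (XJ J)
  unfold mxB
  rw [h, XJ, abs_mul, abs_of_nonneg (by positivity : 0 ≤ (Real.sqrt (2 * n))⁻¹)]
  gcongr
  exact lf_abs sS sS_pm J σ

lemma mxB_cont (B : Finset (Fin n → Bool)) (hB : B.Nonempty) : Continuous (mxB B hB) := by
  unfold mxB
  refine Continuous.finset_sup'_apply hB fun σ _ => ?_
  unfold XJ
  exact continuous_const.mul (lf_cont sS σ)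

lemma mxB_integrable (B : Finset (Fin n → Bool)) (hB : B.Nonempty) : Integrable (mxB B hB) (gm (Fin n × Fin n)) := by
  refine (gm_integrable_abs_sum.const_mul ((Real.sqrt (2 * n))⁻¹)).mono' (mxB_cont B hB).aestronglyMeasurable ?_
  exact Filter.Eventually.of_forall fun J => mxB_abs B hB J

lemma mxB_flip (B : Finset (Fin n → Bool)) (hB : B.Nonempty) (s : Fin n × Fin n → ℝ) (hs : ∀ p, s p = 1 ∨ s p = -1) :
    Integrable (fun J => mxB B hB (fun p => J p * s p)) (gm (Fin n × Fin n)) ∧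
    ∫ J, mxB B hB (fun p => J p * s p) ∂(gm (Fin n × Fin n)) = ∫ J, mxB B hB J ∂(gm (Fin n × Fin n)) := by
  have hmp := gm_flip_mp s hs
  constructor
  · exact hmp.integrable_comp_of_integrable (mxB_integrable B hB)
  · have h2 := integral_map (μ := gm (Fin n × Fin n)) hmp.measurable.aemeasurable (f := mxB B hB) (mxB_cont B hB).aestronglyMeasurable
    rw [hmp.map_eq] at h2
    exact h2.symm

lemma spin_beq (a c : Bool) : spin (a == c) = spin a * spin c := by cases a <;> cases c <;> simp [spin]

lemma XJ_gauge (J : Fin n × Fin n → ℝ) (σ τ : Fin n → Bool) :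
    XJ (fun p => J p * sS τ p) σ = XJ J (fun i => σ i == τ i) := by
  unfold XJ lf sS
  congr 1
  refine Finset.sum_congr rfl fun p _ => ?_
  rw [spin_beq, spin_beq]; ring

lemma XJ_neg (J : Fin n × Fin n → ℝ) (σ : Fin n → Bool) : XJ (fun p => J p * (-1)) σ = - XJ J σ := by
  unfold XJ lf
  rw [← mul_neg, ← Finset.sum_neg_distrib]
  congr 1
  refine Finset.sum_congr rfl fun p _ => by ring

def beqEquiv (σ : Fin n → Bool) : (Fin n → Bool) ≃ (Fin n → Bool) where
  toFun τ := fun i => σ i == τ i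
  invFun τ := fun i => σ i == τ i
  left_inv τ := by funext i; cases h : σ i <;> cases h2 : τ i <;> simp [h, h2]
  right_inv τ := by funext i; cases h : σ i <;> cases h2 : τ i <;> simp [h, h2]

lemma beq_beq (σ τ : Fin n → Bool) : (fun i => (σ i == τ i) == τ i) = σ := by
  funext i; cases h : σ i <;> cases h2 : τ i <;> simp

lemma gauge_lower (B : Finset (Fin n → Bool)) (hB : B.Nonempty) :
    ∫ J, mxB univ univ_nonempty J ∂(gm (Fin n × Fin n))
      - pE (fun τ : Fin n → Bool => if τ ∈ B then (0:ℝ) else 1) * (2 * ∫ J, mxB univ univ_nonempty J ∂(gm (Fin n × Fin n)))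
      ≤ ∫ J, mxB B hB J ∂(gm (Fin n × Fin n)) := by
  set p := pE (fun τ : Fin n → Bool => if τ ∈ B then (0:ℝ) else 1) with hp
  have h1 : ∫ J, mxB B hB J ∂(gm (Fin n × Fin n))
      = ∫ J, pE (fun τ : Fin n → Bool => mxB B hB (fun p => J p * sS τ p)) ∂(gm (Fin n × Fin n)) := by
    rw [integral_pE _ _ fun τ => (mxB_flip B hB _ (sS_pm τ)).1]
    rw [show (fun τ : Fin n → Bool => ∫ J, mxB B hB (fun p => J p * sS τ p) ∂(gm (Fin n × Fin n)))
      = fun _ => ∫ J, mxB B hB J ∂(gm (Fin n × Fin n)) from funext fun τ => (mxB_flip B hB _ (sS_pm τ)).2]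
    rw [pE_const]
  have hneg := mxB_flip (univ : Finset (Fin n → Bool)) univ_nonempty (fun _ => -1) (fun _ => Or.inr rfl)
  have h2 : ∀ J : Fin n × Fin n → ℝ, mxB univ univ_nonempty J - p * (mxB univ univ_nonempty J + mxB univ univ_nonempty (fun p => J p * (-1)))
      ≤ pE (fun τ : Fin n → Bool => mxB B hB (fun p => J p * sS τ p)) := by
    intro J
    obtain ⟨σ, _, hσ⟩ := Finset.exists_mem_eq_sup' (univ_nonempty : (univ : Finset (Fin n → Bool)).Nonempty) (XJ J)
    change mxB univ univ_nonempty J = _ at hσ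
    set m1 := mxB univ univ_nonempty J with hm1
    set m2 := mxB univ univ_nonempty (fun p => J p * (-1)) with hm2
    have hlow : ∀ σ, -m2 ≤ XJ J σ := by
      intro σ
      have : XJ (fun p => J p * (-1)) σ ≤ m2 := Finset.le_sup' _ (mem_univ σ)
      rw [XJ_neg] at this
      linarith
    have h3 : p = pE (fun τ : Fin n → Bool => if (fun i => σ i == τ i) ∈ B then (0:ℝ) else 1) := by
      rw [hp]; exact (pE_equiv (beqEquiv σ) (fun τ : Fin n → Bool => if τ ∈ B then (0:ℝ) else 1)).symm
    rw [h3, mul_comm, ← pE_smul, ← pE_const (α := Fin n → Bool) m1, ← pE_sub, pE_const]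
    refine pE_mono fun τ => ?_
    by_cases hτ : (fun i => σ i == τ i) ∈ B
    · rw [if_pos hτ]
      have : XJ (fun p => J p * sS τ p) (fun i => σ i == τ i) ≤ mxB B hB (fun p => J p * sS τ p) := Finset.le_sup' _ hτ
      rw [XJ_gauge, beq_beq] at this
      linarith
    · rw [if_neg hτ]
      obtain ⟨ρ, hρ⟩ := hB
      have : XJ (fun p => J p * sS τ p) ρ ≤ mxB B ⟨ρ, hρ⟩ (fun p => J p * sS τ p) := Finset.le_sup' _ hρ
      rw [XJ_gauge] at this
      have := hlow (fun i => ρ i == τ i)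
      linarith
  have hi := mxB_integrable (univ : Finset (Fin n → Bool)) univ_nonempty
  have h4 : ∫ J, (mxB univ univ_nonempty J - p * (mxB univ univ_nonempty J + mxB univ univ_nonempty (fun p => J p * (-1)))) ∂(gm (Fin n × Fin n))
     ≤ ∫ J, pE (fun τ : Fin n → Bool => mxB B hB (fun p => J p * sS τ p)) ∂(gm (Fin n × Fin n)) := by
    refine integral_mono ?_ (integrable_pE _ _ fun τ => (mxB_flip B hB _ (sS_pm τ)).1) h2
    exact hi.sub ((hi.add hneg.1).const_mul p)
  have hadd : Integrable (fun J => p * (mxB univ univ_nonempty J + mxB univ univ_nonempty (fun p => J p * (-1)))) (gm (Fin n × Fin n)) :=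
    (hi.add hneg.1).const_mul p
  rw [← h1, integral_sub hi hadd, integral_const_mul, integral_add hi hneg.1, hneg.2] at h4
  linarith

lemma sum_spin_spin (i j : Fin n) (h : i ≠ j) : ∑ σ : Fin n → Bool, spin (σ i) * spin (σ j) = 0 := by
  have hinv : Function.Involutive (fun σ : Fin n → Bool => Function.update σ i (!σ i)) := by
    intro σ; simp
  set f : (Fin n → Bool) → (Fin n → Bool) := fun σ => Function.update σ i (!σ i) with hf
  have := Equiv.sum_comp (Function.Involutive.toPerm f hinv) (fun σ : Fin n → Bool => spin (σ i) * spin (σ j))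
  have e : ∀ σ : Fin n → Bool, spin (Function.Involutive.toPerm f hinv σ i) * spin (Function.Involutive.toPerm f hinv σ j) = -(spin (σ i) * spin (σ j)) := by
    intro σ
    simp only [Function.Involutive.coe_toPerm, hf, Function.update_self, Function.update_of_ne h.symm]
    cases σ i <;> cases σ j <;> simp [spin]
  simp only [e, Finset.sum_neg_distrib] at this
  linarith

lemma pE_spin_sq : pE (fun σ : Fin n → Bool => (∑ i, spin (σ i))^2) = n := by
  have e : ∀ σ : Fin n → Bool, (∑ i, spin (σ i))^2 = ∑ i, ∑ j, spin (σ i) * spin (σ j) := by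
    intro σ; rw [sq, Finset.sum_mul_sum]
  simp only [e]
  rw [pE_sum]
  have : ∀ i ∈ (univ : Finset (Fin n)), pE (fun σ : Fin n → Bool => ∑ j, spin (σ i) * spin (σ j)) = 1 := by
    intro i _
    rw [pE_sum, Finset.sum_eq_single i]
    · simp only [spin_sq]; exact pE_const 1
    · intro j _ hj
      unfold pE; rw [sum_spin_spin i j hj.symm, zero_div]
    · simp
  rw [Finset.sum_congr rfl this]; simp

noncomputable def BB (n γ : ℕ) : Finset (Fin n → Bool) := univ.filter (fun σ => (∑ i, spin (σ i))^2 ≤ (n:ℝ)^2/γ)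

lemma BB_prob (γ : ℕ) (hγ : 1 ≤ γ) (hn : 0 < n) :
    pE (fun τ : Fin n → Bool => if τ ∈ BB n γ then (0:ℝ) else 1) ≤ γ / n := by
  have hg : (0:ℝ) < γ := by exact_mod_cast hγ
  have hn' : (0:ℝ) < n := by exact_mod_cast hn
  have h1 : ∀ τ : Fin n → Bool, (if τ ∈ BB n γ then (0:ℝ) else 1) ≤ (γ/(n:ℝ)^2) * (∑ i, spin (τ i))^2 := by
    intro τ
    split_ifs with h
    · positivity
    · simp only [BB, mem_filter, mem_univ, true_and, not_le] at h
      rw [div_mul_eq_mul_div, le_div_iff₀ (by positivity)]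
      rw [div_lt_iff₀ hg] at h
      linarith
  refine (pE_mono h1).trans_eq ?_
  rw [pE_smul, pE_spin_sq]
  field_simp

lemma BB_nonempty (γ : ℕ) (hγ : 1 ≤ γ) (hn : γ < n) : (BB n γ).Nonempty := by
  by_contra h
  rw [Finset.not_nonempty_iff_eq_empty] at h
  have := BB_prob (n := n) γ hγ (by omega)
  rw [h] at this
  simp only [Finset.notMem_empty, if_false] at this
  rw [pE_const, le_div_iff₀ (by exact_mod_cast (by omega : 0 < n))] at this
  have h2 : (γ:ℝ) < n := by exact_mod_cast hn
  linarith

end gauge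

open MeasureTheory Filter Finset
set_option linter.unusedSectionVars false
set_option linter.unusedVariables false

/-! ### Part 9: the mean of the maximum -/

section mean
variable {n K : ℕ} (w : Fin K × Bool → Fin n) (γ : ℕ) (β : ℝ)

noncomputable def Hp (π : Equiv.Perm (Fin K × Bool)) (σ : Fin n → Bool) : ℝ := ∑ k, ev w π k σ

noncomputable def MM (π : Equiv.Perm (Fin K × Bool)) : ℝ :=
  (univ : Finset (Fin n → Bool)).sup' univ_nonempty (fun σ => - Hp w π σ)

lemma aw_full (b : ℝ) (π : Equiv.Perm (Fin K × Bool)) (σ : Fin n → Bool) :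
    aw w b π K σ = b * (- Hp w π σ) := by
  unfold aw Hp
  simp only [Fin.is_lt, if_true]
  rw [← Finset.mul_sum]; ring

noncomputable def SS (n : ℕ) : ℝ := ∫ J, mxB (univ : Finset (Fin n → Bool)) univ_nonempty J ∂(gm (Fin n × Fin n))

lemma SS_eq (n : ℕ) : SS n = ∫ J, (⨆ σ : Fin n → Bool, -HSK n J σ) ∂(skMeasure n) := by
  unfold SS
  change _ = ∫ J, (⨆ σ : Fin n → Bool, -HSK n J σ) ∂(gm (Fin n × Fin n))
  congr 1
  funext J
  simp only [XJ_eq]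
  unfold mxB
  rw [Finset.sup'_univ_eq_ciSup]

lemma log_card_le (B : Finset (Fin n → Bool)) (hB : B.Nonempty) : Real.log B.card ≤ n := by
  have h1 : (B.card : ℝ) ≤ 2^n := by
    have : B.card ≤ Fintype.card (Fin n → Bool) := Finset.card_le_univ B
    simp at this
    exact_mod_cast this
  have h0 : (0:ℝ) < B.card := by exact_mod_cast hB.card_pos
  calc Real.log B.card ≤ Real.log (2^n) := Real.log_le_log h0 h1
    _ = n * Real.log 2 := by rw [Real.log_pow]
    _ ≤ n * 1 := by gcongr; linarith [Real.log_two_lt_d9]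
    _ = n := mul_one _

lemma mean_up (hw : ∀ i, (univ.filter (fun x => w x = i)).card = γ) (hγ : 1 ≤ γ)
    (hβ : 0 < β) (hb : β / Real.sqrt γ ≤ 1/4) (hn : 0 < n) (hK : 2 * K = n * γ) :
    pE (MM w) / Real.sqrt γ ≤ SS n + n * (1 + EE β γ) / β := by
  have h := fe_up w γ β hw hγ (univ_nonempty : (univ : Finset (Fin n → Bool)).Nonempty) hβ hb hn hK
  have hg : (0:ℝ) < γ := by exact_mod_cast hγ
  have hs := Real.sqrt_pos.mpr hg
  have h1 : β / Real.sqrt γ * pE (MM w) ≤ pE (fun π => gL univ (aw w (β / Real.sqrt γ) π K)) := by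
    rw [← pE_smul]
    refine pE_mono fun π => ?_
    obtain ⟨σ, hσ, he⟩ := Finset.exists_mem_eq_sup' (univ_nonempty : (univ : Finset (Fin n → Bool)).Nonempty) (fun σ => - Hp w π σ)
    unfold MM
    rw [he, ← aw_full]
    exact gL_ge _ hσ
  have h2 : ∫ J, gL univ (fun σ => (β / Real.sqrt (2*n)) * lf sS J σ) ∂(gm (Fin n × Fin n)) ≤ β * SS n + n := by
    have e : β * SS n + n = ∫ J, (β * mxB (univ : Finset (Fin n → Bool)) univ_nonempty J + n) ∂(gm (Fin n × Fin n)) := by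
      rw [integral_add ((mxB_integrable _ _).const_mul _) (integrable_const _), integral_const_mul]
      simp [SS]
    rw [e]
    refine integral_mono ?_ (((mxB_integrable _ _).const_mul _).add (integrable_const _)) fun J => ?_
    · have := gL_integrable (B := univ) sS univ_nonempty sS_pm (fun _ : Fin n → Bool => (0:ℝ)) (β / Real.sqrt (2*n))
      simpa using this
    · refine (gL_le univ_nonempty _ (β * mxB (univ : Finset (Fin n → Bool)) univ_nonempty J) fun σ hσ => ?_).trans ?_
      · have : XJ J σ ≤ mxB (univ : Finset (Fin n → Bool)) univ_nonempty J := Finset.le_sup' _ hσ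
        have h3 : (β / Real.sqrt (2*n)) * lf sS J σ = β * XJ J σ := by unfold XJ; ring
        rw [h3]; gcongr
      · have := log_card_le (univ : Finset (Fin n → Bool)) univ_nonempty
        linarith
  have h3 : β * (pE (MM w) / Real.sqrt γ) ≤ β * SS n + n * (1 + EE β γ) := by
    have : β * (pE (MM w) / Real.sqrt γ) = β / Real.sqrt γ * pE (MM w) := by ring
    rw [this]; linarith
  have h4 : β * (SS n + n * (1 + EE β γ) / β) = β * SS n + n * (1 + EE β γ) := by field_simp
  rw [← h4] at h3
  exact le_of_mul_le_mul_left h3 hβ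

lemma mean_lo (hw : ∀ i, (univ.filter (fun x => w x = i)).card = γ) (hγ : 1 ≤ γ)
    (hβ : 0 < β) (hb : β / Real.sqrt γ ≤ 1/4) (hn : γ < n) (hK : 2 * K = n * γ) (hS : 0 ≤ SS n) :
    SS n - 2 * γ / n * SS n - n * (1 + EE β γ) / β ≤ pE (MM w) / Real.sqrt γ := by
  have hB := BB_nonempty γ hγ hn
  have hn0 : 0 < n := by omega
  have h := fe_lo w γ β hw hγ hB hβ hb hn0 hK (by intro σ hσ; simpa [BB] using hσ)
  have hg : (0:ℝ) < γ := by exact_mod_cast hγ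
  have hs := Real.sqrt_pos.mpr hg
  have h1 : pE (fun π => gL (BB n γ) (aw w (β / Real.sqrt γ) π K)) ≤ β / Real.sqrt γ * pE (MM w) + n := by
    rw [← pE_smul, ← pE_const (α := Equiv.Perm (Fin K × Bool)) (n:ℝ), ← pE_add]
    refine pE_mono fun π => ?_
    refine (gL_le hB _ (β / Real.sqrt γ * MM w π) fun σ _ => ?_).trans ?_
    · rw [aw_full]
      have : -Hp w π σ ≤ MM w π := Finset.le_sup' (fun σ => - Hp w π σ) (mem_univ σ)
      gcongr
    · have := log_card_le _ hB
      linarith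
  have h2 : β * ∫ J, mxB (BB n γ) hB J ∂(gm (Fin n × Fin n)) ≤ ∫ J, gL (BB n γ) (fun σ => (β / Real.sqrt (2*n)) * lf sS J σ) ∂(gm (Fin n × Fin n)) := by
    rw [← integral_const_mul]
    refine integral_mono ((mxB_integrable _ _).const_mul _) ?_ fun J => ?_
    · have := gL_integrable (B := BB n γ) sS hB sS_pm (fun _ : Fin n → Bool => (0:ℝ)) (β / Real.sqrt (2*n))
      simpa using this
    · obtain ⟨σ, hσ, he⟩ := Finset.exists_mem_eq_sup' hB (XJ J)
      have h3 : (β / Real.sqrt (2*n)) * lf sS J σ = β * XJ J σ := by unfold XJ; ring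
      have h4 := gL_ge (B := BB n γ) (fun σ => (β / Real.sqrt (2*n)) * lf sS J σ) hσ
      simp only [h3] at h4
      unfold mxB
      simp only [he]
      exact h4
  have h5 := gauge_lower (BB n γ) hB
  have h6 := BB_prob (n := n) γ hγ hn0
  change SS n - _ * (2 * SS n) ≤ _ at h5
  have h7 : pE (fun τ : Fin n → Bool => if τ ∈ BB n γ then (0:ℝ) else 1) * (2 * SS n) ≤ γ / n * (2 * SS n) := by gcongr
  have h8 : SS n - 2 * γ / n * SS n ≤ ∫ J, mxB (BB n γ) hB J ∂(gm (Fin n × Fin n)) := by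
    have : 2 * (γ:ℝ) / n * SS n = γ / n * (2 * SS n) := by ring
    linarith
  have h9 := mul_le_mul_of_nonneg_left h8 hβ.le
  have h3 : β * (SS n - 2 * γ / n * SS n) - n * (1 + EE β γ) ≤ β * (pE (MM w) / Real.sqrt γ) := by
    have : β * (pE (MM w) / Real.sqrt γ) = β / Real.sqrt γ * pE (MM w) := by ring
    rw [this]; linarith
  have h4 : β * (SS n - 2 * γ / n * SS n - n * (1 + EE β γ) / β) = β * (SS n - 2 * γ / n * SS n) - n * (1 + EE β γ) := by field_simp
  rw [← h4] at h3
  exact le_of_mul_le_mul_left h3 hβ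

lemma SS_nonneg (n : ℕ) : 0 ≤ SS n := by
  have hneg := mxB_flip (univ : Finset (Fin n → Bool)) univ_nonempty (fun _ => -1) (fun _ => Or.inr rfl)
  have hi := mxB_integrable (univ : Finset (Fin n → Bool)) univ_nonempty
  have h : 0 ≤ ∫ J, (mxB (univ : Finset (Fin n → Bool)) univ_nonempty J + mxB (univ : Finset (Fin n → Bool)) univ_nonempty (fun p => J p * (-1))) ∂(gm (Fin n × Fin n)) := by
    refine integral_nonneg fun J => ?_
    have h1 : XJ J (fun _ => true) ≤ mxB (univ : Finset (Fin n → Bool)) univ_nonempty J := Finset.le_sup' _ (mem_univ _)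
    have h2 : XJ (fun p => J p * (-1)) (fun _ => true) ≤ mxB (univ : Finset (Fin n → Bool)) univ_nonempty (fun p => J p * (-1)) := Finset.le_sup' _ (mem_univ _)
    rw [XJ_neg] at h2
    show 0 ≤ _
    linarith
  rw [integral_add hi hneg.1, hneg.2] at h
  unfold SS
  linarith

lemma EE_tendsto (β : ℝ) (hβ : 0 < β) : Tendsto (fun γ : ℕ => EE β γ) atTop (nhds 0) := by
  have hsq : Tendsto (fun γ : ℕ => Real.sqrt (γ:ℝ)) atTop atTop :=
    Real.tendsto_sqrt_atTop.comp tendsto_natCast_atTop_atTop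
  have h1 : Tendsto (fun x : ℝ => 8 * β * (Real.log x ^ 1 / (1 * x + 0)) + (4*β^2 + 12*β^3 + 2*β) * x⁻¹) atTop (nhds (8 * β * 0 + (4*β^2 + 12*β^3 + 2*β) * 0)) :=
    ((Real.tendsto_pow_log_div_mul_add_atTop 1 0 1 one_ne_zero).const_mul _).add (tendsto_inv_atTop_zero.const_mul _)
  rw [mul_zero, mul_zero, add_zero] at h1
  have h2 := h1.comp hsq
  refine squeeze_zero' (Filter.Eventually.of_forall fun γ => ?_) ?_ h2
  · unfold EE
    have : 0 ≤ Real.log (1 + (γ:ℝ)/4) := Real.log_nonneg (by have : (0:ℝ) ≤ (γ:ℝ)/4 := by positivity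
                                                             linarith)
    positivity
  · filter_upwards [Filter.eventually_ge_atTop 2] with γ hγ
    have hg : (2:ℝ) ≤ γ := by exact_mod_cast hγ
    have hs : 0 < Real.sqrt (γ:ℝ) := Real.sqrt_pos.mpr (by linarith)
    have e : Real.log (1 + (γ:ℝ)/4) ≤ 2 * Real.log (Real.sqrt γ) := by
      rw [Real.log_sqrt (by linarith)]
      have := Real.log_le_log (by positivity : 0 < 1 + (γ:ℝ)/4) (by linarith : 1 + (γ:ℝ)/4 ≤ γ)
      linarith
    simp only [Function.comp, EE, pow_one, one_mul, add_zero]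
    rw [div_le_iff₀ hs]
    have : (8 * β * (Real.log (Real.sqrt γ) / Real.sqrt γ) + (4*β^2 + 12*β^3 + 2*β) * (Real.sqrt γ)⁻¹) * Real.sqrt γ
       = 8 * β * Real.log (Real.sqrt γ) + (4*β^2 + 12*β^3 + 2*β) := by field_simp
    rw [this]
    nlinarith

end mean

theorem mean_bound (Pstar : ℝ)
    (hP : Tendsto (fun n : ℕ =>
        (n : ℝ)⁻¹ * ∫ J, (⨆ σ : Fin n → Bool, -HSK n J σ) ∂(skMeasure n))
      atTop (nhds Pstar)) (ε : ℝ) (hε : 0 < ε) :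
    ∃ γ₀ : ℕ, 1 ≤ γ₀ ∧ ∀ γ : ℕ, γ ≥ γ₀ → ∃ n₀ : ℕ, ∀ n : ℕ, n ≥ n₀ → ∀ (K : ℕ) (w : Fin K × Bool → Fin n),
      (∀ i, (univ.filter (fun x => w x = i)).card = γ) → 2 * K = n * γ →
      |pE (MM w) / (n * Real.sqrt γ) - Pstar| ≤ ε := by
  simp only [← SS_eq] at hP
  set β := 8 / ε with hβ
  have hβ0 : 0 < β := by positivity
  have h1 : ∀ᶠ γ : ℕ in atTop, EE β γ ≤ 1 := (EE_tendsto β hβ0).eventually (Iic_mem_nhds one_pos)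
  have hsq : Tendsto (fun γ : ℕ => Real.sqrt (γ:ℝ)) atTop atTop :=
    Real.tendsto_sqrt_atTop.comp tendsto_natCast_atTop_atTop
  have h2 : ∀ᶠ γ : ℕ in atTop, 4 * β ≤ Real.sqrt γ := hsq.eventually_ge_atTop _
  obtain ⟨γ₀, hγ₀⟩ := Filter.eventually_atTop.mp ((h1.and h2).and (Filter.eventually_ge_atTop 1))
  refine ⟨γ₀, (hγ₀ γ₀ le_rfl).2, fun γ hγ => ?_⟩
  obtain ⟨⟨hE, hs⟩, hg1⟩ := hγ₀ γ hγ
  have hg : (0:ℝ) < γ := by exact_mod_cast hg1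
  have hs0 := Real.sqrt_pos.mpr hg
  have hb : β / Real.sqrt γ ≤ 1/4 := by rw [div_le_iff₀ hs0]; linarith
  have h3 : ∀ᶠ n : ℕ in atTop, |(n:ℝ)⁻¹ * SS n - Pstar| < ε/4 := by
    have := (Metric.tendsto_nhds.mp hP) (ε/4) (by positivity)
    simpa [Real.dist_eq] using this
  have h4 : Tendsto (fun n : ℕ => 2 * (γ:ℝ) * (n:ℝ)⁻¹ * ((n:ℝ)⁻¹ * SS n)) atTop (nhds (2 * γ * 0 * Pstar)) :=
    (tendsto_inv_atTop_nhds_zero_nat.const_mul _).mul hP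
  rw [mul_zero, zero_mul] at h4
  have h5 : ∀ᶠ n : ℕ in atTop, 2 * (γ:ℝ) * (n:ℝ)⁻¹ * ((n:ℝ)⁻¹ * SS n) < ε/4 := h4.eventually (Iio_mem_nhds (by positivity))
  obtain ⟨n₀, hn₀⟩ := Filter.eventually_atTop.mp ((h3.and h5).and (Filter.eventually_gt_atTop γ))
  refine ⟨n₀, fun n hn K w hw hK => ?_⟩
  obtain ⟨⟨h6, h7⟩, h8⟩ := hn₀ n hn
  have hn0 : 0 < n := by omega
  have hn' : (0:ℝ) < n := by exact_mod_cast hn0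
  have hu := mean_up w γ β hw hg1 hβ0 hb hn0 hK
  have hl := mean_lo w γ β hw hg1 hβ0 hb h8 hK (SS_nonneg n)
  have e1 : pE (MM w) / (n * Real.sqrt γ) = (n:ℝ)⁻¹ * (pE (MM w) / Real.sqrt γ) := by field_simp
  rw [e1]
  have hu' := mul_le_mul_of_nonneg_left hu (by positivity : 0 ≤ (n:ℝ)⁻¹)
  have hl' := mul_le_mul_of_nonneg_left hl (by positivity : 0 ≤ (n:ℝ)⁻¹)
  have e2 : (n:ℝ)⁻¹ * (SS n + n * (1 + EE β γ) / β) = (n:ℝ)⁻¹ * SS n + (1 + EE β γ) / β := by field_simp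
  have e3 : (n:ℝ)⁻¹ * (SS n - 2 * γ / n * SS n - n * (1 + EE β γ) / β) = (n:ℝ)⁻¹ * SS n - 2 * (γ:ℝ) * (n:ℝ)⁻¹ * ((n:ℝ)⁻¹ * SS n) - (1 + EE β γ) / β := by
    field_simp
  rw [e2] at hu'
  rw [e3] at hl'
  have e4 : (1 + EE β γ) / β ≤ ε / 4 := by
    rw [div_le_iff₀ hβ0, hβ]
    have : ε / 4 * (8/ε) = 2 := by field_simp; norm_num
    rw [this]; linarith
  rw [abs_lt] at h6
  rw [abs_le]
  constructor <;> linarith [h6.1, h6.2]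

open MeasureTheory Filter Finset
set_option linter.unusedSectionVars false
set_option linter.unusedVariables false

/-! ### Part 10: concentration over uniform permutations -/

section conc

lemma pE_equiv_ne {α β : Type*} [Fintype α] [Fintype β] (e : α ≃ β) (f : β → ℝ) :
    pE (fun a => f (e a)) = pE f := by
  unfold pE; rw [Equiv.sum_comp e f, Fintype.card_congr e]

lemma pE_prod {α β : Type*} [Fintype α] [Fintype β] (f : α × β → ℝ) :
    pE f = pE (fun a => pE (fun b => f (a, b))) := by
  unfold pE
  rw [Fintype.sum_prod_type, ← Finset.sum_div, div_div, Fintype.card_prod, Nat.cast_mul, mul_comm (Fintype.card α : ℝ)]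

lemma exp_le_lin {a x : ℝ} (ha : 0 < a) (hx : |x| ≤ a) :
    Real.exp x ≤ Real.cosh a + x * (Real.sinh a / a) := by
  obtain ⟨h1, h2⟩ := abs_le.mp hx
  have q1 : 0 ≤ (1 + x/a)/2 := by
    have : -1 ≤ x/a := by rw [le_div_iff₀ ha]; linarith
    linarith
  have q2 : 0 ≤ (1 - x/a)/2 := by
    have : x/a ≤ 1 := by rw [div_le_iff₀ ha]; linarith
    linarith
  have h := convexOn_exp.2 (Set.mem_univ a) (Set.mem_univ (-a)) q1 q2 (by ring)
  simp only [smul_eq_mul] at h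
  have e : (1 + x/a)/2 * a + (1 - x/a)/2 * (-a) = x := by field_simp; ring
  rw [e] at h
  rw [Real.cosh_eq, Real.sinh_eq]
  refine h.trans (le_of_eq ?_)
  field_simp; ring

lemma pE_hoeffding {α : Type*} [Fintype α] [Nonempty α] (X : α → ℝ) (a : ℝ) (ha : 0 ≤ a)
    (hX : ∀ i, |X i| ≤ a) (h0 : pE X = 0) : pE (fun i => Real.exp (X i)) ≤ Real.exp (a^2/2) := by
  rcases ha.eq_or_lt with rfl | ha
  · have : ∀ i, X i = 0 := fun i => abs_eq_zero.mp (le_antisymm (hX i) (abs_nonneg _))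
    simp [this, pE_const]
  · calc pE (fun i => Real.exp (X i)) ≤ pE (fun i => Real.cosh a + (Real.sinh a / a) * X i) :=
          pE_mono fun i => by have := exp_le_lin ha (hX i); linarith [mul_comm (X i) (Real.sinh a / a)]
      _ = Real.cosh a := by rw [pE_add, pE_const, pE_smul, h0]; ring
      _ ≤ _ := Real.cosh_le_exp_half_sq a

lemma perm_mgf (P : Type) [Fintype P] : ∀ [DecidableEq P] (f : Equiv.Perm P → ℝ) (c : ℝ), 0 ≤ c →
    (∀ π x y, |f (π * Equiv.swap x y) - f π| ≤ c) →
    pE (fun π => Real.exp (f π - pE f)) ≤ Real.exp (2 * c^2 * Fintype.card P) := by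
  refine Fintype.induction_empty_option (P := fun P _ => ∀ [DecidableEq P] (f : Equiv.Perm P → ℝ) (c : ℝ), 0 ≤ c →
    (∀ π x y, |f (π * Equiv.swap x y) - f π| ≤ c) →
    pE (fun π => Real.exp (f π - pE f)) ≤ Real.exp (2 * c^2 * Fintype.card P)) ?_ ?_ ?_ P
  · intro α β hβ e ih _ f c hc hf
    classical
    let _ : Fintype α := Fintype.ofEquiv β e.symm
    have h := ih (fun π => f (e.permCongr π)) c hc ?_
    · rw [pE_equiv_ne e.permCongr f, pE_equiv_ne e.permCongr (fun π => Real.exp (f π - pE f))] at h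
      rwa [Fintype.card_congr e] at h
    · intro π x y
      have : e.permCongr (π * Equiv.swap x y) = e.permCongr π * Equiv.swap (e x) (e y) := by
        ext z
        simp only [Equiv.permCongr_apply, Equiv.Perm.mul_apply]
        congr 2
        obtain ⟨z, rfl⟩ := e.surjective z
        rw [Equiv.symm_apply_apply, Equiv.swap_apply_def, Equiv.swap_apply_def]
        simp only [e.injective.eq_iff]
        split_ifs <;> simp
      simp only [this]
      exact hf _ _ _
  · intro _ f c hc hf
    have : ∀ π, f π = f 1 := fun π => congrArg f (Subsingleton.elim _ _)
    have h2 : f = fun _ => f 1 := funext this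
    rw [h2, pE_const]
    simp [pE_const]
  · intro α _ ih dec f c hc hf
    classical
    obtain rfl : dec = (fun a b => Option.instDecidableEq a b) := Subsingleton.elim _ _
    set g : Option α → Equiv.Perm α → ℝ := fun i σ => f (Equiv.Perm.decomposeOption.symm (i, σ)) with hg
    have hleft : ∀ (τ : Equiv.Perm (Option α)) x y, |f (Equiv.swap x y * τ) - f τ| ≤ c := by
      intro τ x y
      rw [Equiv.swap_mul_eq_mul_swap]; exact hf _ _ _
    have hgi : ∀ i i' σ, |g i σ - g i' σ| ≤ 2 * c := by
      intro i i' σ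
      simp only [hg, Equiv.Perm.decomposeOption_symm_apply]
      have h1 := hleft (Equiv.optionCongr σ) none i
      have h2 := hleft (Equiv.optionCongr σ) none i'
      rw [abs_le] at *
      constructor <;> linarith [h1.1, h1.2, h2.1, h2.2]
    have hgs : ∀ i π x y, |g i (π * Equiv.swap x y) - g i π| ≤ c := by
      intro i π x y
      simp only [hg, Equiv.Perm.decomposeOption_symm_apply]
      have : Equiv.optionCongr (π * Equiv.swap x y) = Equiv.optionCongr π * Equiv.swap (some x) (some y) := by
        rw [← Equiv.optionCongr_swap]; exact Equiv.optionCongr_trans (Equiv.swap x y) π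
      rw [this, ← mul_assoc]
      exact hf _ _ _
    have hmean : pE f = pE (fun i => pE (g i)) := by
      rw [← pE_equiv_ne Equiv.Perm.decomposeOption.symm f, pE_prod]
    set F : Option α → ℝ := fun i => pE (g i) with hF
    have hFF : ∀ i i', |F i - F i'| ≤ 2 * c := by
      intro i i'
      simp only [hF, ← pE_sub]
      exact pE_abs_le (hgi i i')
    have hX : ∀ i, |F i - pE F| ≤ 2 * c := by
      intro i
      have : F i - pE F = pE (fun i' => F i - F i') := by rw [pE_sub, pE_const]
      rw [this]; exact pE_abs_le (hFF i)
    have hH := pE_hoeffding (fun i => F i - pE F) (2*c) (by positivity) hX (by rw [pE_sub, pE_const, sub_self])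
    rw [← pE_equiv_ne Equiv.Perm.decomposeOption.symm, pE_prod, hmean]
    have step : ∀ i, pE (fun σ => Real.exp (f (Equiv.Perm.decomposeOption.symm (i, σ)) - pE F))
        ≤ Real.exp (2 * c^2 * Fintype.card α) * Real.exp (F i - pE F) := by
      intro i
      have h := ih (g i) c hc (hgs i)
      have e : ∀ σ, Real.exp (f (Equiv.Perm.decomposeOption.symm (i, σ)) - pE F)
          = Real.exp (F i - pE F) * Real.exp (g i σ - pE (g i)) := by
        intro σ; rw [← Real.exp_add]; congr 1; simp only [hg, hF]; ring
      simp only [e]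
      rw [pE_smul, mul_comm]
      gcongr
    refine (pE_mono step).trans ?_
    rw [pE_smul, Fintype.card_option]
    calc _ ≤ Real.exp (2 * c^2 * Fintype.card α) * Real.exp ((2*c)^2/2) := by gcongr
      _ = _ := by rw [← Real.exp_add]; congr 1; push_cast; ring

lemma pE_ind_markov {α : Type*} [Fintype α] (X : α → ℝ) (t : ℝ) :
    pE (fun a => if t ≤ X a then (1:ℝ) else 0) ≤ Real.exp (-t) * pE (fun a => Real.exp (X a)) := by
  rw [← pE_smul]
  refine pE_mono fun a => ?_
  rw [← Real.exp_add]
  split_ifs with h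
  · rw [Real.one_le_exp_iff]; linarith
  · positivity

lemma perm_conc {P : Type} [Fintype P] [DecidableEq P] [Nonempty P] (f : Equiv.Perm P → ℝ) (c : ℝ) (hc : 0 < c)
    (hf : ∀ π x y, |f (π * Equiv.swap x y) - f π| ≤ c) (t : ℝ) (ht : 0 ≤ t) :
    pE (fun π => if t ≤ |f π - pE f| then (1:ℝ) else 0) ≤ 2 * Real.exp (-(t^2 / (8 * c^2 * Fintype.card P))) := by
  have key : ∀ (g : Equiv.Perm P → ℝ), (∀ π x y, |g (π * Equiv.swap x y) - g π| ≤ c) →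
      pE (fun π => if t ≤ g π - pE g then (1:ℝ) else 0) ≤ Real.exp (-(t^2 / (8 * c^2 * Fintype.card P))) := by
    intro g hg
    have hN : (0:ℝ) < Fintype.card P := by exact_mod_cast Fintype.card_pos
    set N : ℝ := ((Fintype.card P : ℕ) : ℝ) with hNd
    set l := t / (4 * c^2 * N) with hl
    have hl0 : 0 ≤ l := by positivity
    have h1 := perm_mgf P (fun π => l * g π) (l * c) (by positivity) (by
      intro π x y
      rw [← mul_sub, abs_mul, abs_of_nonneg hl0]
      gcongr; exact hg _ _ _)
    rw [pE_smul] at h1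
    have h2 := pE_ind_markov (fun π => l * (g π) - l * pE g) (l * t)
    have h3 : pE (fun π => if t ≤ g π - pE g then (1:ℝ) else 0) ≤ pE (fun π => if l * t ≤ l * (g π) - l * pE g then (1:ℝ) else 0) := by
      refine pE_mono fun π => ?_
      split_ifs with h4 h5 h5
      · exact le_rfl
      · exact absurd (by rw [← mul_sub]; gcongr) h5
      · norm_num
      · exact le_rfl
    refine h3.trans (h2.trans ?_)
    calc _ ≤ Real.exp (-(l*t)) * Real.exp (2 * (l*c)^2 * N) := by gcongr
      _ = _ := by
        rw [← Real.exp_add]; congr 1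
        rw [hl]; field_simp; ring
  have h1 := key f hf
  have h2 := key (fun π => - f π) (by
    intro π x y
    have := hf π x y
    rw [← abs_neg]; convert this using 2; ring)
  have h3 : pE (fun π => - f π) = - pE f := by
    have := pE_smul (-1) f; simpa using this
  rw [h3] at h2
  calc _ ≤ pE (fun π => (if t ≤ f π - pE f then (1:ℝ) else 0) + (if t ≤ - f π - - pE f then (1:ℝ) else 0)) := by
        refine pE_mono fun π => ?_
        split_ifs with a1 a2 a3 a3 <;> try norm_num
        rcases le_abs.mp a1 with h | h
        · exact absurd h a2
        · exact absurd (by linarith) a3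
    _ ≤ _ := by rw [pE_add]; linarith

end conc

section MMlip
variable {n K : ℕ} (w : Fin K × Bool → Fin n)

lemma ev_abs (π : Equiv.Perm (Fin K × Bool)) (k : Fin K) (σ : Fin n → Bool) : |ev w π k σ| ≤ 1 := by
  unfold ev
  rcases spin_pm (σ (w (π (k, false)))) with h | h <;> rcases spin_pm (σ (w (π (k, true)))) with h' | h' <;> rw [h, h'] <;> norm_num

lemma Hp_swap (π : Equiv.Perm (Fin K × Bool)) (x y) (σ : Fin n → Bool) :
    |Hp w (π * Equiv.swap x y) σ - Hp w π σ| ≤ 4 := by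
  unfold Hp
  rw [← Finset.sum_sub_distrib]
  have h1 : ∑ k, (ev w (π * Equiv.swap x y) k σ - ev w π k σ)
      = ∑ k ∈ ({x.1, y.1} : Finset (Fin K)), (ev w (π * Equiv.swap x y) k σ - ev w π k σ) := by
    symm
    refine Finset.sum_subset (Finset.subset_univ _) fun k _ hk => ?_
    simp only [Finset.mem_insert, Finset.mem_singleton, not_or] at hk
    have : ∀ b, Equiv.swap x y (k, b) = (k, b) := fun b =>
      Equiv.swap_apply_of_ne_of_ne (fun h => hk.1 (by rw [← h])) (fun h => hk.2 (by rw [← h]))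
    unfold ev
    simp only [Equiv.Perm.mul_apply, this, sub_self]
  rw [h1]
  refine (Finset.abs_sum_le_sum_abs _ _).trans ?_
  refine (Finset.sum_le_sum (g := fun _ => (2:ℝ)) fun k _ => ?_).trans ?_
  · have a := abs_le.mp (ev_abs w (π * Equiv.swap x y) k σ)
    have b := abs_le.mp (ev_abs w π k σ)
    rw [abs_le]; constructor <;> linarith [a.1, a.2, b.1, b.2]
  · rw [Finset.sum_const, nsmul_eq_mul]
    have : (({x.1, y.1} : Finset (Fin K)).card : ℝ) ≤ 2 := by exact_mod_cast Finset.card_le_two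
    linarith

lemma MM_swap (π : Equiv.Perm (Fin K × Bool)) (x y) : |MM w (π * Equiv.swap x y) - MM w π| ≤ 4 := by
  have key : ∀ π₁ π₂ : Equiv.Perm (Fin K × Bool), (∀ σ, |Hp w π₁ σ - Hp w π₂ σ| ≤ 4) → MM w π₁ ≤ MM w π₂ + 4 := by
    intro π₁ π₂ h
    unfold MM
    refine Finset.sup'_le _ _ fun σ hσ => ?_
    have := Finset.le_sup' (fun σ => - Hp w π₂ σ) hσ
    have h2 := abs_le.mp (h σ)
    linarith [h2.1, h2.2]
  have a := key _ _ (Hp_swap w π x y)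
  have b := key _ _ (fun σ => by rw [abs_sub_comm]; exact Hp_swap w π x y σ)
  rw [abs_le]; constructor <;> linarith

lemma MM_conc (hK : 0 < K) (t : ℝ) (ht : 0 ≤ t) :
    pE (fun π => if t ≤ |MM w π - pE (MM w)| then (1:ℝ) else 0) ≤ 2 * Real.exp (-(t^2 / (256 * K))) := by
  have : Nonempty (Fin K × Bool) := ⟨(⟨0, hK⟩, true)⟩
  have := perm_conc (MM w) 4 (by norm_num) (MM_swap w) t ht
  refine this.trans (le_of_eq ?_)
  congr 3
  simp; ring

end MMlip

open MeasureTheory Filter Finset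
set_option linter.unusedSectionVars false
set_option linter.unusedVariables false

/-! ### Part 11: the configuration model is simple with polynomial probability -/

section simple
variable {n K : ℕ} (w : Fin K × Bool → Fin n) (γ : ℕ)

/-- the edge number `k` of the configuration -/
def eE (π : Equiv.Perm (Fin K × Bool)) (k : Fin K) : Sym2 (Fin n) :=
  s(w (π (k, false)), w (π (k, true)))

/-- a loop or a multiple edge -/
def isBad (π : Equiv.Perm (Fin K × Bool)) (k : Fin K) : Prop :=
  w (π (k, false)) = w (π (k, true)) ∨ ∃ l, l ≠ k ∧ eE w π l = eE w π k

open Classical in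
noncomputable def Bad (π : Equiv.Perm (Fin K × Bool)) : Finset (Fin K) :=
  univ.filter (fun k => isBad w π k)

lemma mem_Bad {π : Equiv.Perm (Fin K × Bool)} {k : Fin K} : k ∈ Bad w π ↔ isBad w π k := by
  simp [Bad]

/-- joint collision bound -/
lemma collide2 (hw : ∀ i, (univ.filter (fun x => w x = i)).card = γ) {a b c d : Fin K × Bool}
    (hab : a ≠ b) (hda : d ≠ a) (hdb : d ≠ b) (hdc : d ≠ c) :
    ((Fintype.card (Fin K × Bool) : ℝ) - 3) *
      pE (fun π : Equiv.Perm (Fin K × Bool) => if w (π a) = w (π b) ∧ w (π c) = w (π d) then (1:ℝ) else 0)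
      ≤ γ * pE (fun π : Equiv.Perm (Fin K × Bool) => if w (π a) = w (π b) then (1:ℝ) else 0) := by
  set T : Finset (Fin K × Bool) := univ \ {a, b, c} with hT
  set p := pE (fun π : Equiv.Perm (Fin K × Bool) => if w (π a) = w (π b) ∧ w (π c) = w (π d) then (1:ℝ) else 0) with hp
  have hp0 : 0 ≤ p := by
    refine le_of_eq_of_le (pE_const (α := Equiv.Perm (Fin K × Bool)) 0).symm ?_
    exact pE_mono fun π => by split_ifs <;> norm_num
  have h1 : ∀ d' ∈ T, pE (fun π : Equiv.Perm (Fin K × Bool) => if w (π a) = w (π b) ∧ w (π c) = w (π d') then (1:ℝ) else 0) = p := by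
    intro d' hd'
    simp only [hT, Finset.mem_sdiff, mem_univ, true_and, mem_insert, mem_singleton, not_or] at hd'
    rw [hp, ← pE_mul_right (Equiv.swap d d') (fun π : Equiv.Perm (Fin K × Bool) => if w (π a) = w (π b) ∧ w (π c) = w (π d) then (1:ℝ) else 0)]
    congr 1; funext π
    simp only [Equiv.Perm.mul_apply]
    simp only [Equiv.swap_apply_left, Equiv.swap_apply_of_ne_of_ne hda.symm (Ne.symm hd'.1),
      Equiv.swap_apply_of_ne_of_ne hdb.symm (Ne.symm hd'.2.1), Equiv.swap_apply_of_ne_of_ne hdc.symm (Ne.symm hd'.2.2)]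
  have h2 : (T.card : ℝ) * p ≤ γ * pE (fun π : Equiv.Perm (Fin K × Bool) => if w (π a) = w (π b) then (1:ℝ) else 0) := by
    rw [← nsmul_eq_mul, ← Finset.sum_const, ← Finset.sum_congr rfl h1, ← pE_sum, ← pE_smul]
    refine pE_mono fun π => ?_
    by_cases h : w (π a) = w (π b)
    · simp only [h, true_and, if_true, mul_one]
      calc _ ≤ ∑ d', (if w (π c) = w (π d') then (1:ℝ) else 0) :=
            Finset.sum_le_univ_sum_of_nonneg fun _ => by split_ifs <;> norm_num
        _ = γ := by
            rw [Equiv.sum_comp π (fun b' => if w (π c) = w b' then (1:ℝ) else 0), ← hw (w (π c))]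
            simp [eq_comm]
    · simp [h]
  refine le_trans ?_ h2
  gcongr
  have h3 : ({a, b, c} : Finset (Fin K × Bool)).card ≤ 3 := Finset.card_le_three
  have h4 : T.card + ({a, b, c} : Finset (Fin K × Bool)).card = Fintype.card (Fin K × Bool) := by
    rw [hT, Finset.card_sdiff_add_card_eq_card (Finset.subset_univ _), Finset.card_univ]
  have : (Fintype.card (Fin K × Bool) : ℝ) ≤ T.card + 3 := by exact_mod_cast (by omega)
  linarith

lemma Bad_card_le (π : Equiv.Perm (Fin K × Bool)) :
    ((Bad w π).card : ℝ) ≤ ∑ k, (if w (π (k, false)) = w (π (k, true)) then (1:ℝ) else 0)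
      + ∑ k, ∑ l ∈ univ.erase k,
        ((if w (π (l, false)) = w (π (k, false)) ∧ w (π (l, true)) = w (π (k, true)) then (1:ℝ) else 0)
        + (if w (π (l, false)) = w (π (k, true)) ∧ w (π (l, true)) = w (π (k, false)) then (1:ℝ) else 0)) := by
  classical
  rw [← Finset.sum_add_distrib]
  unfold Bad
  rw [Finset.card_filter]
  push_cast
  refine Finset.sum_le_sum fun k _ => ?_
  have hn : ∀ l, (0:ℝ) ≤ ((if w (π (l, false)) = w (π (k, false)) ∧ w (π (l, true)) = w (π (k, true)) then (1:ℝ) else 0)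
        + (if w (π (l, false)) = w (π (k, true)) ∧ w (π (l, true)) = w (π (k, false)) then (1:ℝ) else 0)) := by
    intro l; split_ifs <;> norm_num
  have hs := Finset.sum_nonneg (s := univ.erase k) fun l _ => hn l
  by_cases hb : isBad w π k
  · rw [if_pos hb]
    rcases hb with h | ⟨l, hl, h⟩
    · rw [if_pos h]; linarith
    · have h1 := Finset.single_le_sum (s := univ.erase k) (fun l _ => hn l) (Finset.mem_erase.mpr ⟨hl, mem_univ l⟩)
      have h2 : (1:ℝ) ≤ ((if w (π (l, false)) = w (π (k, false)) ∧ w (π (l, true)) = w (π (k, true)) then (1:ℝ) else 0)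
        + (if w (π (l, false)) = w (π (k, true)) ∧ w (π (l, true)) = w (π (k, false)) then (1:ℝ) else 0)) := by
        unfold eE at h
        rw [Sym2.eq_iff] at h
        rcases h with h | h
        · rw [if_pos h]; split_ifs <;> norm_num
        · rw [if_pos h]; split_ifs <;> norm_num
      have h3 : (0:ℝ) ≤ if w (π (k, false)) = w (π (k, true)) then (1:ℝ) else 0 := by split_ifs <;> norm_num
      linarith
  · rw [if_neg hb]
    have h3 : (0:ℝ) ≤ if w (π (k, false)) = w (π (k, true)) then (1:ℝ) else 0 := by split_ifs <;> norm_num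
    linarith

lemma Bad_mean (hw : ∀ i, (univ.filter (fun x => w x = i)).card = γ) (hγ : 1 ≤ γ) (hK : 3 ≤ K) :
    pE (fun π => ((Bad w π).card : ℝ)) ≤ 3 * γ^2 := by
  have hg : (1:ℝ) ≤ γ := by exact_mod_cast hγ
  have hKr : (3:ℝ) ≤ K := by exact_mod_cast hK
  have hN : (Fintype.card (Fin K × Bool) : ℝ) = 2 * K := by simp; ring
  refine (pE_mono (Bad_card_le w)).trans ?_
  have c1 : ∀ {a b : Fin K × Bool}, a ≠ b → pE (fun π : Equiv.Perm (Fin K × Bool) => if w (π a) = w (π b) then (1:ℝ) else 0) ≤ γ / (2 * K - 1) := by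
    intro a b hab
    have h := collide_prob w γ hw hab
    rw [hN] at h
    rw [le_div_iff₀ (by linarith)]
    linarith
  have c2 : ∀ {a b c d : Fin K × Bool}, a ≠ b → d ≠ a → d ≠ b → d ≠ c →
      pE (fun π : Equiv.Perm (Fin K × Bool) => if w (π a) = w (π b) ∧ w (π c) = w (π d) then (1:ℝ) else 0)
      ≤ γ^2 / ((2 * K - 1) * (2 * K - 3)) := by
    intro a b c d h1 h2 h3 h4
    have h := collide2 w γ hw h1 h2 h3 h4
    rw [hN] at h
    have h5 := h.trans (mul_le_mul_of_nonneg_left (c1 h1) (by positivity))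
    rw [← div_div, le_div_iff₀ (by linarith)]
    calc _ = (2 * K - 3) * pE (fun π : Equiv.Perm (Fin K × Bool) => if w (π a) = w (π b) ∧ w (π c) = w (π d) then (1:ℝ) else 0) := by ring
      _ ≤ _ := h5
      _ = _ := by ring
  rw [pE_add, pE_sum, pE_sum]
  have h1 : ∑ k : Fin K, pE (fun π : Equiv.Perm (Fin K × Bool) => if w (π (k, false)) = w (π (k, true)) then (1:ℝ) else 0) ≤ K * (γ / (2 * K - 1)) := by
    refine (Finset.sum_le_sum fun k _ => c1 (by simp)).trans ?_
    simp
  have h2 : ∑ k : Fin K, pE (fun π : Equiv.Perm (Fin K × Bool) => ∑ l ∈ univ.erase k,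
        ((if w (π (l, false)) = w (π (k, false)) ∧ w (π (l, true)) = w (π (k, true)) then (1:ℝ) else 0)
        + (if w (π (l, false)) = w (π (k, true)) ∧ w (π (l, true)) = w (π (k, false)) then (1:ℝ) else 0)))
      ≤ K * (K * (2 * (γ^2 / ((2 * K - 1) * (2 * K - 3))))) := by
    have hq : (0:ℝ) ≤ γ^2 / ((2 * K - 1) * (2 * K - 3)) := by
      apply div_nonneg (by positivity); nlinarith
    have : ∀ k ∈ (univ : Finset (Fin K)), pE (fun π : Equiv.Perm (Fin K × Bool) => ∑ l ∈ univ.erase k,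
        ((if w (π (l, false)) = w (π (k, false)) ∧ w (π (l, true)) = w (π (k, true)) then (1:ℝ) else 0)
        + (if w (π (l, false)) = w (π (k, true)) ∧ w (π (l, true)) = w (π (k, false)) then (1:ℝ) else 0)))
        ≤ (K * (2 * (γ^2 / ((2 * K - 1) * (2 * K - 3)))) : ℝ) := by
      intro k _
      rw [pE_sum]
      have h3 : ∀ l ∈ univ.erase k, pE (fun π : Equiv.Perm (Fin K × Bool) =>
        ((if w (π (l, false)) = w (π (k, false)) ∧ w (π (l, true)) = w (π (k, true)) then (1:ℝ) else 0)
        + (if w (π (l, false)) = w (π (k, true)) ∧ w (π (l, true)) = w (π (k, false)) then (1:ℝ) else 0)))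
        ≤ 2 * (γ^2 / ((2 * K - 1) * (2 * K - 3)) : ℝ) := by
        intro l hl
        have hne := Finset.ne_of_mem_erase hl
        rw [pE_add, two_mul]
        refine add_le_add (c2 ?_ ?_ ?_ ?_) (c2 ?_ ?_ ?_ ?_) <;> simp [hne, hne.symm]
      refine (Finset.sum_le_sum h3).trans ?_
      rw [Finset.sum_const, nsmul_eq_mul]
      gcongr
      calc (univ.erase k).card ≤ (univ : Finset (Fin K)).card := Finset.card_erase_le
        _ = K := by simp
    refine (Finset.sum_le_sum this).trans ?_
    simp
  have h3 : (K:ℝ) * (γ / (2 * K - 1)) ≤ γ := by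
    rw [mul_div_assoc', div_le_iff₀ (by linarith)]; nlinarith
  have h4 : (K:ℝ) * (K * (2 * (γ^2 / ((2 * K - 1) * (2 * K - 3))))) ≤ 2 * γ^2 := by
    have e : (K:ℝ) * (K * (2 * (γ^2 / ((2 * K - 1) * (2 * K - 3))))) = (2 * γ^2) * (K^2 / ((2 * K - 1) * (2 * K - 3))) := by ring
    rw [e]
    have : (K:ℝ)^2 / ((2 * K - 1) * (2 * K - 3)) ≤ 1 := by
      rw [div_le_one (by nlinarith)]; nlinarith
    nlinarith [sq_nonneg (γ:ℝ)]
  nlinarith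

/-- switching step -/
lemma switch (hw : ∀ i, (univ.filter (fun x => w x = i)).card = γ) (π : Equiv.Perm (Fin K × Bool)) (c : ℕ)
    (hc : (Bad w π).card ≤ c) (hK : (2 + 2 * γ) * γ + c < K) (h0 : (Bad w π).Nonempty) :
    ∃ x y, (Bad w (π * Equiv.swap x y)).card < (Bad w π).card := by
  classical
  obtain ⟨k, hk⟩ := h0
  set u : Fin K × Bool → Fin n := fun x => w (π x) with hu
  have hfib : ∀ i, (univ.filter (fun x => u x = i)).card = γ := by
    intro i
    rw [← hw i]
    exact Finset.card_bij (fun x _ => π x) (by simp [hu]) (fun a _ b _ h => π.injective h)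
      (fun b hb => ⟨π.symm b, by simpa [hu] using hb, by simp⟩)
  let Nb : Fin n → Finset (Fin n) := fun i => (univ.filter (fun x => u x = i)).image (fun x => u (x.1, !x.2))
  have hNb : ∀ i, (Nb i).card ≤ γ := fun i => Finset.card_image_le.trans (hfib i).le
  have hNmem : ∀ m i j, eE w π m = s(i, j) → j ∈ Nb i := by
    intro m i j h
    unfold eE at h
    rw [Sym2.eq_iff] at h
    rcases h with ⟨h1, h2⟩ | ⟨h1, h2⟩
    · exact Finset.mem_image.mpr ⟨(m, false), by simp [hu, h1], by simp [hu, h2]⟩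
    · exact Finset.mem_image.mpr ⟨(m, true), by simp [hu, h2], by simp [hu, h1]⟩
  set p := u (k, false) with hp
  set q := u (k, true) with hq
  set Z : Finset (Fin n) := ({p, q} ∪ Nb p) ∪ Nb q with hZ
  have hZc : Z.card ≤ 2 + 2 * γ := by
    have h1 := Finset.card_union_le ({p, q} ∪ Nb p) (Nb q)
    have h2 := Finset.card_union_le {p, q} (Nb p)
    have h3 : ({p, q} : Finset (Fin n)).card ≤ 2 := Finset.card_le_two
    have := hNb p
    have := hNb q
    rw [hZ]
    omega
  set F : Finset (Fin K) := (univ.filter (fun x => u x ∈ Z)).image Prod.fst with hF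
  have hFc : F.card ≤ (2 + 2 * γ) * γ := by
    refine Finset.card_image_le.trans ?_
    rw [Finset.card_eq_sum_card_fiberwise (f := u) (t := Z) (by intro x hx; simpa using hx)]
    calc _ ≤ ∑ i ∈ Z, γ := by
          refine Finset.sum_le_sum fun i _ => ?_
          rw [← hfib i]
          exact Finset.card_le_card (Finset.filter_subset_filter _ (Finset.filter_subset _ _))
      _ = Z.card * γ := by simp
      _ ≤ _ := Nat.mul_le_mul_right _ hZc
  obtain ⟨l, hl⟩ : ∃ l, l ∉ F ∪ Bad w π := by
    by_contra hcon
    push Not at hcon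
    have : (univ : Finset (Fin K)).card ≤ (F ∪ Bad w π).card := Finset.card_le_card fun x _ => hcon x
    have h2 := Finset.card_union_le F (Bad w π)
    simp at this
    omega
  rw [Finset.mem_union, not_or] at hl
  obtain ⟨hlF, hlB⟩ := hl
  have hlk : l ≠ k := fun h => hlB (h ▸ hk)
  set r := u (l, false) with hr
  set s := u (l, true) with hs
  have hrZ : r ∉ Z := fun h => hlF (Finset.mem_image.mpr ⟨(l, false), by simpa using h, rfl⟩)
  have hsZ : s ∉ Z := fun h => hlF (Finset.mem_image.mpr ⟨(l, true), by simpa using h, rfl⟩)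
  simp only [hZ, Finset.mem_union, Finset.mem_insert, Finset.mem_singleton, not_or] at hrZ hsZ
  have hrs : r ≠ s := fun h => hlB ((mem_Bad w).mpr (Or.inl h))
  refine ⟨(k, true), (l, true), ?_⟩
  set π' := π * Equiv.swap (k, true) (l, true) with hπ'
  have v1 : w (π' (k, false)) = p := by
    rw [hπ', Equiv.Perm.mul_apply, Equiv.swap_apply_of_ne_of_ne (by simp) (by simp)]
  have v2 : w (π' (k, true)) = s := by rw [hπ', Equiv.Perm.mul_apply, Equiv.swap_apply_left]
  have v3 : w (π' (l, false)) = r := by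
    rw [hπ', Equiv.Perm.mul_apply, Equiv.swap_apply_of_ne_of_ne (by simp) (by simp)]
  have v4 : w (π' (l, true)) = q := by rw [hπ', Equiv.Perm.mul_apply, Equiv.swap_apply_right]
  have v5 : ∀ m, m ≠ k → m ≠ l → ∀ b, π' (m, b) = π (m, b) := by
    intro m h1 h2 b
    rw [hπ', Equiv.Perm.mul_apply, Equiv.swap_apply_of_ne_of_ne (by simp [h1]) (by simp [h2])]
  have v6 : ∀ m, m ≠ k → m ≠ l → eE w π' m = eE w π m := by
    intro m h1 h2
    unfold eE; rw [v5 m h1 h2, v5 m h1 h2]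
  have ek : eE w π' k = s(p, s) := by unfold eE; rw [v1, v2]
  have el : eE w π' l = s(r, q) := by unfold eE; rw [v3, v4]
  have hkl : eE w π' k ≠ eE w π' l := by
    rw [ek, el, Ne, Sym2.eq_iff]
    rintro (⟨h1, h2⟩ | ⟨h1, h2⟩)
    · exact hrZ.1.1.1 h1.symm
    · exact hrs h2.symm
  have gk : ¬ isBad w π' k := by
    rintro (h | ⟨m, hm, h⟩)
    · rw [v1, v2] at h; exact hsZ.1.1.1 h.symm
    · by_cases hml : m = l
      · subst hml; exact hkl h.symm
      · rw [v6 m hm hml, ek] at h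
        exact hsZ.1.2 (hNmem _ _ _ h)
  have gl : ¬ isBad w π' l := by
    rintro (h | ⟨m, hm, h⟩)
    · rw [v3, v4] at h; exact hrZ.1.1.2 h
    · by_cases hmk : m = k
      · subst hmk; exact hkl h
      · rw [v6 m hmk hm, el, Sym2.eq_swap] at h
        exact hrZ.2 (hNmem _ _ _ h)
  apply Finset.card_lt_card
  rw [Finset.ssubset_iff_of_subset]
  · exact ⟨k, hk, fun h => gk ((mem_Bad w).mp h)⟩
  · intro m hm
    rw [mem_Bad] at hm ⊢
    have hmk : m ≠ k := fun h => gk (h ▸ hm)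
    have hml : m ≠ l := fun h => gl (h ▸ hm)
    rcases hm with h | ⟨m', hm', h⟩
    · left; rwa [v5 m hmk hml, v5 m hmk hml] at h
    · right
      refine ⟨m', hm', ?_⟩
      have h1 : m' ≠ k := by
        rintro rfl
        exact gk (Or.inr ⟨m, hm'.symm, h.symm⟩)
      have h2 : m' ≠ l := by
        rintro rfl
        exact gl (Or.inr ⟨m, hm'.symm, h.symm⟩)
      rwa [v6 m' h1 h2, v6 m hmk hml] at h

noncomputable def Ac (c : ℕ) : Finset (Equiv.Perm (Fin K × Bool)) := univ.filter (fun π => (Bad w π).card ≤ c)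

lemma Ac_step (hw : ∀ i, (univ.filter (fun x => w x = i)).card = γ) (c : ℕ)
    (hK : (2 + 2 * γ) * γ + (c + 1) < K) : (Ac w (c+1)).card ≤ (2*K)^2 * (Ac w c).card := by
  classical
  have hsub : Ac w (c+1) ⊆ (univ ×ˢ Ac w c : Finset (((Fin K × Bool) × (Fin K × Bool)) × Equiv.Perm (Fin K × Bool))).image
      (fun z => z.2 * Equiv.swap z.1.1 z.1.2) := by
    intro π hπ
    simp only [Ac, mem_filter, mem_univ, true_and] at hπ
    have : ∃ x y, (Bad w (π * Equiv.swap x y)).card ≤ c := by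
      by_cases h : (Bad w π).card ≤ c
      · have : 0 < K := by omega
        refine ⟨(⟨0, this⟩, true), (⟨0, this⟩, true), ?_⟩
        rw [Equiv.swap_self]; exact h
      · obtain ⟨x, y, hxy⟩ := switch w γ hw π (c+1) hπ hK (Finset.card_pos.mp (by omega))
        exact ⟨x, y, by omega⟩
    obtain ⟨x, y, h⟩ := this
    refine Finset.mem_image.mpr ⟨((x, y), π * Equiv.swap x y), ?_, ?_⟩
    · simp [Ac, h]
    · simp
  refine (Finset.card_le_card hsub).trans (Finset.card_image_le.trans ?_)
  rw [Finset.card_product, Finset.card_univ]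
  simp only [Fintype.card_prod, Fintype.card_fin, Fintype.card_bool]
  apply le_of_eq; ring

lemma Ac_bound (hw : ∀ i, (univ.filter (fun x => w x = i)).card = γ) (c : ℕ)
    (hK : (2 + 2 * γ) * γ + c < K) : (Ac w c).card ≤ (2*K)^(2*c) * (Ac w 0).card := by
  induction c with
  | zero => simp
  | succ c ih =>
    refine (Ac_step w γ hw c hK).trans ?_
    calc _ ≤ (2*K)^2 * ((2*K)^(2*c) * (Ac w 0).card) := Nat.mul_le_mul_left _ (ih (by omega))
      _ = _ := by ring

lemma simple_prob (hw : ∀ i, (univ.filter (fun x => w x = i)).card = γ) (hγ : 1 ≤ γ)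
    (hK : (2 + 2 * γ) * γ + 6 * γ^2 < K) :
    (Fintype.card (Equiv.Perm (Fin K × Bool)) : ℝ) ≤ 2 * (2*K)^(12*γ^2) * (Ac w 0).card := by
  have hK3 : 3 ≤ K := by nlinarith
  have h1 := Bad_mean w γ hw hγ hK3
  have h2 := Ac_bound w γ hw (6*γ^2) hK
  set T : ℝ := (Fintype.card (Equiv.Perm (Fin K × Bool)) : ℝ) with hT
  have hT0 : 0 < T := by rw [hT]; exact_mod_cast Fintype.card_pos
  -- Markov
  have h3 : (6 * γ^2 : ℝ) * (T - (Ac w (6*γ^2)).card) ≤ ∑ π, ((Bad w π).card : ℝ) := by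
    have : (T - (Ac w (6*γ^2)).card) = ((univ.filter (fun π => ¬ (Bad w π).card ≤ 6*γ^2)).card : ℝ) := by
      have := Finset.card_filter_add_card_filter_not (s := (univ : Finset (Equiv.Perm (Fin K × Bool)))) (fun π => (Bad w π).card ≤ 6*γ^2)
      rw [Finset.card_univ] at this
      rw [hT, ← this]; unfold Ac; push_cast; ring
    rw [this, mul_comm, ← nsmul_eq_mul, ← Finset.sum_const]
    refine (Finset.sum_le_sum (g := fun π => ((Bad w π).card : ℝ)) ?_).trans
      (Finset.sum_le_univ_sum_of_nonneg fun _ => Nat.cast_nonneg _)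
    intro π hπ
    have h4 := (Finset.mem_filter.mp hπ).2
    have : 6 * γ^2 ≤ (Bad w π).card := by omega
    exact_mod_cast this
  unfold pE at h1
  rw [div_le_iff₀ hT0] at h1
  have hg : (1:ℝ) ≤ γ := by exact_mod_cast hγ
  have hg2 : (0:ℝ) < 3 * γ^2 := by positivity
  have h5 : T ≤ 2 * (Ac w (6*γ^2)).card := by
    have := h3.trans h1
    have : (3 * (γ:ℝ)^2) * T ≤ (3 * (γ:ℝ)^2) * (2 * (Ac w (6*γ^2)).card) := by linarith
    exact le_of_mul_le_mul_left this hg2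
  have h6 : ((Ac w (6*γ^2)).card : ℝ) ≤ (2*K)^(12*γ^2) * (Ac w 0).card := by
    rw [show 12*γ^2 = 2*(6*γ^2) by ring]; exact_mod_cast h2
  linarith

end simple

open MeasureTheory Filter Finset
set_option linter.unusedSectionVars false
set_option linter.unusedVariables false

/-! ### Part 12: conditioning the configuration model on simplicity gives the uniform measure -/

section unif
variable {n K : ℕ} (w : Fin K × Bool → Fin n) (γ : ℕ)

/-- the mate of a half-edge -/
def bar (z : Fin K × Bool) : Fin K × Bool := (z.1, !z.2)

lemma bar_bar (z : Fin K × Bool) : bar (bar z) = z := by simp [bar]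

lemma eq_or_bar {z z' : Fin K × Bool} (h : z.1 = z'.1) : z' = z ∨ z' = bar z := by
  obtain ⟨k, b⟩ := z
  obtain ⟨l, c⟩ := z'
  simp only at h
  subst h
  cases b <;> cases c <;> simp [bar]

/-- darts of the configuration -/
def dD (π : Equiv.Perm (Fin K × Bool)) (z : Fin K × Bool) : Fin n × Fin n := (w (π z), w (π (bar z)))

lemma dD_bar (π : Equiv.Perm (Fin K × Bool)) (z) : dD w π (bar z) = (dD w π z).swap := by
  simp [dD, bar_bar]

lemma eE_dD (π : Equiv.Perm (Fin K × Bool)) (z : Fin K × Bool) :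
    eE w π z.1 = s((dD w π z).1, (dD w π z).2) := by
  obtain ⟨k, b⟩ := z
  cases b
  · rfl
  · simp only [eE, dD, bar, Bool.not_true]; rw [Sym2.eq_swap]

lemma mem_Ac {π : Equiv.Perm (Fin K × Bool)} :
    π ∈ Ac w 0 ↔ (∀ z, (dD w π z).1 ≠ (dD w π z).2) ∧ Function.Injective (dD w π) := by
  have h0 : π ∈ Ac w 0 ↔ ∀ k, ¬ isBad w π k := by
    simp only [Ac, mem_filter, mem_univ, true_and, Nat.le_zero, Finset.card_eq_zero]
    rw [Finset.eq_empty_iff_forall_notMem]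
    simp only [mem_Bad]
  rw [h0]
  constructor
  · intro h
    have h1 : ∀ z, (dD w π z).1 ≠ (dD w π z).2 := by
      rintro ⟨k, b⟩ he
      apply h k
      left
      cases b
      · exact he
      · exact he.symm
    refine ⟨h1, fun z z' hz => ?_⟩
    have h2 : z.1 = z'.1 := by
      by_contra hne
      apply h z'.1
      right
      exact ⟨z.1, hne, by rw [eE_dD, eE_dD, hz]⟩
    rcases eq_or_bar h2 with h3 | h3
    · exact h3.symm
    · exfalso
      rw [h3, dD_bar] at hz
      apply h1 z
      have := congrArg Prod.fst hz
      exact this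
  · rintro ⟨h1, h2⟩ k (h | ⟨l, hl, h⟩)
    · exact h1 (k, false) h
    · rw [eE_dD w π (l, false), eE_dD w π (k, false), Sym2.eq_iff] at h
      rcases h with ⟨h3, h4⟩ | ⟨h3, h4⟩
      · have := h2 (Prod.ext h3 h4)
        exact hl (by simpa using this)
      · have : dD w π (l, false) = dD w π (bar (k, false)) := by
          rw [dD_bar]; exact Prod.ext h3 h4
        have := h2 this
        exact hl (by simpa [bar] using this)

/-- the graph of a configuration -/
def Gr (π : Equiv.Perm (Fin K × Bool)) : SimpleGraph (Fin n) where
  Adj i j := i ≠ j ∧ ∃ z, dD w π z = (i, j)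
  symm := ⟨by
    rintro i j ⟨h, z, hz⟩
    exact ⟨h.symm, bar z, by rw [dD_bar, hz]; rfl⟩⟩
  loopless := ⟨fun i h => h.1 rfl⟩

lemma Gr_adj {π : Equiv.Perm (Fin K × Bool)} (h : π ∈ Ac w 0) (p : Fin n × Fin n) :
    (Gr w π).Adj p.1 p.2 ↔ ∃ z, dD w π z = p := by
  constructor
  · rintro ⟨_, z, hz⟩; exact ⟨z, hz⟩
  · rintro ⟨z, rfl⟩
    exact ⟨((mem_Ac w).mp h).1 z, z, rfl⟩

lemma Gr_eq {π : Equiv.Perm (Fin K × Bool)} {G : SimpleGraph (Fin n)} (hinj : Function.Injective (dD w π))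
    (hr : ∀ p : Fin n × Fin n, G.Adj p.1 p.2 ↔ ∃ z, dD w π z = p) : π ∈ Ac w 0 ∧ Gr w π = G := by
  have h : π ∈ Ac w 0 := (mem_Ac w).mpr ⟨fun z => ((hr _).mpr ⟨z, rfl⟩).ne, hinj⟩
  refine ⟨h, ?_⟩
  ext i j
  rw [Gr_adj w h (i, j), ← hr (i, j)]

lemma fiber_perm (hw : ∀ i, (univ.filter (fun x => w x = i)).card = γ) (π : Equiv.Perm (Fin K × Bool)) (i : Fin n) :
    (univ.filter (fun x => w (π x) = i)).card = γ := by
  rw [← hw i]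
  exact Finset.card_bij (fun x _ => π x) (by simp) (fun a _ b _ h => π.injective h)
      (fun b hb => ⟨π.symm b, by simpa using hb, by simp⟩)

lemma Gr_regular (hw : ∀ i, (univ.filter (fun x => w x = i)).card = γ) {π : Equiv.Perm (Fin K × Bool)}
    (h : π ∈ Ac w 0) (v : Fin n) : ((Gr w π).neighborSet v).ncard = γ := by
  have he : (Gr w π).neighborSet v = ((univ.filter (fun x => w (π x) = v)).image (fun x => w (π (bar x))) : Finset (Fin n)) := by
    ext j
    rw [SimpleGraph.mem_neighborSet, Gr_adj w h (v, j)]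
    simp [dD]
  rw [he, Set.ncard_coe_finset, Finset.card_image_of_injOn, fiber_perm w γ hw]
  intro x hx y hy hxy
  simp only [coe_filter, mem_univ, true_and, Set.mem_ofPred_eq] at hx hy
  apply ((mem_Ac w).mp h).2
  exact Prod.ext (hx.trans hy.symm) hxy

/-- uniqueness of relabellings -/
lemma relabel {π π₁ : Equiv.Perm (Fin K × Bool)} (h : π ∈ Ac w 0) (h₁ : π₁ ∈ Ac w 0) (hG : Gr w π = Gr w π₁) :
    ∃ θ : Equiv.Perm (Fin K × Bool), (∀ z, dD w π₁ (θ z) = dD w π z) ∧ ∀ z, θ (bar z) = bar (θ z) := by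
  have h2 : ∀ z, ∃ z', dD w π₁ z' = dD w π z := by
    intro z
    rw [← Gr_adj w h₁, ← hG, Gr_adj w h]
    exact ⟨z, rfl⟩
  choose t ht using h2
  have hinj : Function.Injective t := by
    intro a b hab
    apply ((mem_Ac w).mp h).2
    rw [← ht, ← ht, hab]
  refine ⟨Equiv.ofBijective t (Finite.injective_iff_bijective.mp hinj), ht, fun z => ?_⟩
  apply ((mem_Ac w).mp h₁).2
  change dD w π₁ (t (bar z)) = dD w π₁ (bar (t z))
  rw [ht, dD_bar, dD_bar, ht]

open Classical in
noncomputable def FG (G : SimpleGraph (Fin n)) : Finset (Equiv.Perm (Fin K × Bool)) :=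
  (Ac w 0).filter (fun π => Gr w π = G)

lemma FG_le {G₁ G₂ : SimpleGraph (Fin n)} (h₁ : (FG w G₁).Nonempty) (h₂ : (FG w G₂).Nonempty) :
    (FG w G₁).card ≤ (FG w G₂).card := by
  classical
  obtain ⟨π₁, hπ₁⟩ := h₁
  obtain ⟨π₂, hπ₂⟩ := h₂
  have m : ∀ {π G}, π ∈ FG w G ↔ π ∈ Ac w 0 ∧ Gr w π = G := by intro π G; simp [FG]
  rw [m] at hπ₁ hπ₂
  have h3 : ∀ π : Equiv.Perm (Fin K × Bool), ∃ θ : Equiv.Perm (Fin K × Bool), π ∈ FG w G₁ →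
      (∀ z, dD w π₁ (θ z) = dD w π z) ∧ ∀ z, θ (bar z) = bar (θ z) := by
    intro π
    by_cases h : π ∈ FG w G₁
    · have h' := m.mp h
      obtain ⟨θ, hθ⟩ := relabel w h'.1 hπ₁.1 (h'.2.trans hπ₁.2.symm)
      exact ⟨θ, fun _ => hθ⟩
    · exact ⟨1, fun h' => absurd h' h⟩
  choose θ hθ using h3
  -- the transported configuration
  have hd : ∀ π ∈ FG w G₁, ∀ z, dD w (π * (θ π)⁻¹ * π₁⁻¹ * π₂ * θ π) z = dD w π₂ (θ π z) := by
    intro π hπ z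
    obtain ⟨a, b⟩ := hθ π hπ
    have key : ∀ x, w (π ((θ π)⁻¹ (π₁⁻¹ x))) = w x := by
      intro x
      have := congrArg Prod.fst (a ((θ π)⁻¹ (π₁⁻¹ x)))
      simp only [dD, Equiv.Perm.inv_def, Equiv.apply_symm_apply] at this
      exact this.symm
    simp only [dD, Equiv.Perm.mul_apply, key, b]
  refine Finset.card_le_card_of_injOn (fun π => π * (θ π)⁻¹ * π₁⁻¹ * π₂ * θ π) ?_ ?_
  · intro π hπ
    have hπ' := Finset.mem_coe.mp hπ
    apply Finset.mem_coe.mpr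
    rw [m]
    have e : dD w (π * (θ π)⁻¹ * π₁⁻¹ * π₂ * θ π) = dD w π₂ ∘ θ π := funext (hd π hπ')
    have := Gr_eq w (π := π * (θ π)⁻¹ * π₁⁻¹ * π₂ * θ π) (G := Gr w π₂) ?_ ?_
    · rw [← hπ₂.2]; exact this
    · rw [e]; exact (((mem_Ac w).mp hπ₂.1).2).comp (θ π).injective
    · intro p
      rw [Gr_adj w hπ₂.1, e]
      exact ((θ π).surjective.exists (p := fun z => dD w π₂ z = p))
  · intro π hπ π' hπ' heq
    have hπa := Finset.mem_coe.mp hπ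
    have hπb := Finset.mem_coe.mp hπ'
    simp only at heq
    have : θ π = θ π' := by
      ext1 z
      apply ((mem_Ac w).mp hπ₂.1).2
      rw [← hd π hπa, ← hd π' hπb, heq]
    rw [this] at heq
    simpa using heq

/-- existence of a configuration representing a regular graph -/
lemma FG_nonempty (hw : ∀ i, (univ.filter (fun x => w x = i)).card = γ) (hK : 2 * K = n * γ)
    (G : SimpleGraph (Fin n)) (hG : ∀ v, (G.neighborSet v).ncard = γ) : (FG w G).Nonempty := by
  classical
  have hdeg : ∀ v, G.degree v = γ := by
    intro v
    rw [← hG v, ← SimpleGraph.card_neighborSet_eq_degree, ← Nat.card_eq_fintype_card]; rfl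
  have hcard : Fintype.card G.edgeSet = K := by
    have h1 := G.sum_degrees_eq_twice_card_edges
    simp only [hdeg, sum_const, card_univ, Fintype.card_fin, smul_eq_mul] at h1
    rw [← SimpleGraph.edgeFinset_card]; omega
  let e : Fin K ≃ G.edgeSet := (Fintype.equivFinOfCardEq hcard).symm
  let o : Fin K → Fin n × Fin n := fun k => Quot.out (e k).1
  have ho : ∀ k, s((o k).1, (o k).2) = (e k).1 := by
    intro k
    exact Quot.out_eq (e k).1
  let φ : Fin K × Bool → Fin n × Fin n := fun z => if z.2 then (o z.1).swap else o z.1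
  have hφ : ∀ z, s((φ z).1, (φ z).2) = (e z.1).1 := by
    rintro ⟨k, b⟩
    cases b
    · simp [φ, ho]
    · simp only [φ, if_true, Prod.fst_swap, Prod.snd_swap]
      rw [Sym2.eq_swap, ho]
  have hφb : ∀ z, φ (bar z) = (φ z).swap := by
    rintro ⟨k, b⟩
    cases b <;> simp [φ, bar]
  have hadj : ∀ z, G.Adj (φ z).1 (φ z).2 := by
    intro z
    rw [← SimpleGraph.mem_edgeSet, hφ]
    exact (e z.1).2
  have hinj : Function.Injective φ := by
    intro z z' h
    have h1 : z.1 = z'.1 := by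
      apply e.injective
      apply Subtype.ext
      rw [← hφ, ← hφ, h]
    rcases eq_or_bar h1 with h3 | h3
    · exact h3.symm
    · exfalso
      rw [h3, hφb] at h
      exact (hadj z).ne (congrArg Prod.fst h)
  have hsurj : ∀ p : Fin n × Fin n, G.Adj p.1 p.2 → ∃ z, φ z = p := by
    intro p hp
    obtain ⟨k, hk⟩ := e.surjective ⟨s(p.1, p.2), by rwa [SimpleGraph.mem_edgeSet]⟩
    have h1 := hφ (k, false)
    rw [hk, Sym2.eq_iff] at h1
    rcases h1 with h1 | h1
    · exact ⟨(k, false), Prod.ext h1.1 h1.2⟩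
    · refine ⟨bar (k, false), ?_⟩
      rw [hφb]
      exact Prod.ext h1.2 h1.1
  have hfib : ∀ i, (univ.filter (fun z => (φ z).1 = i)).card = γ := by
    intro i
    rw [← hdeg i, ← SimpleGraph.card_neighborFinset_eq_degree]
    refine Finset.card_bij (fun z _ => (φ z).2) ?_ ?_ ?_
    · intro z hz
      simp only [mem_filter, mem_univ, true_and] at hz
      rw [SimpleGraph.mem_neighborFinset, ← hz]; exact hadj z
    · intro a ha b hb hab
      simp only [mem_filter, mem_univ, true_and] at ha hb
      exact hinj (Prod.ext (ha.trans hb.symm) hab)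
    · intro j hj
      rw [SimpleGraph.mem_neighborFinset] at hj
      obtain ⟨z, hz⟩ := hsurj (i, j) hj
      exact ⟨z, by simp [hz], by simp [hz]⟩
  have hfe : ∀ i, Nonempty ({z // (φ z).1 = i} ≃ {z // w z = i}) := by
    intro i
    apply Fintype.card_eq.mp
    rw [Fintype.card_subtype, Fintype.card_subtype, hfib, hw]
  let π : Equiv.Perm (Fin K × Bool) := Equiv.ofFiberEquiv (f := fun z => (φ z).1) (g := w) fun i => (hfe i).some
  have hπ : ∀ z, w (π z) = (φ z).1 := fun z => Equiv.ofFiberEquiv_map _ z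
  have hD : dD w π = φ := by
    funext z
    refine Prod.ext (hπ z) ?_
    change w (π (bar z)) = _
    rw [hπ, hφb]; rfl
  have := Gr_eq w (π := π) (G := G) (by rw [hD]; exact hinj) (by
    intro p
    rw [hD]
    constructor
    · exact hsurj p
    · rintro ⟨z, rfl⟩; exact hadj z)
  exact ⟨π, by simp [FG, this]⟩

open Classical in
/-- probability under the uniform regular graph, via simple configurations -/
lemma prob_eq (hw : ∀ i, (univ.filter (fun x => w x = i)).card = γ) (hK : 2 * K = n * γ)
    (hne : (Ac w 0).Nonempty) (B : Set (SimpleGraph (Fin n))) :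
    probUniform {G : SimpleGraph (Fin n) | ∀ v, (G.neighborSet v).ncard = γ} B
      = (((Ac w 0).filter (fun π => Gr w π ∈ B)).card : ℝ) / (Ac w 0).card := by
  obtain ⟨π₀, hπ₀⟩ := hne
  set M := (FG w (Gr w π₀)).card with hM
  have h0 : (FG w (Gr w π₀)).Nonempty := ⟨π₀, by simp [FG, hπ₀]⟩
  have hM0 : 0 < M := Finset.card_pos.mpr h0
  have hFM : ∀ G : SimpleGraph (Fin n), (∀ v, (G.neighborSet v).ncard = γ) → (FG w G).card = M := fun G hG =>
    le_antisymm (FG_le w (FG_nonempty w γ hw hK G hG) h0) (FG_le w h0 (FG_nonempty w γ hw hK G hG))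
  have count : ∀ C : Set (SimpleGraph (Fin n)),
      ((Ac w 0).filter (fun π => Gr w π ∈ C)).card = ({G : SimpleGraph (Fin n) | ∀ v, (G.neighborSet v).ncard = γ} ∩ C).ncard * M := by
    intro C
    set R := ({G : SimpleGraph (Fin n) | ∀ v, (G.neighborSet v).ncard = γ} ∩ C) with hR
    rw [Finset.card_eq_sum_card_fiberwise (f := Gr w) (t := R.toFinset)]
    · rw [Finset.sum_congr rfl (g := fun _ => M), Finset.sum_const, smul_eq_mul, Set.ncard_eq_toFinset_card']
      intro G hG
      rw [Set.mem_toFinset] at hG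
      rw [← hFM G hG.1, Finset.filter_filter]
      unfold FG
      congr 1
      apply Finset.filter_congr
      intro π _
      constructor
      · exact fun h => h.2
      · exact fun h => ⟨h ▸ hG.2, h⟩
    · intro π hπ
      have := Finset.mem_filter.mp (Finset.mem_coe.mp hπ)
      rw [Finset.mem_coe, Set.mem_toFinset]
      exact ⟨Gr_regular w γ hw this.1, this.2⟩
  have c1 := count B
  have c2 := count Set.univ
  rw [Set.inter_univ] at c2
  simp only [Set.mem_univ, Finset.filter_true] at c2
  unfold probUniform
  rw [c1, c2]
  push_cast
  rw [mul_div_mul_right]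
  exact_mod_cast hM0.ne'

end unif

open MeasureTheory Filter Finset
set_option linter.unusedSectionVars false
set_option linter.unusedVariables false

/-! ### Part 13: conclusion -/

section final
variable {n K : ℕ} (w : Fin K × Bool → Fin n) (γ : ℕ)

lemma cutSize_eq {π : Equiv.Perm (Fin K × Bool)} (h : π ∈ Ac w 0) (σ : Fin n → Bool) :
    (cutSize (Gr w π) (univ.filter (fun i => σ i = true)) : ℝ) = (K - Hp w π σ) / 2 := by
  classical
  set S : Finset (Fin n) := univ.filter (fun i => σ i = true) with hS
  have h1 : cutSize (Gr w π) S = ((S ×ˢ Sᶜ).filter (fun p => (Gr w π).Adj p.1 p.2)).card := by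
    unfold cutSize
    rw [Finset.card_filter, Finset.sum_product]
  have h2 : ((S ×ˢ Sᶜ).filter (fun p => (Gr w π).Adj p.1 p.2)).card
      = (univ.filter (fun z => (dD w π z).1 ∈ S ∧ (dD w π z).2 ∉ S)).card := by
    symm
    refine Finset.card_bij (fun z _ => dD w π z) ?_ ?_ ?_
    · intro z hz
      have hz := (Finset.mem_filter.mp hz).2
      refine Finset.mem_filter.mpr ⟨by simpa using hz, ?_⟩
      rw [Gr_adj w h]; exact ⟨z, rfl⟩
    · intro a _ b _ hab; exact ((mem_Ac w).mp h).2 hab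
    · intro p hp
      obtain ⟨ha, hb⟩ := Finset.mem_filter.mp hp
      rw [Gr_adj w h] at hb
      obtain ⟨z, rfl⟩ := hb
      refine ⟨z, ?_, rfl⟩
      simpa using ha
  rw [h1, h2, Finset.card_filter]
  push_cast
  rw [Fintype.sum_prod_type]
  have h3 : ∀ k : Fin K, ∑ b : Bool, (if (dD w π (k, b)).1 ∈ S ∧ (dD w π (k, b)).2 ∉ S then (1:ℝ) else 0)
      = (1 - ev w π k σ) / 2 := by
    intro k
    rw [Fintype.sum_bool]
    simp only [dD, bar, ev, hS, mem_filter, mem_univ, true_and, Bool.not_true, Bool.not_false]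
    cases σ (w (π (k, false))) <;> cases σ (w (π (k, true))) <;> norm_num [spin]
  simp only [h3]
  rw [← Finset.sum_div, Finset.sum_sub_distrib]
  simp [Hp]

lemma MaxCut_eq {π : Equiv.Perm (Fin K × Bool)} (h : π ∈ Ac w 0) :
    (MaxCut (Gr w π) : ℝ) = (K + MM w π) / 2 := by
  classical
  have hb : BddAbove {k : ℕ | ∃ S : Finset (Fin n), cutSize (Gr w π) S = k} :=
    (Set.finite_range (fun S : Finset (Fin n) => cutSize (Gr w π) S)).bddAbove
  apply le_antisymm
  · have hmem := Nat.sSup_mem (s := {k : ℕ | ∃ S : Finset (Fin n), cutSize (Gr w π) S = k}) ⟨_, ∅, rfl⟩ hb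
    obtain ⟨S, hS⟩ := hmem
    have e : S = univ.filter (fun i => (fun i => decide (i ∈ S)) i = true) := by ext i; simp
    unfold MaxCut
    rw [← hS, e, cutSize_eq w h]
    have := Finset.le_sup' (fun σ => - Hp w π σ) (mem_univ (fun i => decide (i ∈ S)))
    unfold MM
    linarith
  · obtain ⟨σ, hσ, he⟩ := Finset.exists_mem_eq_sup' (univ_nonempty : (univ : Finset (Fin n → Bool)).Nonempty) (fun σ => - Hp w π σ)
    have h1 : cutSize (Gr w π) (univ.filter (fun i => σ i = true)) ≤ MaxCut (Gr w π) := le_csSup hb ⟨_, rfl⟩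
    have h2 : (cutSize (Gr w π) (univ.filter (fun i => σ i = true)) : ℝ) ≤ MaxCut (Gr w π) := by exact_mod_cast h1
    rw [cutSize_eq w h] at h2
    unfold MM
    rw [he]
    linarith

lemma exists_w (n γ : ℕ) (hn : Even n) : ∃ (K : ℕ) (w : Fin K × Bool → Fin n),
    (∀ i, (univ.filter (fun x => w x = i)).card = γ) ∧ 2 * K = n * γ := by
  obtain ⟨m, rfl⟩ := hn
  have hc : Fintype.card (Fin (m * γ) × Bool) = Fintype.card (Fin (m + m) × Fin γ) := by
    simp; ring
  let e := Fintype.equivOfCardEq hc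
  refine ⟨m * γ, fun x => (e x).1, fun i => ?_, by ring⟩
  have : γ = (univ : Finset (Fin γ)).card := by simp
  conv_rhs => rw [this]
  symm
  refine Finset.card_bij (fun j _ => e.symm (i, j)) (by simp) (by simp) ?_
  intro x hx
  refine ⟨(e x).2, mem_univ _, ?_⟩
  rw [Equiv.symm_apply_eq, ← (Finset.mem_filter.mp hx).2]

lemma pow_exp_lim (c : ℝ) (hc : 0 < c) (A : ℝ) (C : ℕ) :
    Tendsto (fun n : ℕ => A * (n:ℝ)^C * Real.exp (-(c * n))) atTop (nhds 0) := by
  have h1 : Tendsto (fun n : ℕ => c * (n:ℝ)) atTop atTop :=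
    Tendsto.const_mul_atTop hc tendsto_natCast_atTop_atTop
  have h2 := ((Real.tendsto_pow_mul_exp_neg_atTop_nhds_zero C).comp h1).const_mul (A / c^C)
  rw [mul_zero] at h2
  refine h2.congr fun n => ?_
  simp only [Function.comp]
  rw [mul_pow]; field_simp

lemma err_bound (hw : ∀ i, (univ.filter (fun x => w x = i)).card = γ) (hγ : 1 ≤ γ) (hK : 2 * K = n * γ)
    (hn : (2 + 2 * γ) * γ + 6 * γ^2 < n) (hn2 : 2 * ((2 + 2 * γ) * γ + 6 * γ^2) < n) (Pstar ε : ℝ) (hε : 0 < ε)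
    (hm : |pE (MM w) / (n * Real.sqrt γ) - Pstar| ≤ ε) :
    1 - (4 * (γ:ℝ)^(12*γ^2)) * (n:ℝ)^(12*γ^2) * Real.exp (-(ε^2/128 * n)) ≤
      probUniform {G : SimpleGraph (Fin n) | ∀ v, (G.neighborSet v).ncard = γ}
            {G : SimpleGraph (Fin n) |
              |(MaxCut G : ℝ) / n - ((γ : ℝ) / 4 + Pstar * Real.sqrt ((γ : ℝ) / 4))|
                ≤ ε * Real.sqrt (γ : ℝ)} := by
  classical
  have hKn : n ≤ 2 * K := by rw [hK]; exact Nat.le_mul_of_pos_right _ hγ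
  have hK' : (2 + 2 * γ) * γ + 6 * γ^2 < K := by omega
  have hK0 : 0 < K := by omega
  have hn0 : 0 < n := by omega
  have hnr : (0:ℝ) < n := by exact_mod_cast hn0
  have hg : (0:ℝ) < γ := by exact_mod_cast hγ
  have hs := Real.sqrt_pos.mpr hg
  have hss : Real.sqrt γ ^ 2 = γ := Real.sq_sqrt hg.le
  have hKr : 2 * (K:ℝ) = n * γ := by exact_mod_cast hK
  have hsp := simple_prob w γ hw hγ hK'
  have hT0 : (0:ℝ) < (Fintype.card (Equiv.Perm (Fin K × Bool)) : ℝ) := by exact_mod_cast Fintype.card_pos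
  have hA0 : 0 < (Ac w 0).card := by
    rcases Nat.eq_zero_or_pos (Ac w 0).card with h | h
    · rw [h] at hsp; simp at hsp
    · exact h
  have hA : (0:ℝ) < (Ac w 0).card := by exact_mod_cast hA0
  rw [prob_eq w γ hw hK (Finset.card_pos.mp hA0)]
  set B := {G : SimpleGraph (Fin n) |
              |(MaxCut G : ℝ) / n - ((γ : ℝ) / 4 + Pstar * Real.sqrt ((γ : ℝ) / 4))|
                ≤ ε * Real.sqrt (γ : ℝ)} with hB
  set t := ε * n * Real.sqrt γ with ht
  have hconc := MM_conc w hK0 t (by positivity)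
  have hexp : t^2 / (256 * K) = ε^2/128 * n := by
    have : 256 * (K:ℝ) = 128 * (n * γ) := by linarith
    rw [this, ht, mul_pow, mul_pow, hss]; field_simp
  rw [hexp] at hconc
  -- the exceptional configurations
  have hgood : ∀ π ∈ Ac w 0, Gr w π ∉ B → t ≤ |MM w π - pE (MM w)| := by
    intro π hπ hnB
    by_contra hlt
    push Not at hlt
    apply hnB
    rw [hB]
    change |(MaxCut (Gr w π) : ℝ) / n - ((γ : ℝ) / 4 + Pstar * Real.sqrt ((γ : ℝ) / 4))| ≤ ε * Real.sqrt (γ : ℝ)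
    have hsq4 : Real.sqrt ((γ:ℝ)/4) = Real.sqrt γ / 2 := by
      rw [Real.sqrt_div hg.le, show (4:ℝ) = 2^2 by norm_num, Real.sqrt_sq (by norm_num)]
    rw [MaxCut_eq w hπ, hsq4]
    have e1 : ((K:ℝ) + MM w π) / 2 / n - (γ / 4 + Pstar * (Real.sqrt γ / 2))
        = (Real.sqrt γ / 2) * ((MM w π - pE (MM w)) / (n * Real.sqrt γ) + (pE (MM w) / (n * Real.sqrt γ) - Pstar)) := by
      have : (K:ℝ) = n * γ / 2 := by linarith
      rw [this]; field_simp; ring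
    rw [e1, abs_mul, abs_of_pos (by positivity : 0 < Real.sqrt γ / 2)]
    have h2 : |(MM w π - pE (MM w)) / (n * Real.sqrt γ)| ≤ ε := by
      rw [abs_div, abs_of_pos (by positivity : 0 < (n:ℝ) * Real.sqrt γ), div_le_iff₀ (by positivity)]
      rw [ht] at hlt; nlinarith
    have h3 := (abs_add_le ((MM w π - pE (MM w)) / (n * Real.sqrt γ)) (pE (MM w) / (n * Real.sqrt γ) - Pstar)).trans (add_le_add h2 hm)
    nlinarith
  have hcount := Finset.card_filter_add_card_filter_not (s := Ac w 0) (fun π => Gr w π ∈ B)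
  have hbadc : (((Ac w 0).filter (fun π => ¬ Gr w π ∈ B)).card : ℝ)
      ≤ ∑ π, (if t ≤ |MM w π - pE (MM w)| then (1:ℝ) else 0) := by
    have h1 : ((Ac w 0).filter (fun π => ¬ Gr w π ∈ B)).card ≤ (univ.filter (fun π => t ≤ |MM w π - pE (MM w)|)).card := by
      refine Finset.card_le_card fun π hπ => ?_
      obtain ⟨ha, hb⟩ := Finset.mem_filter.mp hπ
      exact Finset.mem_filter.mpr ⟨mem_univ _, hgood π ha hb⟩
    rw [Finset.sum_boole]
    exact_mod_cast h1
  unfold pE at hconc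
  rw [div_le_iff₀ hT0] at hconc
  have hbad2 : (((Ac w 0).filter (fun π => ¬ Gr w π ∈ B)).card : ℝ)
      ≤ 2 * Real.exp (-(ε^2/128 * n)) * (2 * (2*K)^(12*γ^2) * (Ac w 0).card) := by
    refine hbadc.trans (le_trans hconc ?_)
    gcongr
  rw [hKr, mul_pow] at hbad2
  rw [le_div_iff₀ hA]
  have hcr : (((Ac w 0).filter (fun π => Gr w π ∈ B)).card : ℝ) + (((Ac w 0).filter (fun π => ¬ Gr w π ∈ B)).card : ℝ) = (Ac w 0).card := by
    exact_mod_cast hcount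
  nlinarith

lemma prob_le_one {α : Type*} [Finite α] (A B : Set α) : probUniform A B ≤ 1 := by
  unfold probUniform
  apply div_le_one_of_le₀ _ (Nat.cast_nonneg _)
  exact_mod_cast Set.ncard_le_ncard Set.inter_subset_left (Set.toFinite A)

end final

/-- **Max-Cut of random regular graphs.**
If `P_*` is the limit of `n⁻¹ E[max_σ (-H^SK_n(σ))]` (which exists by the Parisi
formula), then for every `ε > 0` there is an integer `γ₀` such that for every
integer `γ ≥ γ₀`, the Max-Cut of a uniformly random simple `γ`-regular
graph on `n` vertices satisfies, w.h.p. as `n → ∞` along even `n > γ`,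
`MaxCut(R_n(γ))/n = γ/4 + P_* √(γ/4) + o_γ(√γ)`. -/
theorem maxcut_regular
    (Pstar : ℝ)
    (hP : Tendsto (fun n : ℕ =>
        (n : ℝ)⁻¹ * ∫ J, (⨆ σ : Fin n → Bool, -HSK n J σ) ∂(skMeasure n))
      atTop (nhds Pstar)) :
    ∀ ε > (0 : ℝ), ∃ γ₀ : ℕ, ∀ γ : ℕ, γ ≥ γ₀ →
      Tendsto (fun n : ℕ =>
          probUniform {G : SimpleGraph (Fin n) | ∀ v, (G.neighborSet v).ncard = γ}
            {G : SimpleGraph (Fin n) |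
              |(MaxCut G : ℝ) / n - ((γ : ℝ) / 4 + Pstar * Real.sqrt ((γ : ℝ) / 4))|
                ≤ ε * Real.sqrt (γ : ℝ)})
        (atTop ⊓ Filter.principal {n : ℕ | Even n ∧ γ < n}) (nhds 1) := by
  intro ε hε
  obtain ⟨γ₀, hγ₀, hmain⟩ := mean_bound Pstar hP ε hε
  refine ⟨γ₀, fun γ hγ => ?_⟩
  obtain ⟨n₀, hn₀⟩ := hmain γ hγ
  have hlim := pow_exp_lim (ε^2/128) (by positivity) (4 * (γ:ℝ)^(12*γ^2)) (12*γ^2)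
  have hlow : Tendsto (fun n : ℕ => 1 - (4 * (γ:ℝ)^(12*γ^2)) * (n:ℝ)^(12*γ^2) * Real.exp (-(ε^2/128 * n)))
      (atTop ⊓ Filter.principal {n : ℕ | Even n ∧ γ < n}) (nhds 1) := by
    have := (hlim.const_sub 1).mono_left (inf_le_left : atTop ⊓ Filter.principal {n : ℕ | Even n ∧ γ < n} ≤ atTop)
    rwa [sub_zero] at this
  refine tendsto_of_tendsto_of_tendsto_of_le_of_le' hlow tendsto_const_nhds ?_ ?_
  · rw [Filter.eventually_inf_principal]
    filter_upwards [Filter.eventually_ge_atTop n₀,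
      Filter.eventually_gt_atTop (2 * ((2 + 2 * γ) * γ + 6 * γ^2))] with n h1 h2 h3
    obtain ⟨K, w, hw, hK⟩ := exists_w n γ h3.1
    exact err_bound w γ hw (hγ₀.trans hγ) hK (by omega) h2 Pstar ε hε (hn₀ n h1 K w hw hK)
  · exact Filter.Eventually.of_forall fun n => prob_le_one _ _
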